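/- Let d ≥ 3 and 0 < θ ≤ 1, and let u : ℝ × ℝ^d → ℂ be the solution of the free wave equation ∂_t² u = Δ u with radial Schwartz initial data (u(0,·), ∂_t u(0,·)) = (u₀, u₁). Then there is a constant C depending only on d and θ such that ‖ |x|^{((d−2)/2)(1−θ)} u ‖_{L²_t L^{2d/((d−2)θ)}_x(ℝ × ℝ^d)} ≤ C (‖u₀‖_{Ḣ^{1/2}} + ‖u₁‖_{Ḣ^{−1/2}}). -/

import Mathlib

noncomputable section

open MeasureTheory Real Set
open scoped ENNReal

/-- Euclidean space `ℝ^d`. -/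
abbrev Euc (d : ℕ) := EuclideanSpace ℝ (Fin d)

/-- The time derivative `∂ₜ u` of `u : ℝ × ℝ^d → ℂ` (in curried form). -/
def timeDerivC (d : ℕ) (u : ℝ → Euc d → ℂ) (t : ℝ) (x : Euc d) : ℂ :=
  deriv (fun s => u s x) t

/-- The second time derivative `∂ₜ² u`. -/
def timeDeriv2C (d : ℕ) (u : ℝ → Euc d → ℂ) (t : ℝ) (x : Euc d) : ℂ :=
  deriv (deriv (fun s => u s x)) t

/-- The spatial Laplacian `Δf = ∑ⱼ ∂²f/∂xⱼ²`. -/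
def spatialLapC (d : ℕ) (f : Euc d → ℂ) (x : Euc d) : ℂ :=
  ∑ i : Fin d,
    fderiv ℝ (fun y => fderiv ℝ f y (EuclideanSpace.single i 1)) x (EuclideanSpace.single i 1)

/-- A function on `ℝ^d` is radial if it depends only on `|x|`. -/
def IsRadialC (d : ℕ) (f : Euc d → ℂ) : Prop := ∃ g : ℝ → ℂ, ∀ x, f x = g ‖x‖

/-- `f : ℝ^d → ℂ` agrees with a Schwartz function. -/
def IsSchwartzC (d : ℕ) (f : Euc d → ℂ) : Prop :=
  ∃ φ : SchwartzMap (Euc d) ℂ, ∀ x, f x = φ x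

/-- The homogeneous Sobolev norm `‖f‖_{Ḣ^s} = (∫ |ξ|^{2s} |f̂(ξ)|² dξ)^{1/2}`,
valued in `[0, ∞]`. -/
def sobolevNormC (d : ℕ) (s : ℝ) (f : Euc d → ℂ) : ℝ≥0∞ :=
  (∫⁻ ξ : Euc d,
    ENNReal.ofReal (‖ξ‖ ^ (2 * s) * ‖FourierTransform.fourier f ξ‖ ^ 2)) ^ ((1 : ℝ) / 2)

/-- The mixed space-time norm `‖u‖_{L^p_t L^q_x(I × ℝ^d)}`, valued in `[0, ∞]`. -/
def mixedNorm (d : ℕ) (p q : ℝ≥0∞) (I : Set ℝ) (u : ℝ → Euc d → ℂ) : ℝ≥0∞ :=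
  if p = ∞ then essSup (fun t => eLpNorm (u t) q volume) (volume.restrict I)
  else (∫⁻ t in I, (eLpNorm (u t) q volume) ^ p.toReal) ^ (1 / p.toReal)

/-- The norm `‖u‖_{L^∞_t Ḣ^s_x(I × ℝ^d)}`, valued in `[0, ∞]`. -/
def LinftySobolev (d : ℕ) (s : ℝ) (I : Set ℝ) (u : ℝ → Euc d → ℂ) : ℝ≥0∞ :=
  essSup (fun t => sobolevNormC d s (u t)) (volume.restrict I)

/-- Norm of the Fourier transform of a Gaussian. -/
lemma norm_integral_gaussian_char {V : Type*} [NormedAddCommGroup V] [InnerProductSpace ℝ V]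
    [FiniteDimensional ℝ V] [MeasurableSpace V] [BorelSpace V] {R : ℝ} (hR : 0 < R) (w : V) :
    ‖∫ x : V, Complex.exp ((2 * π * inner ℝ w x : ℝ) * Complex.I)
        * (Real.exp (-(π / R ^ 2) * ‖x‖ ^ 2) : ℂ)‖
      = R ^ Module.finrank ℝ V * Real.exp (-(π * R ^ 2) * ‖w‖ ^ 2) := by
  have hb : 0 < ((π / R ^ 2 : ℝ) : ℂ).re := by
    rw [Complex.ofReal_re]; positivity
  have h := GaussianFourier.integral_cexp_neg_mul_sq_norm_add hb (2 * π * Complex.I) w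
  have e : ∀ x : V, Complex.exp ((2 * π * inner ℝ w x : ℝ) * Complex.I)
        * (Real.exp (-(π / R ^ 2) * ‖x‖ ^ 2) : ℂ) =
      Complex.exp (-((π / R ^ 2 : ℝ) : ℂ) * ‖x‖ ^ 2 + 2 * π * Complex.I * inner ℝ w x) := by
    intro x
    rw [Complex.ofReal_exp, ← Complex.exp_add]
    congr 1; push_cast; ring
  simp_rw [e]
  rw [h, norm_mul]
  have h1 : (π : ℂ) / ((π / R ^ 2 : ℝ) : ℂ) = ((R ^ 2 : ℝ) : ℂ) := by
    have := Real.pi_ne_zero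
    rw [← Complex.ofReal_div]; congr 1; field_simp
  have h2 : (2 * π * Complex.I) ^ 2 * (‖w‖ : ℂ) ^ 2 / (4 * ((π / R ^ 2 : ℝ) : ℂ))
      = ((-(π * R ^ 2) * ‖w‖ ^ 2 : ℝ) : ℂ) := by
    have : (π : ℂ) ≠ 0 := by exact_mod_cast Real.pi_ne_zero
    have : (R : ℂ) ≠ 0 := by exact_mod_cast hR.ne'
    push_cast
    rw [mul_pow, Complex.I_sq]
    field_simp
    ring
  rw [h1, h2, ← Complex.ofReal_exp, Complex.norm_real, Real.norm_of_nonneg (Real.exp_pos _).le,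
    Complex.norm_cpow_eq_rpow_re_of_pos (by positivity)]
  congr 1
  have : ((Module.finrank ℝ V : ℂ) / 2).re = (Module.finrank ℝ V : ℝ) / 2 := by
    rw [show ((Module.finrank ℝ V : ℂ) / 2) = (((Module.finrank ℝ V : ℝ) / 2 : ℝ) : ℂ) by
      push_cast; rfl, Complex.ofReal_re]
  rw [this, ← Real.rpow_natCast R 2, ← Real.rpow_mul hR.le, ← Real.rpow_natCast]
  congr 1; push_cast; ring

/-- The exponential integral `x ↦ ∫ e^{2πi⟨v, x⟩} a(v) dμ(v)`. -/
def expInt {V : Type*} [NormedAddCommGroup V] [InnerProductSpace ℝ V] [MeasurableSpace V]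
    (μ : Measure V) (a : V → ℂ) (x : V) : ℂ :=
  ∫ v, Complex.exp ((2 * π * inner ℝ v x : ℝ) * Complex.I) * a v ∂μ

lemma integrable_char_mul {V : Type*} [NormedAddCommGroup V] [InnerProductSpace ℝ V]
    [MeasurableSpace V] [BorelSpace V] [SecondCountableTopology V]
    {μ : Measure V} {a : V → ℂ} (ha : Integrable a μ) (x : V) :
    Integrable (fun v => Complex.exp ((2 * π * inner ℝ v x : ℝ) * Complex.I) * a v) μ := by
  refine ha.bdd_mul (c := 1) (by fun_prop) (.of_forall fun v => ?_)
  rw [Complex.norm_exp_ofReal_mul_I]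

lemma norm_expInt_le {V : Type*} [NormedAddCommGroup V] [InnerProductSpace ℝ V]
    [MeasurableSpace V] (μ : Measure V) (a : V → ℂ) (x : V) :
    ‖expInt μ a x‖ ≤ ∫ v, ‖a v‖ ∂μ := by
  refine (norm_integral_le_integral_norm _).trans (le_of_eq ?_)
  congr 1; ext v
  rw [norm_mul, Complex.norm_exp_ofReal_mul_I, one_mul]

lemma integrable_gaussian {V : Type*} [NormedAddCommGroup V] [InnerProductSpace ℝ V]
    [FiniteDimensional ℝ V] [MeasurableSpace V] [BorelSpace V] {b : ℝ} (hb : 0 < b) :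
    Integrable (fun x : V => Real.exp (-b * ‖x‖ ^ 2)) := by
  have hb' : 0 < ((b : ℝ) : ℂ).re := by simpa using hb
  have h := GaussianFourier.integrable_cexp_neg_mul_sq_norm_add hb' 0 (0 : V)
  refine h.norm.congr (.of_forall fun x => ?_)
  simp only [zero_mul, add_zero]
  rw [show -(b : ℂ) * (‖x‖ : ℂ) ^ 2 = ((-b * ‖x‖ ^ 2 : ℝ) : ℂ) by push_cast; rfl,
    ← Complex.ofReal_exp, Complex.norm_real, Real.norm_of_nonneg (Real.exp_pos _).le]

/-- Gaussian-weighted `L²` bound for exponential integrals. -/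
lemma lintegral_expInt_sq_gaussian_le {V : Type*} [NormedAddCommGroup V] [InnerProductSpace ℝ V]
    [FiniteDimensional ℝ V] [MeasurableSpace V] [BorelSpace V] (μ : Measure V) [SFinite μ]
    {a : V → ℂ} (ha : Integrable a μ) {R : ℝ} (hR : 0 < R) :
    ∫⁻ x, ‖expInt μ a x‖ₑ ^ 2 * ENNReal.ofReal (Real.exp (-(π / R ^ 2) * ‖x‖ ^ 2)) ≤
      ∫⁻ v, ∫⁻ v', ‖a v‖ₑ * ‖a v'‖ₑ * ENNReal.ofReal
        (R ^ Module.finrank ℝ V * Real.exp (-(π * R ^ 2) * ‖v - v'‖ ^ 2)) ∂μ ∂μ := by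
  set G : V → ℝ := fun x => Real.exp (-(π / R ^ 2) * ‖x‖ ^ 2) with hG
  have hGi : Integrable G := integrable_gaussian (by positivity)
  have haa : Integrable (fun p : V × V => a p.1 * (starRingEnd ℂ) (a p.2)) (μ.prod μ) :=
    ha.mul_prod (L := ℂ) ((Complex.conjCLE : ℂ →L[ℝ] ℂ).integrable_comp ha)
  -- the double integral formula for the square
  have hsq : ∀ x, ((‖expInt μ a x‖ ^ 2 * G x : ℝ) : ℂ) =
      ∫ p : V × V, (a p.1 * (starRingEnd ℂ) (a p.2)) *
        (Complex.exp ((2 * π * inner ℝ (p.1 - p.2) x : ℝ) * Complex.I) * (G x : ℂ))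
        ∂(μ.prod μ) := by
    intro x
    have h1 : ((‖expInt μ a x‖ ^ 2 : ℝ) : ℂ) = expInt μ a x * (starRingEnd ℂ) (expInt μ a x) := by
      rw [Complex.mul_conj, Complex.normSq_eq_norm_sq]
    rw [Complex.ofReal_mul, h1]
    unfold expInt
    rw [← integral_conj, ← integral_prod_mul (L := ℂ), ← integral_mul_const]
    congr 1; ext p
    rw [map_mul, ← Complex.exp_conj, inner_sub_left]
    have : Complex.exp ((2 * π * (inner ℝ p.1 x - inner ℝ p.2 x) : ℝ) * Complex.I) =
      Complex.exp ((2 * π * inner ℝ p.1 x : ℝ) * Complex.I) *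
        Complex.exp ((starRingEnd ℂ) ((2 * π * inner ℝ p.2 x : ℝ) * Complex.I)) := by
      rw [← Complex.exp_add, map_mul, Complex.conj_ofReal, Complex.conj_I]
      congr 1; push_cast; ring
    rw [this]; ring
  have hFc : Continuous (expInt μ a) := by
    refine continuous_of_dominated (bound := fun v => ‖a v‖) (fun x => ?_) (fun x => ?_) ha.norm ?_
    · exact (integrable_char_mul ha x).aestronglyMeasurable
    · refine .of_forall fun v => ?_
      rw [norm_mul, Complex.norm_exp_ofReal_mul_I, one_mul]
    · exact .of_forall fun v => by fun_prop
  have hGc : Continuous G := by fun_prop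
  have h_Gint : Integrable (fun x => ‖expInt μ a x‖ ^ 2 * G x) := by
    refine hGi.bdd_mul (c := (∫ v, ‖a v‖ ∂μ) ^ 2) (by fun_prop) (.of_forall fun x => ?_)
    rw [norm_pow, norm_norm]
    gcongr
    exact norm_expInt_le μ a x
  have hL : ∫⁻ x, ‖expInt μ a x‖ₑ ^ 2 * ENNReal.ofReal (G x) =
      ENNReal.ofReal (∫ x, ‖expInt μ a x‖ ^ 2 * G x) := by
    rw [ofReal_integral_eq_lintegral_ofReal h_Gint
      (.of_forall fun x => mul_nonneg (by positivity) (Real.exp_pos _).le)]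
    congr 1; ext x
    rw [ENNReal.ofReal_mul (by positivity), ENNReal.ofReal_pow (norm_nonneg _), ofReal_norm]
  have hK : Integrable (Function.uncurry fun (x : V) (p : V × V) =>
      (a p.1 * (starRingEnd ℂ) (a p.2)) *
        (Complex.exp ((2 * π * inner ℝ (p.1 - p.2) x : ℝ) * Complex.I) * (G x : ℂ)))
      (volume.prod (μ.prod μ)) := by
    have h0 : Integrable (fun z : V × (V × V) => (G z.1 : ℂ) *
      (a z.2.1 * (starRingEnd ℂ) (a z.2.2))) (volume.prod (μ.prod μ)) :=
      hGi.ofReal.mul_prod (L := ℂ) haa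
    have h1 := h0.bdd_mul (c := 1) (f := fun z : V × (V × V) =>
      Complex.exp ((2 * π * inner ℝ (z.2.1 - z.2.2) z.1 : ℝ) * Complex.I))
      (Continuous.aestronglyMeasurable (by fun_prop))
      (.of_forall fun v => by rw [Complex.norm_exp_ofReal_mul_I])
    refine h1.congr (.of_forall fun z => ?_)
    simp only [Function.uncurry]; ring
  have hmain : ((∫ x, ‖expInt μ a x‖ ^ 2 * G x : ℝ) : ℂ) =
      ∫ p : V × V, (a p.1 * (starRingEnd ℂ) (a p.2)) *
        (∫ x, Complex.exp ((2 * π * inner ℝ (p.1 - p.2) x : ℝ) * Complex.I) * (G x : ℂ))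
        ∂(μ.prod μ) := by
    rw [← integral_complex_ofReal]
    simp_rw [hsq]
    rw [integral_integral_swap hK]
    simp_rw [integral_const_mul]
  rw [hL]
  have h3 : ENNReal.ofReal (∫ x, ‖expInt μ a x‖ ^ 2 * G x) ≤
      ‖((∫ x, ‖expInt μ a x‖ ^ 2 * G x : ℝ) : ℂ)‖ₑ := by
    rw [← ofReal_norm, Complex.norm_real]
    exact ENNReal.ofReal_le_ofReal (le_abs_self _)
  refine h3.trans ?_
  rw [hmain]
  refine (enorm_integral_le_lintegral_enorm _).trans ?_
  refine (lintegral_prod_le _).trans (le_of_eq ?_)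
  congr 1; ext v; congr 1; ext v'
  rw [enorm_mul, enorm_mul, ← ofReal_norm (∫ x, _), norm_integral_gaussian_char hR]
  congr 2
  rw [← ofReal_norm, RCLike.norm_conj, ofReal_norm]

lemma ENNReal.mul_le_sq_add_sq (x y : ℝ≥0∞) : x * y ≤ x ^ 2 + y ^ 2 := by
  rcases le_total x y with h | h
  · calc x * y ≤ y * y := by gcongr
      _ = y ^ 2 := (sq y).symm
      _ ≤ _ := le_add_self
  · calc x * y ≤ x * x := by gcongr
      _ = x ^ 2 := (sq x).symm
      _ ≤ _ := le_self_add

/-- Schur test form of `lintegral_expInt_sq_gaussian_le`. -/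
lemma lintegral_expInt_sq_gaussian_le_of_bound {V : Type*} [NormedAddCommGroup V]
    [InnerProductSpace ℝ V] [FiniteDimensional ℝ V] [MeasurableSpace V] [BorelSpace V]
    (μ : Measure V) [SFinite μ] {a : V → ℂ} (ha : Integrable a μ) {R : ℝ} (hR : 0 < R)
    {B : ℝ≥0∞} (hB : ∀ᵐ v ∂μ, ∫⁻ v', ENNReal.ofReal
        (R ^ Module.finrank ℝ V * Real.exp (-(π * R ^ 2) * ‖v - v'‖ ^ 2)) ∂μ ≤ B) :
    ∫⁻ x, ‖expInt μ a x‖ₑ ^ 2 * ENNReal.ofReal (Real.exp (-(π / R ^ 2) * ‖x‖ ^ 2)) ≤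
      2 * B * ∫⁻ v, ‖a v‖ₑ ^ 2 ∂μ := by
  refine (lintegral_expInt_sq_gaussian_le μ ha hR).trans ?_
  set K : V → V → ℝ≥0∞ := fun v v' => ENNReal.ofReal
        (R ^ Module.finrank ℝ V * Real.exp (-(π * R ^ 2) * ‖v - v'‖ ^ 2)) with hK
  have hKm : Measurable (Function.uncurry K) :=
    (Continuous.measurable (by fun_prop : Continuous fun p : V × V =>
      R ^ Module.finrank ℝ V * Real.exp (-(π * R ^ 2) * ‖p.1 - p.2‖ ^ 2))).ennreal_ofReal
  have hae : AEMeasurable (fun v => ‖a v‖ₑ ^ 2) μ := ha.aestronglyMeasurable.enorm.pow_const 2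
  have h1 : ∫⁻ v, ∫⁻ v', ‖a v‖ₑ ^ 2 * K v v' ∂μ ∂μ ≤ B * ∫⁻ v, ‖a v‖ₑ ^ 2 ∂μ := by
    rw [← lintegral_const_mul'' _ hae]
    refine lintegral_mono_ae ?_
    filter_upwards [hB] with v hv
    rw [lintegral_const_mul _ (hKm.of_uncurry_left), mul_comm]
    gcongr
  have hsymm : ∀ v v', K v v' = K v' v := fun v v' => by simp only [K, norm_sub_rev]
  have h2 : ∫⁻ v, ∫⁻ v', ‖a v'‖ₑ ^ 2 * K v v' ∂μ ∂μ = ∫⁻ v, ∫⁻ v', ‖a v‖ₑ ^ 2 * K v v' ∂μ ∂μ := by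
    rw [lintegral_lintegral_swap]
    · simp_rw [hsymm]
    · exact (hae.comp_snd).mul hKm.aemeasurable
  calc ∫⁻ v, ∫⁻ v', ‖a v‖ₑ * ‖a v'‖ₑ * K v v' ∂μ ∂μ
      ≤ ∫⁻ v, ∫⁻ v', (‖a v‖ₑ ^ 2 * K v v' + ‖a v'‖ₑ ^ 2 * K v v') ∂μ ∂μ := by
        refine lintegral_mono fun v => lintegral_mono fun v' => ?_
        rw [← add_mul]
        exact mul_le_mul_left (ENNReal.mul_le_sq_add_sq _ _) _
    _ = ∫⁻ v, ∫⁻ v', ‖a v‖ₑ ^ 2 * K v v' ∂μ ∂μ + ∫⁻ v, ∫⁻ v', ‖a v'‖ₑ ^ 2 * K v v' ∂μ ∂μ := by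
        rw [← lintegral_add_left']
        · refine lintegral_congr fun v => ?_
          rw [lintegral_add_left]
          exact (hKm.of_uncurry_left).const_mul _
        · exact ((hae.comp_fst).mul hKm.aemeasurable).lintegral_prod_right'
    _ ≤ _ := by
        rw [h2, mul_assoc, two_mul]
        gcongr

lemma lintegral_gaussian_eq_one {V : Type*} [NormedAddCommGroup V] [InnerProductSpace ℝ V]
    [FiniteDimensional ℝ V] [MeasurableSpace V] [BorelSpace V] {R : ℝ} (hR : 0 < R) (v : V) :
    ∫⁻ v', ENNReal.ofReal
        (R ^ Module.finrank ℝ V * Real.exp (-(π * R ^ 2) * ‖v - v'‖ ^ 2)) = 1 := by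
  have hb : 0 < π * R ^ 2 := by positivity
  rw [lintegral_sub_left_eq_self (fun w : V => ENNReal.ofReal
        (R ^ Module.finrank ℝ V * Real.exp (-(π * R ^ 2) * ‖w‖ ^ 2))) v]
  rw [← ofReal_integral_eq_lintegral_ofReal ((integrable_gaussian hb).const_mul _)
    (.of_forall fun x => by positivity), integral_const_mul,
    GaussianFourier.integral_rexp_neg_mul_sq_norm hb]
  rw [show π / (π * R ^ 2) = (R ^ 2)⁻¹ by field_simp, Real.inv_rpow (by positivity),
    ← Real.rpow_natCast R 2, ← Real.rpow_mul hR.le, ← Real.rpow_natCast]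
  have : ((2 : ℕ) : ℝ) * ((Module.finrank ℝ V : ℝ) / 2) = (Module.finrank ℝ V : ℝ) := by
    push_cast; ring
  rw [this, mul_inv_cancel₀ (by positivity), ENNReal.ofReal_one]

lemma continuous_expInt {V : Type*} [NormedAddCommGroup V] [InnerProductSpace ℝ V]
    [MeasurableSpace V] [BorelSpace V] [SecondCountableTopology V]
    {μ : Measure V} {a : V → ℂ} (ha : Integrable a μ) : Continuous (expInt μ a) := by
  refine continuous_of_dominated (bound := fun v => ‖a v‖) (fun x => ?_) (fun x => ?_) ha.norm ?_
  · exact (integrable_char_mul ha x).aestronglyMeasurable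
  · refine .of_forall fun v => ?_
    rw [norm_mul, Complex.norm_exp_ofReal_mul_I, one_mul]
  · exact .of_forall fun v => by fun_prop

/-- A Plancherel inequality for integrable functions (with a non-sharp constant). -/
lemma lintegral_expInt_sq_le {V : Type*} [NormedAddCommGroup V] [InnerProductSpace ℝ V]
    [FiniteDimensional ℝ V] [MeasurableSpace V] [BorelSpace V] {a : V → ℂ} (ha : Integrable a) :
    ∫⁻ x, ‖expInt volume a x‖ₑ ^ 2 ≤ 2 * ∫⁻ v, ‖a v‖ₑ ^ 2 := by
  have hc := continuous_expInt ha
  set G : ℕ → V → ℝ≥0∞ := fun n x => ‖expInt volume a x‖ₑ ^ 2 *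
    ENNReal.ofReal (Real.exp (-(π / ((n : ℝ) + 1) ^ 2) * ‖x‖ ^ 2)) with hG
  have hle : ∀ n, ∫⁻ x, G n x ≤ 2 * ∫⁻ v, ‖a v‖ₑ ^ 2 := fun n => by
    have := lintegral_expInt_sq_gaussian_le_of_bound volume ha
      (R := (n : ℝ) + 1) (by positivity) (B := 1)
      (.of_forall fun v => (lintegral_gaussian_eq_one (by positivity) v).le)
    simpa only [mul_one] using this
  have hlim : ∀ x, Filter.Tendsto (fun n => G n x) Filter.atTop
      (nhds (‖expInt volume a x‖ₑ ^ 2)) := fun x => by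
    have h0 : Filter.Tendsto (fun n : ℕ => (π / ((n : ℝ) + 1) ^ 2)) Filter.atTop (nhds 0) := by
      refine tendsto_const_nhds.div_atTop ?_
      refine (Filter.tendsto_pow_atTop two_ne_zero).comp ?_
      exact Filter.tendsto_atTop_add_const_right _ _ tendsto_natCast_atTop_atTop
    have h1 : Filter.Tendsto (fun n : ℕ => ENNReal.ofReal
        (Real.exp (-(π / ((n : ℝ) + 1) ^ 2) * ‖x‖ ^ 2))) Filter.atTop (nhds 1) := by
      have : Filter.Tendsto (fun n : ℕ => ENNReal.ofReal
        (Real.exp (-(π / ((n : ℝ) + 1) ^ 2) * ‖x‖ ^ 2))) Filter.atTop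
        (nhds (ENNReal.ofReal (Real.exp (-0 * ‖x‖ ^ 2)))) :=
        ENNReal.tendsto_ofReal ((Real.continuous_exp.tendsto _).comp (h0.neg.mul_const _))
      simpa using this
    have h2 := ENNReal.Tendsto.const_mul h1 (a := ‖expInt volume a x‖ₑ ^ 2) (Or.inl one_ne_zero)
    simpa only [mul_one] using h2
  calc ∫⁻ x, ‖expInt volume a x‖ₑ ^ 2
      = ∫⁻ x, Filter.liminf (fun n => G n x) Filter.atTop := by
        congr 1; ext x; exact (hlim x).liminf_eq.symm
    _ ≤ Filter.liminf (fun n => ∫⁻ x, G n x) Filter.atTop := by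
        refine lintegral_liminf_le fun n => ?_
        exact (hc.measurable.enorm.pow_const 2).mul
          (Continuous.measurable (by fun_prop : Continuous fun x : V =>
            Real.exp (-(π / ((n : ℝ) + 1) ^ 2) * ‖x‖ ^ 2))).ennreal_ofReal
    _ ≤ _ := by
        refine Filter.liminf_le_of_le (by isBoundedDefault) fun b hb => ?_
        obtain ⟨n, hn⟩ := hb.exists
        exact hn.trans (hle n)

/-- The surface measure of the unit sphere, as a measure on the ambient space. -/
def sphMeas (V : Type*) [NormedAddCommGroup V] [InnerProductSpace ℝ V] [FiniteDimensional ℝ V]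
    [MeasurableSpace V] [BorelSpace V] : Measure V :=
  ((volume : Measure V).toSphere).map Subtype.val

section Sphere

variable {V : Type*} [NormedAddCommGroup V] [InnerProductSpace ℝ V] [FiniteDimensional ℝ V]
    [MeasurableSpace V] [BorelSpace V]

instance : IsFiniteMeasure (sphMeas V) := by
  unfold sphMeas; infer_instance

lemma ae_norm_eq_one_sphMeas : ∀ᵐ v ∂(sphMeas V), ‖v‖ = 1 := by
  unfold sphMeas
  rw [ae_map_iff measurable_subtype_coe.aemeasurable
    (measurableSet_eq_fun measurable_norm measurable_const)]
  exact .of_forall fun v => by simp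

open Pointwise in
lemma map_sphMeas (A : V ≃ₗᵢ[ℝ] V) : (sphMeas V).map A = sphMeas V := by
  ext s hs
  have hA : Measurable A := A.continuous.measurable
  rw [Measure.map_apply hA hs]
  unfold sphMeas
  rw [Measure.map_apply measurable_subtype_coe (hA hs), Measure.map_apply measurable_subtype_coe hs,
    Measure.toSphere_apply' _ (measurable_subtype_coe (hA hs)),
    Measure.toSphere_apply' _ (measurable_subtype_coe hs)]
  congr 1
  have hpre : ∀ T : Set V, volume (A.toMeasurableEquiv ⁻¹' T) = volume T := fun T =>
    A.measurePreserving.measure_preimage_equiv (f := A.toMeasurableEquiv) T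
  rw [← hpre (Ioo (0 : ℝ) 1 • (Subtype.val '' ((Subtype.val : Metric.sphere (0 : V) 1 → V) ⁻¹' s)))]
  congr 1
  ext x
  simp only [Subtype.image_preimage_coe, Set.mem_smul, Set.mem_preimage, Set.mem_inter_iff,
    LinearIsometryEquiv.toMeasurableEquiv]
  constructor
  · rintro ⟨r, hr, y, ⟨hy1, hy2⟩, rfl⟩
    refine ⟨r, hr, A y, ⟨?_, hy2⟩, ?_⟩
    · simpa using hy1
    · exact (A.map_smul r y).symm
  · rintro ⟨r, hr, y, ⟨hy1, hy2⟩, h⟩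
    refine ⟨r, hr, A.symm y, ⟨?_, ?_⟩, ?_⟩
    · simpa using hy1
    · simpa using hy2
    · apply A.injective
      rw [map_smul, A.apply_symm_apply]
      exact h

lemma lintegral_polar [Nontrivial V] {f : V → ℝ≥0∞} (hf : Measurable f) :
    ∫⁻ x, f x = ∫⁻ r in Ioi (0 : ℝ), ENNReal.ofReal (r ^ (Module.finrank ℝ V - 1)) *
      ∫⁻ v, f (r • v) ∂(sphMeas V) := by
  have mp := (volume : Measure V).measurePreserving_homeomorphUnitSphereProd
  have hg : Measurable (fun p : Metric.sphere (0 : V) 1 × Ioi (0 : ℝ) => f (p.2.1 • p.1.1)) :=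
    hf.comp (by fun_prop)
  calc ∫⁻ x, f x = ∫⁻ x in ({0}ᶜ : Set V), f x := by rw [restrict_compl_singleton]
    _ = ∫⁻ x : ({0}ᶜ : Set V), f x ∂(Measure.comap (Subtype.val : ({0}ᶜ : Set V) → V) volume) := by
        rw [lintegral_subtype_comap (measurableSet_singleton _).compl]
    _ = ∫⁻ x : ({0}ᶜ : Set V), (fun p : Metric.sphere (0 : V) 1 × Ioi (0 : ℝ) =>
          f (p.2.1 • p.1.1)) (homeomorphUnitSphereProd V x)
              ∂(Measure.comap (Subtype.val : ({0}ᶜ : Set V) → V) volume) := by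
        refine lintegral_congr fun x => ?_
        have : ‖(x : V)‖ ≠ 0 := norm_ne_zero_iff.2 x.2
        simp [smul_smul, this]
    _ = ∫⁻ p, f (p.2.1 • p.1.1) ∂((volume : Measure V).toSphere.prod
          (.volumeIoiPow (Module.finrank ℝ V - 1))) := mp.lintegral_comp hg
    _ = ∫⁻ r : Ioi (0 : ℝ), ∫⁻ v : Metric.sphere (0 : V) 1, f (r.1 • v.1)
          ∂(volume : Measure V).toSphere ∂(.volumeIoiPow (Module.finrank ℝ V - 1)) :=
        lintegral_prod_symm' _ hg
    _ = _ := by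
        have hm : Measurable (fun r : ℝ => ∫⁻ v, f (r • v) ∂(sphMeas V)) := by
          have : Measurable (fun p : ℝ × V => f (p.1 • p.2)) := hf.comp (by fun_prop)
          exact this.lintegral_prod_right'
        rw [Measure.volumeIoiPow, lintegral_withDensity_eq_lintegral_mul]
        · rw [← lintegral_subtype_comap measurableSet_Ioi]
          refine lintegral_congr fun r => ?_
          simp only [Pi.mul_apply, sphMeas]
          rw [lintegral_map (f := fun v => f (r.1 • v)) (hf.comp (measurable_const_smul _))
            measurable_subtype_coe]
        · fun_prop
        · exact hg.lintegral_prod_left'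

lemma integral_polar [Nontrivial V] {f : V → ℂ} (hf : Integrable f) (hfm : Measurable f) :
    ∫ x, f x = ∫ r in Ioi (0 : ℝ), ((r ^ (Module.finrank ℝ V - 1) : ℝ) : ℂ) *
      ∫ v, f (r • v) ∂(sphMeas V) := by
  have mp := (volume : Measure V).measurePreserving_homeomorphUnitSphereProd
  have e : ∀ x : ({0}ᶜ : Set V), f x = (fun p : Metric.sphere (0 : V) 1 × Ioi (0 : ℝ) =>
          f (p.2.1 • p.1.1)) (homeomorphUnitSphereProd V x) := fun x => by
    have : ‖(x : V)‖ ≠ 0 := norm_ne_zero_iff.2 x.2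
    simp [smul_smul, this]
  have hi : Integrable (fun p : Metric.sphere (0 : V) 1 × Ioi (0 : ℝ) => f (p.2.1 • p.1.1))
      ((volume : Measure V).toSphere.prod (.volumeIoiPow (Module.finrank ℝ V - 1))) := by
    rw [← mp.integrable_comp_emb (Homeomorph.measurableEmbedding _)]
    have h1 : IntegrableOn f ({0}ᶜ : Set V) := hf.integrableOn
    rw [integrableOn_iff_comap_subtypeVal (by measurability)] at h1
    exact h1.congr (.of_forall e)
  calc ∫ x, f x = ∫ x in ({0}ᶜ : Set V), f x := by rw [restrict_compl_singleton]
    _ = ∫ x : ({0}ᶜ : Set V), f x ∂(Measure.comap (Subtype.val : ({0}ᶜ : Set V) → V) volume) := by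
        rw [integral_subtype_comap (measurableSet_singleton _).compl]
    _ = ∫ x : ({0}ᶜ : Set V), (fun p : Metric.sphere (0 : V) 1 × Ioi (0 : ℝ) =>
          f (p.2.1 • p.1.1)) (homeomorphUnitSphereProd V x)
              ∂(Measure.comap (Subtype.val : ({0}ᶜ : Set V) → V) volume) := by
        exact integral_congr_ae (.of_forall e)
    _ = ∫ p, f (p.2.1 • p.1.1) ∂((volume : Measure V).toSphere.prod
          (.volumeIoiPow (Module.finrank ℝ V - 1))) :=
        mp.integral_comp (Homeomorph.measurableEmbedding _)
          (fun p : Metric.sphere (0 : V) 1 × Ioi (0 : ℝ) => f (p.2.1 • p.1.1))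
    _ = ∫ r : Ioi (0 : ℝ), ∫ v : Metric.sphere (0 : V) 1, f (r.1 • v.1)
          ∂(volume : Measure V).toSphere ∂(.volumeIoiPow (Module.finrank ℝ V - 1)) :=
        integral_prod_symm _ hi
    _ = _ := by
        simp only [Measure.volumeIoiPow, ENNReal.ofReal]
        rw [integral_withDensity_eq_integral_smul
          ((measurable_subtype_coe.pow_const _).real_toNNReal)]
        rw [← integral_subtype_comap measurableSet_Ioi]
        refine integral_congr_ae (.of_forall fun r => ?_)
        simp only [sphMeas]
        rw [integral_map (f := fun v => f (r.1 • v)) measurable_subtype_coe.aemeasurable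
          (hfm.comp (measurable_const_smul _)).aestronglyMeasurable, NNReal.smul_def,
          Real.coe_toNNReal _ (pow_nonneg (le_of_lt r.2) _), Complex.real_smul]

end Sphere

section Sphere

lemma gaussian_sphere_thicken {V : Type*} [NormedAddCommGroup V] [NormedSpace ℝ V]
    {R : ℝ} (hR : 1 ≤ R) {v v' : V}
    (hv' : ‖v'‖ = 1) {l : ℝ} (hl1 : 1 ≤ l) (hl2 : l ≤ 1 + 1 / R) (n : ℕ) :
    R ^ n * Real.exp (-(π * R ^ 2) * ‖v - v'‖ ^ 2) ≤
      Real.exp π * √2 ^ n * ((R / √2) ^ n *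
        Real.exp (-(π * (R / √2) ^ 2) * ‖v - l • v'‖ ^ 2)) := by
  have hR0 : 0 < R := by linarith
  have h2 : (0 : ℝ) < √2 := by positivity
  have e1 : Real.exp π * √2 ^ n * ((R / √2) ^ n *
        Real.exp (-(π * (R / √2) ^ 2) * ‖v - l • v'‖ ^ 2)) =
      R ^ n * Real.exp (π + -(π * (R / √2) ^ 2) * ‖v - l • v'‖ ^ 2) := by
    rw [Real.exp_add, div_pow]; field_simp
  rw [e1]
  gcongr
  have h3 : ‖v - l • v'‖ ≤ ‖v - v'‖ + 1 / R := by
    calc ‖v - l • v'‖ = ‖(v - v') - (l - 1) • v'‖ := by congr 1; module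
      _ ≤ ‖v - v'‖ + ‖(l - 1) • v'‖ := norm_sub_le _ _
      _ = ‖v - v'‖ + (l - 1) := by
        rw [norm_smul, hv', mul_one, Real.norm_of_nonneg (by linarith)]
      _ ≤ _ := by linarith
  have h4 : ‖v - l • v'‖ ^ 2 ≤ 2 * ‖v - v'‖ ^ 2 + 2 * (1 / R) ^ 2 := by
    have : ‖v - l • v'‖ ^ 2 ≤ (‖v - v'‖ + 1 / R) ^ 2 := by gcongr
    nlinarith [sq_nonneg (‖v - v'‖ - 1 / R)]
  have h5 : (R / √2) ^ 2 = R ^ 2 / 2 := by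
    rw [div_pow, Real.sq_sqrt (by norm_num)]
  rw [h5]
  have h6 : π * (R ^ 2 / 2) * ‖v - l • v'‖ ^ 2 ≤
      π * (R ^ 2 / 2) * (2 * ‖v - v'‖ ^ 2 + 2 * (1 / R) ^ 2) := by gcongr
  have h7 : π * (R ^ 2 / 2) * (2 * ‖v - v'‖ ^ 2 + 2 * (1 / R) ^ 2) =
      π * R ^ 2 * ‖v - v'‖ ^ 2 + π := by field_simp
  linarith

variable {V : Type*} [NormedAddCommGroup V] [InnerProductSpace ℝ V] [FiniteDimensional ℝ V]
    [MeasurableSpace V] [BorelSpace V]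

lemma lintegral_gaussian_sphMeas_le [Nontrivial V] {R : ℝ} (hR : 1 ≤ R) (v : V) :
    ∫⁻ v', ENNReal.ofReal (R ^ Module.finrank ℝ V * Real.exp (-(π * R ^ 2) * ‖v - v'‖ ^ 2))
      ∂(sphMeas V) ≤ ENNReal.ofReal (Real.exp π * √2 ^ Module.finrank ℝ V * R) := by
  have hR0 : 0 < R := by linarith
  set n := Module.finrank ℝ V with hn
  set I := ∫⁻ v', ENNReal.ofReal (R ^ n * Real.exp (-(π * R ^ 2) * ‖v - v'‖ ^ 2))
      ∂(sphMeas V) with hI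
  set c : ℝ := Real.exp π * √2 ^ n with hc
  have hc0 : 0 ≤ c := by positivity
  set f : V → ℝ≥0∞ := fun x => ENNReal.ofReal ((R / √2) ^ n *
        Real.exp (-(π * (R / √2) ^ 2) * ‖v - x‖ ^ 2)) with hf
  have hfm : Measurable f := (Continuous.measurable (by fun_prop)).ennreal_ofReal
  have hf1 : ∫⁻ x, f x = 1 := lintegral_gaussian_eq_one (by positivity) v
  have key : ∀ l ∈ Ioc 1 (1 + 1 / R), I ≤ ENNReal.ofReal c *
      (ENNReal.ofReal (l ^ (n - 1)) * ∫⁻ v', f (l • v') ∂(sphMeas V)) := by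
    intro l hl
    calc I ≤ ∫⁻ v', ENNReal.ofReal c * f (l • v') ∂(sphMeas V) := by
          refine lintegral_mono_ae (ae_norm_eq_one_sphMeas.mono fun v' hv' => ?_)
          simp only [hf]
          rw [← ENNReal.ofReal_mul hc0]
          exact ENNReal.ofReal_le_ofReal (gaussian_sphere_thicken hR hv' hl.1.le hl.2 n)
      _ = ENNReal.ofReal c * (1 * ∫⁻ v', f (l • v') ∂(sphMeas V)) := by
          rw [lintegral_const_mul' _ _ ENNReal.ofReal_ne_top, one_mul]
      _ ≤ _ := by
          gcongr
          rw [← ENNReal.ofReal_one]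
          exact ENNReal.ofReal_le_ofReal (one_le_pow₀ hl.1.le)
  have h1 : ENNReal.ofReal (1 / R) * I ≤ ENNReal.ofReal c := by
    calc ENNReal.ofReal (1 / R) * I = ∫⁻ _ in Ioc 1 (1 + 1 / R), I := by
          rw [setLIntegral_const, Real.volume_Ioc, add_sub_cancel_left, mul_comm]
      _ ≤ ∫⁻ l in Ioc 1 (1 + 1 / R), ENNReal.ofReal c *
          (ENNReal.ofReal (l ^ (n - 1)) * ∫⁻ v', f (l • v') ∂(sphMeas V)) :=
          setLIntegral_mono' measurableSet_Ioc key
      _ ≤ ∫⁻ l in Ioi (0 : ℝ), ENNReal.ofReal c *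
          (ENNReal.ofReal (l ^ (n - 1)) * ∫⁻ v', f (l • v') ∂(sphMeas V)) :=
          lintegral_mono_set fun l hl => lt_trans zero_lt_one hl.1
      _ = ENNReal.ofReal c * ∫⁻ x, f x := by
          rw [lintegral_const_mul' _ _ ENNReal.ofReal_ne_top, lintegral_polar hfm]
      _ = _ := by rw [hf1, mul_one]
  calc I = ENNReal.ofReal R * (ENNReal.ofReal (1 / R) * I) := by
        rw [← mul_assoc, ← ENNReal.ofReal_mul hR0.le, mul_one_div_cancel hR0.ne',
          ENNReal.ofReal_one, one_mul]
    _ ≤ ENNReal.ofReal R * ENNReal.ofReal c := by gcongr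
    _ = _ := by rw [← ENNReal.ofReal_mul hR0.le, mul_comm]

/-- The Agmon–Hörmander bound for the Fourier extension operator of the unit sphere. -/
lemma lintegral_expInt_sphMeas_sq_gaussian_le [Nontrivial V] {R : ℝ} (hR : 1 ≤ R) {a : V → ℂ}
    (ha : Integrable a (sphMeas V)) :
    ∫⁻ x, ‖expInt (sphMeas V) a x‖ₑ ^ 2 * ENNReal.ofReal (Real.exp (-(π / R ^ 2) * ‖x‖ ^ 2)) ≤
      2 * ENNReal.ofReal (Real.exp π * √2 ^ Module.finrank ℝ V * R) *
        ∫⁻ v, ‖a v‖ₑ ^ 2 ∂(sphMeas V) :=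
  lintegral_expInt_sq_gaussian_le_of_bound _ ha (by linarith)
    (.of_forall fun v => lintegral_gaussian_sphMeas_le hR v)

end Sphere

section Sphere

lemma exists_linearIsometryEquiv_apply_eq {V : Type*} [NormedAddCommGroup V]
    [InnerProductSpace ℝ V] {x y : V} (h : ‖x‖ = ‖y‖) :
    ∃ A : V ≃ₗᵢ[ℝ] V, A x = y :=
  ⟨_, Submodule.reflection_sub h⟩

variable {V : Type*} [NormedAddCommGroup V] [InnerProductSpace ℝ V] [FiniteDimensional ℝ V]
    [MeasurableSpace V] [BorelSpace V]

lemma lintegral_comp_norm [Nontrivial V] {f : ℝ → ℝ≥0∞} (hf : Measurable f) :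
    ∫⁻ x : V, f ‖x‖ = sphMeas V univ * ∫⁻ r in Ioi (0 : ℝ),
      ENNReal.ofReal (r ^ (Module.finrank ℝ V - 1)) * f r := by
  rw [lintegral_polar (f := fun x : V => f ‖x‖) (hf.comp measurable_norm),
      ← lintegral_const_mul' _ _ (measure_ne_top _ _)]
  refine setLIntegral_congr_fun measurableSet_Ioi fun r hr => ?_
  have : ∫⁻ v, f ‖r • v‖ ∂(sphMeas V) = ∫⁻ _, f r ∂(sphMeas V) := by
    refine lintegral_congr_ae (ae_norm_eq_one_sphMeas.mono fun v hv => ?_)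
    simp only [norm_smul, hv, mul_one, Real.norm_of_nonneg (le_of_lt hr)]
  rw [this, lintegral_const]
  ring

lemma sphMeas_univ_ne_zero [Nontrivial V] : sphMeas V univ ≠ 0 := by
  unfold sphMeas
  rw [Measure.map_apply measurable_subtype_coe MeasurableSet.univ, preimage_univ,
    Measure.toSphere_apply_univ]
  refine mul_ne_zero (by simpa using Module.finrank_pos.ne') ?_
  exact (Metric.measure_ball_pos volume _ one_pos).ne'

lemma expInt_sphMeas_map (A : V ≃ₗᵢ[ℝ] V) (a : V → ℂ) (x : V) :
    expInt (sphMeas V) a (A x) = expInt (sphMeas V) (a ∘ A) x := by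
  unfold expInt
  conv_lhs => rw [← map_sphMeas A]
  refine (A.toHomeomorph.measurableEmbedding.integral_map (μ := sphMeas V)
    (fun v => Complex.exp ((2 * π * inner ℝ v (A x) : ℝ) * Complex.I) * a v)).trans ?_
  simp

/-- The radial profile of the Fourier transform of the surface measure of the sphere. -/
def sphJ (e : V) (r : ℝ) : ℂ := expInt (sphMeas V) (fun _ => 1) (r • e)

/-- The derivative of `sphJ`. -/
def sphJ' (e : V) (r : ℝ) : ℂ :=
  expInt (sphMeas V) (fun v => 2 * π * inner ℝ v e * Complex.I) (r • e)

lemma expInt_sphMeas_one {e : V} (he : ‖e‖ = 1) (x : V) :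
    expInt (sphMeas V) (fun _ => 1) x = sphJ e ‖x‖ := by
  obtain ⟨A, hA⟩ := exists_linearIsometryEquiv_apply_eq (x := ‖x‖ • e) (y := x)
    (by simp [norm_smul, he])
  rw [← hA, expInt_sphMeas_map, hA]
  rfl

lemma sphJ'_eq {e w : V} (he : ‖e‖ = 1) (hw : ‖w‖ = 1) (r : ℝ) : sphJ' e r = sphJ' w r := by
  obtain ⟨A, hA⟩ := exists_linearIsometryEquiv_apply_eq (x := e) (y := w) (by rw [he, hw])
  unfold sphJ'
  rw [← hA, ← map_smul, expInt_sphMeas_map]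
  congr 1
  ext v
  simp

lemma integrable_inner_sphMeas (e : V) :
    Integrable (fun v => (2 * π * inner ℝ v e * Complex.I : ℂ)) (sphMeas V) := by
  refine Integrable.of_bound (C := 2 * π * ‖e‖) (by fun_prop)
    (ae_norm_eq_one_sphMeas.mono fun v hv => ?_)
  have := abs_real_inner_le_norm v e
  rw [hv, one_mul] at this
  simp only [norm_mul, Complex.norm_ofNat, Complex.norm_real, Complex.norm_I, mul_one,
    Real.norm_eq_abs, abs_of_pos pi_pos]
  gcongr

lemma norm_sphJ_le (e : V) (r : ℝ) : ‖sphJ e r‖ ≤ (sphMeas V).real univ := by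
  refine (norm_expInt_le _ _ _).trans (le_of_eq ?_)
  simp

lemma norm_sphJ'_le {e : V} (he : ‖e‖ = 1) (r : ℝ) :
    ‖sphJ' e r‖ ≤ 2 * π * (sphMeas V).real univ := by
  refine (norm_expInt_le _ _ _).trans ?_
  calc ∫ v, ‖(2 * π * inner ℝ v e * Complex.I : ℂ)‖ ∂(sphMeas V)
      ≤ ∫ _, 2 * π ∂(sphMeas V) := by
        refine integral_mono_ae (integrable_inner_sphMeas e).norm (integrable_const _)
          (ae_norm_eq_one_sphMeas.mono fun v hv => ?_)
        have := abs_real_inner_le_norm v e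
        rw [hv, he, one_mul] at this
        simp only [norm_mul, Complex.norm_ofNat, Complex.norm_real, Complex.norm_I, mul_one,
          Real.norm_eq_abs, abs_of_pos pi_pos]
        nlinarith [pi_pos]
    _ = _ := by simp [mul_comm]

lemma continuous_sphJ (e : V) : Continuous (sphJ e) :=
  (continuous_expInt (integrable_const _)).comp (by fun_prop)

lemma continuous_sphJ' (e : V) : Continuous (sphJ' e) :=
  (continuous_expInt (integrable_inner_sphMeas e)).comp (by fun_prop)

lemma hasDerivAt_sphJ (e : V) (r : ℝ) : HasDerivAt (sphJ e) (sphJ' e r) r := by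
  have key := hasDerivAt_integral_of_dominated_loc_of_deriv_le (μ := sphMeas V)
    (F := fun r v => Complex.exp ((2 * π * inner ℝ v (r • e) : ℝ) * Complex.I) * 1)
    (F' := fun r v => Complex.exp ((2 * π * inner ℝ v (r • e) : ℝ) * Complex.I) *
      (2 * π * inner ℝ v e * Complex.I)) (x₀ := r) (s := univ)
    (bound := fun v => ‖(2 * π * inner ℝ v e * Complex.I : ℂ)‖) Filter.univ_mem
    (.of_forall fun r => (integrable_char_mul (integrable_const 1) (r • e)).aestronglyMeasurable)
    (integrable_char_mul (integrable_const 1) (r • e))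
    (integrable_char_mul (integrable_inner_sphMeas e) (r • e)).aestronglyMeasurable
    (.of_forall fun v r _ => by rw [norm_mul, Complex.norm_exp_ofReal_mul_I, one_mul])
    (integrable_inner_sphMeas e).norm
    (.of_forall fun v r _ => by
      simp only [mul_one, inner_smul_right]
      have h : HasDerivAt (fun r : ℝ => (((2 * π * (r * inner ℝ v e) : ℝ) : ℂ) * Complex.I))
          (((2 * π * (1 * inner ℝ v e) : ℝ) : ℂ) * Complex.I) r :=
        ((((hasDerivAt_id r).mul_const _).const_mul _).ofReal_comp).mul_const _
      have h' := h.cexp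
      rw [one_mul, show (((2 * π * inner ℝ v e : ℝ) : ℂ) = 2 * π * inner ℝ v e) by push_cast; rfl]
        at h'
      exact h')
  exact key.2

lemma sphJ'_enorm_sq_le [Nontrivial V] {e : V} (he : ‖e‖ = 1) (x : V) :
    ‖sphJ' e ‖x‖‖ₑ ^ 2 ≤ Module.finrank ℝ V * ∑ i, ‖expInt (sphMeas V)
      (fun v => 2 * π * inner ℝ v (stdOrthonormalBasis ℝ V i) * Complex.I) x‖ₑ ^ 2 := by
  obtain ⟨w, hw, hx⟩ : ∃ w : V, ‖w‖ = 1 ∧ ‖x‖ • w = x := by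
    rcases eq_or_ne x 0 with h | h
    · exact ⟨e, he, by simp [h]⟩
    · have := norm_ne_zero_iff.2 h
      exact ⟨‖x‖⁻¹ • x, by simp [norm_smul, this], by simp [smul_smul, this]⟩
  set b := stdOrthonormalBasis ℝ V with hb
  set P := fun i => expInt (sphMeas V) (fun v => 2 * π * inner ℝ v (b i) * Complex.I) x with hP
  have h1 : sphJ' e ‖x‖ = ∑ i, (inner ℝ (b i) w : ℝ) * P i := by
    rw [sphJ'_eq he hw, sphJ', hx]
    simp only [hP, expInt, ← integral_const_mul]
    rw [← integral_finsetSum _ fun i _ =>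
      (integrable_char_mul (integrable_inner_sphMeas (b i)) x).const_mul _]
    congr 1
    ext v
    rw [show inner ℝ v w = ∑ i, inner ℝ v (b i) * inner ℝ (b i) w from
      (b.sum_inner_mul_inner v w).symm]
    push_cast
    rw [Finset.mul_sum, Finset.sum_mul, Finset.mul_sum]
    exact Finset.sum_congr rfl fun i _ => by ring
  have h2 : ‖sphJ' e ‖x‖‖ ≤ ∑ i, ‖P i‖ := by
    rw [h1]
    refine (norm_sum_le _ _).trans (Finset.sum_le_sum fun i _ => ?_)
    rw [norm_mul, Complex.norm_real]
    have := abs_real_inner_le_norm (b i) w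
    rw [hw, b.norm_eq_one i, one_mul] at this
    exact mul_le_of_le_one_left (norm_nonneg _) this
  have h3 : ‖sphJ' e ‖x‖‖ ^ 2 ≤ Module.finrank ℝ V * ∑ i, ‖P i‖ ^ 2 := by
    calc ‖sphJ' e ‖x‖‖ ^ 2 ≤ (∑ i, ‖P i‖) ^ 2 := by gcongr
      _ ≤ _ := by simpa using sq_sum_le_card_mul_sum_sq (s := Finset.univ) (f := fun i => ‖P i‖)
  have h4 := ENNReal.ofReal_le_ofReal h3
  rw [ENNReal.ofReal_mul (by positivity), ENNReal.ofReal_sum_of_nonneg (fun i _ => by positivity),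
    ENNReal.ofReal_natCast] at h4
  simpa only [ENNReal.ofReal_pow (norm_nonneg _), ofReal_norm] using h4

lemma lintegral_sphJ_sq_gaussian_le [Nontrivial V] {e : V} (he : ‖e‖ = 1) :
    ∃ C : ℝ, 0 ≤ C ∧ ∀ R : ℝ, 1 ≤ R →
      ∫⁻ r in Ioi (0 : ℝ), ENNReal.ofReal (r ^ (Module.finrank ℝ V - 1)) *
        (‖sphJ e r‖ₑ ^ 2 * ENNReal.ofReal (Real.exp (-(π / R ^ 2) * r ^ 2))) ≤
          ENNReal.ofReal (C * R) := by
  have hs0 : sphMeas V univ ≠ 0 := sphMeas_univ_ne_zero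
  have hs : sphMeas V univ ≠ ⊤ := measure_ne_top _ _
  refine ⟨2 * (Real.exp π * √2 ^ Module.finrank ℝ V), by positivity, fun R hR => ?_⟩
  have h := lintegral_expInt_sphMeas_sq_gaussian_le (V := V) hR (a := fun _ => 1)
    (integrable_const _)
  simp only [expInt_sphMeas_one he] at h
  rw [lintegral_comp_norm (V := V) (f := fun r => ‖sphJ e r‖ₑ ^ 2 *
    ENNReal.ofReal (Real.exp (-(π / R ^ 2) * r ^ 2)))] at h
  · have h' : sphMeas V univ * _ ≤ sphMeas V univ * ENNReal.ofReal
        (2 * (Real.exp π * √2 ^ Module.finrank ℝ V) * R) := h.trans (le_of_eq ?_)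
    · rwa [ENNReal.mul_le_mul_iff_right hs0 hs] at h'
    · simp only [enorm_one, one_pow, lintegral_const, one_mul]
      rw [mul_comm, mul_assoc 2, ENNReal.ofReal_mul (p := (2 : ℝ)) (by norm_num),
        ENNReal.ofReal_ofNat]
  · exact ((continuous_sphJ e).measurable.enorm.pow_const 2).mul
      (Continuous.measurable (by fun_prop)).ennreal_ofReal

lemma lintegral_sphJ'_sq_gaussian_le [Nontrivial V] {e : V} (he : ‖e‖ = 1) :
    ∃ C : ℝ, 0 ≤ C ∧ ∀ R : ℝ, 1 ≤ R →
      ∫⁻ r in Ioi (0 : ℝ), ENNReal.ofReal (r ^ (Module.finrank ℝ V - 1)) *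
        (‖sphJ' e r‖ₑ ^ 2 * ENNReal.ofReal (Real.exp (-(π / R ^ 2) * r ^ 2))) ≤
          ENNReal.ofReal (C * R) := by
  have hs0 : sphMeas V univ ≠ 0 := sphMeas_univ_ne_zero
  have hs : sphMeas V univ ≠ ⊤ := measure_ne_top _ _
  set n := Module.finrank ℝ V with hn
  set b := stdOrthonormalBasis ℝ V with hb
  refine ⟨n * (n * (2 * (Real.exp π * √2 ^ n) * (2 * π) ^ 2)), by positivity, fun R hR => ?_⟩
  have hR0 : 0 ≤ R := by linarith
  have h : ∫⁻ x : V, ‖sphJ' e ‖x‖‖ₑ ^ 2 * ENNReal.ofReal (Real.exp (-(π / R ^ 2) * ‖x‖ ^ 2)) ≤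
      sphMeas V univ *
        ENNReal.ofReal (n * (n * (2 * (Real.exp π * √2 ^ n) * (2 * π) ^ 2)) * R) := by
    set G : V → ℝ≥0∞ := fun x => ENNReal.ofReal (Real.exp (-(π / R ^ 2) * ‖x‖ ^ 2)) with hG
    have hGm : Measurable G := (Continuous.measurable (by fun_prop)).ennreal_ofReal
    calc ∫⁻ x : V, ‖sphJ' e ‖x‖‖ₑ ^ 2 * G x
        ≤ ∫⁻ x, n * ∑ i, ‖expInt (sphMeas V)
          (fun v => 2 * π * inner ℝ v (b i) * Complex.I) x‖ₑ ^ 2 * G x := by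
          refine lintegral_mono fun x => ?_
          rw [← Finset.sum_mul, ← mul_assoc]
          exact mul_le_mul_left (sphJ'_enorm_sq_le he x) _
      _ = n * ∑ i, ∫⁻ x, ‖expInt (sphMeas V)
          (fun v => 2 * π * inner ℝ v (b i) * Complex.I) x‖ₑ ^ 2 * G x := by
          rw [lintegral_const_mul' _ _ (by simp), lintegral_finsetSum]
          exact fun i _ => ((continuous_expInt (integrable_inner_sphMeas _)).measurable.enorm.pow_const
            2).mul hGm
      _ ≤ n * ∑ _i : Fin n, 2 * ENNReal.ofReal (Real.exp π * √2 ^ n * R) *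
          (ENNReal.ofReal ((2 * π) ^ 2) * sphMeas V univ) := by
          gcongr with i
          refine (lintegral_expInt_sphMeas_sq_gaussian_le hR (integrable_inner_sphMeas _)).trans ?_
          gcongr
          rw [← lintegral_const]
          refine lintegral_mono_ae (ae_norm_eq_one_sphMeas.mono fun v hv => ?_)
          have := abs_real_inner_le_norm v (b i)
          rw [hv, b.norm_eq_one i, one_mul] at this
          rw [← ofReal_norm, ← ENNReal.ofReal_pow (norm_nonneg _)]
          refine ENNReal.ofReal_le_ofReal ?_
          simp only [norm_mul, Complex.norm_ofNat, Complex.norm_real, Complex.norm_I, mul_one,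
            Real.norm_eq_abs, abs_of_pos pi_pos]
          exact pow_le_pow_left₀ (by positivity) (by nlinarith [pi_pos]) 2
      _ = _ := by
          rw [Finset.sum_const, Finset.card_univ, Fintype.card_fin, nsmul_eq_mul,
            show (n * (n * (2 * (Real.exp π * √2 ^ n) * (2 * π) ^ 2)) * R : ℝ) =
              n * (n * (2 * (Real.exp π * √2 ^ n * R) * (2 * π) ^ 2)) by ring,
            ENNReal.ofReal_mul (p := (n : ℝ)) (by positivity),
            ENNReal.ofReal_mul (p := (n : ℝ)) (by positivity),
            ENNReal.ofReal_mul (p := 2 * (Real.exp π * √2 ^ n * R)) (by positivity),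
            ENNReal.ofReal_mul (p := (2 : ℝ)) (by norm_num), ENNReal.ofReal_ofNat,
            ENNReal.ofReal_natCast]
          ring
  rw [lintegral_comp_norm (V := V) (f := fun r => ‖sphJ' e r‖ₑ ^ 2 *
    ENNReal.ofReal (Real.exp (-(π / R ^ 2) * r ^ 2)))] at h
  · rwa [ENNReal.mul_le_mul_iff_right hs0 hs] at h
  · exact ((continuous_sphJ' e).measurable.enorm.pow_const 2).mul
      (Continuous.measurable (by fun_prop)).ennreal_ofReal

end Sphere

lemma lintegral_exp_mul_comp_exp (g : ℝ → ℝ≥0∞) :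
    ∫⁻ s, ENNReal.ofReal (Real.exp s) * g (Real.exp s) = ∫⁻ r in Ioi (0 : ℝ), g r := by
  have h := lintegral_image_eq_lintegral_abs_deriv_mul (s := univ) MeasurableSet.univ
    (fun x _ => (Real.hasDerivAt_exp x).hasDerivWithinAt) Real.exp_injective.injOn g
  rw [image_univ, Real.range_exp] at h
  simpa [abs_of_pos (Real.exp_pos _)] using h.symm

/-- The Gaussian cut-offs of a dyadic decomposition of unity. -/
def dyCut (n : ℕ) (y : ℝ) : ℝ :=
  if n = 0 then Real.exp (-π * y ^ 2) else Real.exp (-π * y ^ 2) - Real.exp (-π * (2 * y) ^ 2)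

/-- The Euler derivative `y * deriv (dyCut n) y`. -/
def dyCut' (n : ℕ) (y : ℝ) : ℝ :=
  if n = 0 then -2 * π * y ^ 2 * Real.exp (-π * y ^ 2)
  else -2 * π * y ^ 2 * Real.exp (-π * y ^ 2) + 8 * π * y ^ 2 * Real.exp (-π * (2 * y) ^ 2)

@[fun_prop] lemma continuous_dyCut (n : ℕ) : Continuous (dyCut n) := by
  unfold dyCut; split_ifs <;> fun_prop

@[fun_prop] lemma continuous_dyCut' (n : ℕ) : Continuous (dyCut' n) := by
  unfold dyCut'; split_ifs <;> fun_prop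

lemma hasDerivAt_exp_neg_pi_mul_sq_mul_exp (a s : ℝ) :
    HasDerivAt (fun s => Real.exp (-π * (a * Real.exp s) ^ 2))
      (-2 * π * (a * Real.exp s) ^ 2 * Real.exp (-π * (a * Real.exp s) ^ 2)) s := by
  have h := ((((Real.hasDerivAt_exp s).const_mul a).pow 2).const_mul (-π)).exp
  refine HasDerivAt.congr_deriv h ?_
  simp only [Pi.pow_apply, Nat.cast_ofNat]
  ring

lemma hasDerivAt_dyCut (n : ℕ) (a s : ℝ) :
    HasDerivAt (fun s => dyCut n (a * Real.exp s)) (dyCut' n (a * Real.exp s)) s := by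
  unfold dyCut dyCut'
  split_ifs
  · exact hasDerivAt_exp_neg_pi_mul_sq_mul_exp a s
  · have h := (hasDerivAt_exp_neg_pi_mul_sq_mul_exp a s).sub
      (hasDerivAt_exp_neg_pi_mul_sq_mul_exp (2 * a) s)
    simp only [mul_assoc 2 a] at h
    refine HasDerivAt.congr_deriv h ?_
    ring

lemma sum_dyCut (N : ℕ) (r : ℝ) :
    ∑ n ∈ Finset.range (N + 1), dyCut n ((2 ^ n)⁻¹ * r) = Real.exp (-π * ((2 ^ N)⁻¹ * r) ^ 2) := by
  induction N with
  | zero => simp [dyCut]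
  | succ N ih =>
    rw [Finset.sum_range_succ, ih, dyCut, if_neg (Nat.succ_ne_zero N),
      show 2 * (((2 : ℝ) ^ (N + 1))⁻¹ * r) = (2 ^ N)⁻¹ * r by rw [pow_succ]; field_simp]
    ring

lemma mul_exp_neg_le_one (x : ℝ) : x * Real.exp (-x) ≤ 1 := by
  rw [Real.exp_neg, ← div_eq_mul_inv, div_le_one (Real.exp_pos _)]
  linarith [Real.add_one_le_exp x]

lemma exp_neg_pi_two_mul_sq (y : ℝ) :
    Real.exp (-π * (2 * y) ^ 2) = Real.exp (-π * y ^ 2) * Real.exp (-(3 * π * y ^ 2)) := by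
  rw [← Real.exp_add]; congr 1; ring

lemma dyCut_nonneg (n : ℕ) (y : ℝ) : 0 ≤ dyCut n y := by
  unfold dyCut
  split_ifs
  · positivity
  · rw [sub_nonneg, Real.exp_le_exp]
    nlinarith [pi_pos, mul_nonneg pi_pos.le (sq_nonneg y)]

lemma dyCut_le (n : ℕ) (y : ℝ) : dyCut n y ≤ Real.exp (-π * y ^ 2) := by
  unfold dyCut
  split_ifs
  · exact le_rfl
  · linarith [Real.exp_pos (-π * (2 * y) ^ 2)]

lemma exp_neg_pi_mul_sq_le_one (y : ℝ) : Real.exp (-π * y ^ 2) ≤ 1 := by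
  rw [Real.exp_le_one_iff]
  nlinarith [pi_pos, mul_nonneg pi_pos.le (sq_nonneg y)]

lemma dyCut_sq_le (n : ℕ) (y : ℝ) : dyCut n y ^ 2 ≤ Real.exp (-π * y ^ 2) := by
  have h1 := dyCut_nonneg n y
  have h2 := dyCut_le n y
  have h3 := exp_neg_pi_mul_sq_le_one y
  nlinarith

lemma dyCut_succ_sq_le (n : ℕ) (y : ℝ) :
    dyCut (n + 1) y ^ 2 ≤ 3 * π * (y ^ 2 * Real.exp (-π * y ^ 2)) := by
  have h1 := dyCut_nonneg (n + 1) y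
  have h2 := (dyCut_le (n + 1) y).trans (exp_neg_pi_mul_sq_le_one y)
  have h3 : dyCut (n + 1) y ≤ 3 * π * (y ^ 2 * Real.exp (-π * y ^ 2)) := by
    rw [dyCut, if_neg (Nat.succ_ne_zero n), exp_neg_pi_two_mul_sq]
    have h4 := Real.add_one_le_exp (-(3 * π * y ^ 2))
    nlinarith [Real.exp_pos (-π * y ^ 2)]
  nlinarith

lemma abs_dyCut'_le (n : ℕ) (y : ℝ) : |dyCut' n y| ≤ 10 * π * y ^ 2 * Real.exp (-π * y ^ 2) := by
  have hy := sq_nonneg y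
  have hE := Real.exp_pos (-π * y ^ 2)
  have hyE : 0 ≤ π * y ^ 2 * Real.exp (-π * y ^ 2) := by positivity
  unfold dyCut'
  split_ifs
  · rw [abs_le]; constructor <;> nlinarith
  · rw [exp_neg_pi_two_mul_sq]
    have h1 : Real.exp (-(3 * π * y ^ 2)) ≤ 1 := by
      rw [Real.exp_le_one_iff, neg_nonpos]; positivity
    have h2 := Real.exp_pos (-(3 * π * y ^ 2))
    have h3 := mul_le_mul_of_nonneg_left h1 hyE
    have h4 := mul_nonneg hyE h2.le
    rw [abs_le]; constructor <;> nlinarith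

lemma abs_dyCut'_le_ten (n : ℕ) (y : ℝ) : |dyCut' n y| ≤ 10 := by
  have h := mul_exp_neg_le_one (π * y ^ 2)
  have h2 := abs_dyCut'_le n y
  rw [← neg_mul] at h
  nlinarith

lemma dyCut'_sq_le (n : ℕ) (y : ℝ) :
    dyCut' n y ^ 2 ≤ 100 * π * (y ^ 2 * Real.exp (-π * y ^ 2)) := by
  have h1 := abs_dyCut'_le n y
  have h2 := abs_dyCut'_le_ten n y
  have h3 := abs_nonneg (dyCut' n y)
  rw [← sq_abs]
  nlinarith

lemma dyCut'_sq_le_exp (n : ℕ) (y : ℝ) :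
    dyCut' n y ^ 2 ≤ 400 * Real.exp (-π * y ^ 2) := by
  set x := π * y ^ 2 with hx
  have hx0 : 0 ≤ x := by positivity
  have h1 := abs_dyCut'_le n y
  rw [neg_mul, ← hx, mul_assoc 10, ← hx] at h1
  have h2 : dyCut' n y ^ 2 ≤ (10 * x * Real.exp (-x)) ^ 2 := by
    rw [← sq_abs]; gcongr
  rw [neg_mul, ← hx]
  have h3 : x / 2 * Real.exp (-(x / 2)) ≤ 1 := mul_exp_neg_le_one _
  have h4 : Real.exp (-x) = Real.exp (-(x / 2)) ^ 2 := by
    rw [← Real.exp_nat_mul]; congr 1; push_cast; ring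
  have h5 : (x / 2 * Real.exp (-(x / 2))) ^ 2 ≤ 1 := pow_le_one₀ (by positivity) h3
  calc _ ≤ (10 * x * Real.exp (-x)) ^ 2 := h2
    _ = 400 * ((x / 2 * Real.exp (-(x / 2))) ^ 2) * Real.exp (-x) := by rw [h4]; ring
    _ ≤ 400 * 1 * Real.exp (-x) := by gcongr
    _ = _ := by ring

/-- `J` has locally bounded averages of order `R` against the weight `r ^ (j + 2)`. -/
def DyBdd (j : ℕ) (C : ℝ) (J : ℝ → ℂ) : Prop :=
  ∀ R : ℝ, 1 ≤ R → ∫⁻ r in Ioi (0 : ℝ), ENNReal.ofReal (r ^ (j + 2)) *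
    (‖J r‖ₑ ^ 2 * ENNReal.ofReal (Real.exp (-(π / R ^ 2) * r ^ 2))) ≤ ENNReal.ofReal (C * R)

lemma enorm_sq_eq_ofReal (z : ℂ) : ‖z‖ₑ ^ 2 = ENNReal.ofReal (‖z‖ ^ 2) := by
  rw [ENNReal.ofReal_pow (norm_nonneg _), ofReal_norm]

lemma DyBdd.lintegral_sq_le {j : ℕ} {C : ℝ} {J : ℝ → ℂ} (hJ : DyBdd j C J) {f : ℝ → ℂ} {R K : ℝ}
    (hR : 1 ≤ R) (hK : 0 ≤ K)
    (h : ∀ s, ‖f s‖ ^ 2 ≤ Real.exp s * (K * (Real.exp s ^ (j + 2) *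
      (‖J (Real.exp s)‖ ^ 2 * Real.exp (-(π / R ^ 2) * Real.exp s ^ 2))))) :
    ∫⁻ s, ‖f s‖ₑ ^ 2 ≤ ENNReal.ofReal (K * (C * R)) := by
  calc ∫⁻ s, ‖f s‖ₑ ^ 2 ≤ ∫⁻ s, ENNReal.ofReal (Real.exp s) * (fun r => ENNReal.ofReal K *
        (ENNReal.ofReal (r ^ (j + 2)) * (‖J r‖ₑ ^ 2 *
          ENNReal.ofReal (Real.exp (-(π / R ^ 2) * r ^ 2))))) (Real.exp s) := by
        refine lintegral_mono fun s => ?_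
        simp only [enorm_sq_eq_ofReal]
        rw [← ENNReal.ofReal_mul (by positivity), ← ENNReal.ofReal_mul (by positivity),
          ← ENNReal.ofReal_mul (by positivity), ← ENNReal.ofReal_mul (by positivity)]
        exact ENNReal.ofReal_le_ofReal (h s)
    _ = ENNReal.ofReal K * ∫⁻ r in Ioi (0 : ℝ), (ENNReal.ofReal (r ^ (j + 2)) * (‖J r‖ₑ ^ 2 *
          ENNReal.ofReal (Real.exp (-(π / R ^ 2) * r ^ 2)))) := by
        rw [← lintegral_const_mul' _ _ ENNReal.ofReal_ne_top]
        exact lintegral_exp_mul_comp_exp (fun r => ENNReal.ofReal K *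
          (ENNReal.ofReal (r ^ (j + 2)) * (‖J r‖ₑ ^ 2 *
            ENNReal.ofReal (Real.exp (-(π / R ^ 2) * r ^ 2)))))
    _ ≤ ENNReal.ofReal K * ENNReal.ofReal (C * R) := by gcongr; exact hJ R hR
    _ = _ := by rw [← ENNReal.ofReal_mul hK]

lemma exists_lintegral_exp_pow_gaussian_le (j : ℕ) : ∃ C : ℝ, 0 ≤ C ∧ ∀ (f : ℝ → ℂ) (K : ℝ),
    0 ≤ K → (∀ s, ‖f s‖ ^ 2 ≤ Real.exp s * (K * (Real.exp s ^ j *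
      Real.exp (-π * Real.exp s ^ 2)))) → ∫⁻ s, ‖f s‖ₑ ^ 2 ≤ ENNReal.ofReal (K * C) := by
  have hi : Integrable (fun r : ℝ => r ^ j * Real.exp (-π * r ^ 2)) := by
    have := integrable_rpow_mul_exp_neg_mul_sq pi_pos (s := (j : ℝ))
      (lt_of_lt_of_le neg_one_lt_zero (Nat.cast_nonneg j))
    simpa only [Real.rpow_natCast] using this
  refine ⟨∫ r in Ioi (0 : ℝ), r ^ j * Real.exp (-π * r ^ 2),
    setIntegral_nonneg measurableSet_Ioi fun r hr => mul_nonneg (pow_nonneg (le_of_lt hr) _)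
      (Real.exp_pos _).le, fun f K hK h => ?_⟩
  calc ∫⁻ s, ‖f s‖ₑ ^ 2 ≤ ∫⁻ s, ENNReal.ofReal (Real.exp s) * (fun r => ENNReal.ofReal K *
        ENNReal.ofReal (r ^ j * Real.exp (-π * r ^ 2))) (Real.exp s) := by
        refine lintegral_mono fun s => ?_
        simp only [enorm_sq_eq_ofReal]
        rw [← ENNReal.ofReal_mul hK, ← ENNReal.ofReal_mul (by positivity)]
        exact ENNReal.ofReal_le_ofReal (h s)
    _ = ENNReal.ofReal K * ∫⁻ r in Ioi (0 : ℝ), ENNReal.ofReal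
          (r ^ j * Real.exp (-π * r ^ 2)) := by
        rw [← lintegral_const_mul' _ _ ENNReal.ofReal_ne_top]
        exact lintegral_exp_mul_comp_exp (fun r => ENNReal.ofReal K *
          ENNReal.ofReal (r ^ j * Real.exp (-π * r ^ 2)))
    _ = _ := by
        rw [ENNReal.ofReal_mul hK, ofReal_integral_eq_lintegral_ofReal hi.restrict]
        exact (ae_restrict_mem measurableSet_Ioi).mono fun r hr =>
          mul_nonneg (pow_nonneg (le_of_lt hr) _) (Real.exp_pos _).le

/-- The function `e^{(j+1)s/2} c(2^{-n} e^s) J(e^s)`. -/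
def expBlock (j n : ℕ) (c : ℝ → ℝ) (J : ℝ → ℂ) (s : ℝ) : ℂ :=
  (Real.exp (((j : ℝ) + 1) / 2 * s) * c ((2 ^ n)⁻¹ * Real.exp s) : ℝ) * J (Real.exp s)

lemma exp_half_mul_sq (j : ℕ) (s : ℝ) :
    Real.exp (((j : ℝ) + 1) / 2 * s) ^ 2 = Real.exp s ^ (j + 1) := by
  rw [← Real.exp_nat_mul, ← Real.exp_nat_mul]; congr 1; push_cast; ring

lemma norm_expBlock (j n : ℕ) (c : ℝ → ℝ) (J : ℝ → ℂ) (s : ℝ) :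
    ‖expBlock j n c J s‖ = Real.exp (((j : ℝ) + 1) / 2 * s) *
      |c ((2 ^ n)⁻¹ * Real.exp s)| * ‖J (Real.exp s)‖ := by
  rw [expBlock, norm_mul, Complex.norm_real, Real.norm_eq_abs, abs_mul, Real.abs_exp]

lemma norm_expBlock_sq (j n : ℕ) (c : ℝ → ℝ) (J : ℝ → ℂ) (s : ℝ) :
    ‖expBlock j n c J s‖ ^ 2 = Real.exp s ^ (j + 1) * c ((2 ^ n)⁻¹ * Real.exp s) ^ 2 *
      ‖J (Real.exp s)‖ ^ 2 := by
  rw [norm_expBlock, mul_pow, mul_pow, sq_abs, exp_half_mul_sq]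

lemma DyBdd.exists_lintegral_expBlock_le {j : ℕ} {C M : ℝ} {J : ℝ → ℂ} (hJ : DyBdd j C J)
    (hC : 0 ≤ C) (hM : ∀ r, ‖J r‖ ≤ M) {c : ℕ → ℝ → ℝ} {K : ℝ} (hK : 0 ≤ K)
    (h0 : ∀ y, c 0 y ^ 2 ≤ K * Real.exp (-π * y ^ 2))
    (h1 : ∀ n y, c (n + 1) y ^ 2 ≤ K * (y ^ 2 * Real.exp (-π * y ^ 2))) :
    ∃ B : ℝ, 0 ≤ B ∧ ∀ n, ∫⁻ s, ‖expBlock j n (c n) J s‖ₑ ^ 2 ≤ ENNReal.ofReal (B / 2 ^ n) := by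
  obtain ⟨C', hC', h'⟩ := exists_lintegral_exp_pow_gaussian_le j
  refine ⟨K * M ^ 2 * C' + K * C, by positivity, fun n => ?_⟩
  rcases n with _ | n
  · refine (h' _ (K * M ^ 2) (by positivity) fun s => ?_).trans
      (ENNReal.ofReal_le_ofReal ?_)
    · rw [norm_expBlock_sq]
      have h2 := h0 (Real.exp s)
      have h3 : ‖J (Real.exp s)‖ ^ 2 ≤ M ^ 2 := by gcongr; exact hM _
      simp only [pow_zero, inv_one, one_mul]
      calc _ ≤ Real.exp s ^ (j + 1) * (K * Real.exp (-π * Real.exp s ^ 2)) * M ^ 2 := by gcongr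
        _ = _ := by ring
    · rw [pow_zero, div_one]
      have : 0 ≤ K * C := by positivity
      linarith
  · refine (hJ.lintegral_sq_le (R := 2 ^ (n + 1)) (K := K / (2 ^ (n + 1)) ^ 2)
      (one_le_pow₀ one_le_two) (by positivity) fun s => ?_).trans (ENNReal.ofReal_le_ofReal ?_)
    · rw [norm_expBlock_sq]
      have h2 := h1 n ((2 ^ (n + 1))⁻¹ * Real.exp s)
      calc _ ≤ Real.exp s ^ (j + 1) * (K * (((2 ^ (n + 1))⁻¹ * Real.exp s) ^ 2 *
            Real.exp (-π * ((2 ^ (n + 1))⁻¹ * Real.exp s) ^ 2))) * ‖J (Real.exp s)‖ ^ 2 := by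
            gcongr
        _ = _ := by
          rw [show -π * ((2 ^ (n + 1))⁻¹ * Real.exp s) ^ 2 =
            -(π / (2 ^ (n + 1)) ^ 2) * Real.exp s ^ 2 by field_simp]
          field_simp
          ring
    · rw [show K / (2 ^ (n + 1)) ^ 2 * (C * 2 ^ (n + 1)) = K * C / 2 ^ (n + 1) by field_simp]
      gcongr
      have : 0 ≤ K * M ^ 2 * C' := by positivity
      linarith

lemma DyBdd.exists_lintegral_expBlock_le' {j : ℕ} {C : ℝ} {J : ℝ → ℂ} (hJ : DyBdd j C J)
    {c : ℕ → ℝ → ℝ} (h1 : ∀ n y, c n y ^ 2 ≤ Real.exp (-π * y ^ 2)) (n : ℕ) :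
    ∫⁻ s, ‖Real.exp s * expBlock j n (c n) J s‖ₑ ^ 2 ≤ ENNReal.ofReal (C * 2 ^ n) := by
  have := hJ.lintegral_sq_le (f := fun s => Real.exp s * expBlock j n (c n) J s) (R := 2 ^ n)
      (K := 1) (one_le_pow₀ one_le_two) zero_le_one fun s => ?_
  · rwa [one_mul] at this
  · rw [norm_mul, mul_pow, norm_expBlock_sq, Complex.norm_real, Real.norm_eq_abs, Real.abs_exp]
    have h2 := h1 n ((2 ^ n)⁻¹ * Real.exp s)
    calc _ ≤ Real.exp s ^ 2 * (Real.exp s ^ (j + 1) *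
            Real.exp (-π * ((2 ^ n)⁻¹ * Real.exp s) ^ 2) * ‖J (Real.exp s)‖ ^ 2) := by
            gcongr
      _ = _ := by
          rw [show -π * ((2 ^ n)⁻¹ * Real.exp s) ^ 2 =
            -(π / (2 ^ n) ^ 2) * Real.exp s ^ 2 by field_simp]
          ring

lemma enorm_add_sq_le (x y : ℂ) : ‖x + y‖ₑ ^ 2 ≤ 2 * ‖x‖ₑ ^ 2 + 2 * ‖y‖ₑ ^ 2 := by
  simp only [enorm_sq_eq_ofReal]
  rw [← ENNReal.ofReal_ofNat 2, ← ENNReal.ofReal_mul (by norm_num),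
    ← ENNReal.ofReal_mul (by norm_num), ← ENNReal.ofReal_add (by positivity) (by positivity)]
  refine ENNReal.ofReal_le_ofReal ?_
  have h1 : ‖x + y‖ ^ 2 ≤ (‖x‖ + ‖y‖) ^ 2 := by gcongr; exact norm_add_le _ _
  nlinarith [sq_nonneg (‖x‖ - ‖y‖)]

/-- A kernel on the line which splits into dyadic pieces of geometrically decaying `L²` norm and
geometrically growing derivative. -/
structure DyKernel (α : ℝ) (k : ℝ → ℂ) where
  /-- The dyadic pieces. -/
  piece : ℕ → ℝ → ℂ
  /-- The derivatives of the dyadic pieces. -/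
  piece' : ℕ → ℝ → ℂ
  /-- The common constant in all the bounds. -/
  bd : ℝ
  bd_nonneg : 0 ≤ bd
  hasDerivAt : ∀ n s, HasDerivAt (piece n) (piece' n s) s
  continuous' : ∀ n, Continuous (piece' n)
  norm_le : ∀ n s, ‖piece n s‖ ≤ bd * Real.exp (α * s)
  norm_le' : ∀ n s, ‖piece' n s‖ ≤ bd * (Real.exp (α * s) + Real.exp ((α + 1) * s))
  lintegral_le : ∀ n, ∫⁻ s, ‖piece n s‖ₑ ^ 2 ≤ ENNReal.ofReal (bd / 2 ^ n)
  lintegral_le' : ∀ n, ∫⁻ s, ‖piece' n s‖ₑ ^ 2 ≤ ENNReal.ofReal (bd * 2 ^ n)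
  norm_sum_le : ∀ N s, ‖∑ n ∈ Finset.range (N + 1), piece n s‖ ≤ bd * Real.exp (α * s)
  tendsto_sum : ∀ s, Filter.Tendsto (fun N : ℕ => ∑ n ∈ Finset.range (N + 1), piece n s)
    Filter.atTop (nhds (k s))

lemma exists_dyKernel {j : ℕ} {C M : ℝ} {J J' : ℝ → ℂ} (hC : 0 ≤ C) (hJ : DyBdd j C J)
    (hJ' : DyBdd j C J') (hM : ∀ r, ‖J r‖ ≤ M) (hM' : ∀ r, ‖J' r‖ ≤ M)
    (hd : ∀ r, HasDerivAt J (J' r) r) (hc : Continuous J') :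
    Nonempty (DyKernel (((j : ℝ) + 1) / 2)
      (fun s => Real.exp (((j : ℝ) + 1) / 2 * s) * J (Real.exp s))) := by
  set α : ℝ := ((j : ℝ) + 1) / 2 with hα
  have hα0 : 0 ≤ α := by positivity
  have hM0 : 0 ≤ M := (norm_nonneg _).trans (hM 0)
  have hJc : Continuous J := continuous_iff_continuousAt.2 fun r => (hd r).continuousAt
  obtain ⟨B1, hB1, h1⟩ := hJ.exists_lintegral_expBlock_le hC hM (c := dyCut) (K := 3 * π + 1)
    (by positivity)
    (fun y => (dyCut_sq_le 0 y).trans (le_mul_of_one_le_left (by positivity)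
      (by linarith [pi_pos])))
    (fun n y => (dyCut_succ_sq_le n y).trans (by gcongr; linarith))
  obtain ⟨B2, hB2, h2⟩ := hJ.exists_lintegral_expBlock_le hC hM
    (c := fun n y => α * dyCut n y + dyCut' n y)
    (K := 2 * α ^ 2 * (3 * π + 1) + 2 * (100 * π + 400)) (by positivity)
    (fun y => by
      have e1 := dyCut_sq_le 0 y
      have e2 := dyCut'_sq_le_exp 0 y
      have e3 : (α * dyCut 0 y + dyCut' 0 y) ^ 2 ≤
        2 * α ^ 2 * dyCut 0 y ^ 2 + 2 * dyCut' 0 y ^ 2 := by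
        nlinarith [sq_nonneg (α * dyCut 0 y - dyCut' 0 y)]
      have e4 : 2 * α ^ 2 * dyCut 0 y ^ 2 ≤ 2 * α ^ 2 * Real.exp (-π * y ^ 2) := by gcongr
      have e5 : 0 ≤ (2 * α ^ 2 * (3 * π) + 200 * π) * Real.exp (-π * y ^ 2) := by positivity
      nlinarith)
    (fun n y => by
      have e1 := dyCut_succ_sq_le n y
      have e2 := dyCut'_sq_le (n + 1) y
      have e3 : (α * dyCut (n + 1) y + dyCut' (n + 1) y) ^ 2 ≤
        2 * α ^ 2 * dyCut (n + 1) y ^ 2 + 2 * dyCut' (n + 1) y ^ 2 := by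
        nlinarith [sq_nonneg (α * dyCut (n + 1) y - dyCut' (n + 1) y)]
      have e4 : 2 * α ^ 2 * dyCut (n + 1) y ^ 2 ≤
        2 * α ^ 2 * (3 * π * (y ^ 2 * Real.exp (-π * y ^ 2))) := by gcongr
      have e5 : 0 ≤ (2 * α ^ 2 + 800) * (y ^ 2 * Real.exp (-π * y ^ 2)) := by positivity
      nlinarith)
  have h3 := fun n => hJ'.exists_lintegral_expBlock_le' (c := dyCut) dyCut_sq_le n
  have hcut : ∀ n y, |dyCut n y| ≤ 1 := fun n y => by
    rw [abs_of_nonneg (dyCut_nonneg n y)]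
    exact (dyCut_le n y).trans (exp_neg_pi_mul_sq_le_one y)
  have hsum : ∀ N s, ∑ n ∈ Finset.range (N + 1), expBlock j n (dyCut n) J s =
      (Real.exp (-π * ((2 ^ N)⁻¹ * Real.exp s) ^ 2) : ℝ) *
        (Real.exp (α * s) * J (Real.exp s)) := fun N s => by
    rw [← sum_dyCut]
    simp only [expBlock, ← hα]
    push_cast
    rw [Finset.sum_mul]
    exact Finset.sum_congr rfl fun n _ => by ring
  set bd := B1 + 2 * B2 + 2 * C + M * (α + 11) with hbd
  have hMa : 0 ≤ M * (α + 11) := by positivity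
  have hMbd : M ≤ bd := by nlinarith [mul_nonneg hM0 hα0]
  refine ⟨⟨fun n => expBlock j n (dyCut n) J,
    fun n s => expBlock j n (fun y => α * dyCut n y + dyCut' n y) J s +
      Real.exp s * expBlock j n (dyCut n) J' s, bd, by positivity, fun n s => ?_, fun n => ?_,
    fun n s => ?_, fun n s => ?_, fun n => ?_, fun n => ?_, fun N s => ?_, fun s => ?_⟩⟩
  · have e1 : HasDerivAt (fun s => Real.exp (α * s)) (Real.exp (α * s) * (α * 1)) s :=
      ((hasDerivAt_id s).const_mul α).exp
    have e2 := (e1.mul (hasDerivAt_dyCut n (2 ^ n)⁻¹ s)).ofReal_comp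
    have e3 := (hd (Real.exp s)).scomp s (Real.hasDerivAt_exp s)
    refine HasDerivAt.congr_deriv (e2.mul e3) ?_
    simp only [expBlock, ← hα, Complex.real_smul, Pi.mul_apply]
    push_cast
    ring
  · unfold expBlock
    fun_prop
  · rw [norm_expBlock, ← hα]
    have := hcut n ((2 ^ n)⁻¹ * Real.exp s)
    have h' := (hM (Real.exp s)).trans hMbd
    calc _ ≤ Real.exp (α * s) * 1 * bd := by gcongr
      _ = _ := by ring
  · have e1 := hcut n ((2 ^ n)⁻¹ * Real.exp s)
    have e2 : |α * dyCut n ((2 ^ n)⁻¹ * Real.exp s) + dyCut' n ((2 ^ n)⁻¹ * Real.exp s)| ≤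
        α + 10 := by
      refine (abs_add_le _ _).trans (add_le_add ?_ (abs_dyCut'_le_ten _ _))
      rw [abs_mul, abs_of_nonneg hα0]
      exact mul_le_of_le_one_right hα0 e1
    have e3 := hM (Real.exp s)
    have e4 := hM' (Real.exp s)
    refine (norm_add_le _ _).trans ?_
    rw [norm_mul, Complex.norm_real, Real.norm_eq_abs, Real.abs_exp, norm_expBlock, norm_expBlock,
      ← hα]
    have e5 : Real.exp ((α + 1) * s) = Real.exp s * Real.exp (α * s) := by
      rw [← Real.exp_add]; congr 1; ring
    rw [e5, mul_add]
    refine add_le_add ?_ ?_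
    · calc _ ≤ Real.exp (α * s) * (α + 10) * M := by gcongr
        _ = (M * (α + 10)) * Real.exp (α * s) := by ring
        _ ≤ _ := by gcongr; nlinarith
    · calc _ ≤ Real.exp s * (Real.exp (α * s) * 1 * M) := by gcongr
        _ = M * (Real.exp s * Real.exp (α * s)) := by ring
        _ ≤ _ := by gcongr
  · refine (h1 n).trans (ENNReal.ofReal_le_ofReal ?_)
    gcongr
    linarith
  · have hm : Measurable (expBlock j n (fun y => α * dyCut n y + dyCut' n y) J) := by
      unfold expBlock
      exact Continuous.measurable (by fun_prop)
    calc _ ≤ ∫⁻ s, (2 * ‖expBlock j n (fun y => α * dyCut n y + dyCut' n y) J s‖ₑ ^ 2 +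
          2 * ‖Real.exp s * expBlock j n (dyCut n) J' s‖ₑ ^ 2) :=
          lintegral_mono fun s => enorm_add_sq_le _ _
      _ ≤ 2 * ENNReal.ofReal (B2 / 2 ^ n) + 2 * ENNReal.ofReal (C * 2 ^ n) := by
          rw [lintegral_add_left ((hm.enorm.pow_const 2).const_mul 2),
            lintegral_const_mul' _ _ (by simp), lintegral_const_mul' _ _ (by simp)]
          gcongr
          · exact h2 n
          · exact h3 n
      _ ≤ _ := by
          rw [← ENNReal.ofReal_ofNat 2, ← ENNReal.ofReal_mul (by norm_num),
            ← ENNReal.ofReal_mul (by norm_num),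
            ← ENNReal.ofReal_add (by positivity) (by positivity)]
          refine ENNReal.ofReal_le_ofReal ?_
          have e1 : (1 : ℝ) ≤ 2 ^ n := one_le_pow₀ one_le_two
          have e2 : B2 / 2 ^ n ≤ B2 * 2 ^ n :=
            (div_le_self hB2 e1).trans (le_mul_of_one_le_right hB2 e1)
          calc 2 * (B2 / 2 ^ n) + 2 * (C * 2 ^ n) ≤ (2 * B2 + 2 * C) * 2 ^ n := by linarith
            _ ≤ _ := by gcongr; linarith
  · rw [hsum, norm_mul, norm_mul, Complex.norm_real, Complex.norm_real, Real.norm_eq_abs,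
      Real.norm_eq_abs, Real.abs_exp, Real.abs_exp]
    have e1 := exp_neg_pi_mul_sq_le_one ((2 ^ N)⁻¹ * Real.exp s)
    have e2 := (hM (Real.exp s)).trans hMbd
    calc _ ≤ 1 * (Real.exp (α * s) * bd) := by gcongr
      _ = _ := by ring
  · simp only [hsum]
    have e1 : Filter.Tendsto (fun N : ℕ => ((2 : ℝ) ^ N)⁻¹) Filter.atTop (nhds 0) := by
      exact tendsto_inv_atTop_zero.comp (tendsto_pow_atTop_atTop_of_one_lt one_lt_two)
    have e2 : Filter.Tendsto (fun N : ℕ => ((Real.exp (-π * ((2 ^ N)⁻¹ * Real.exp s) ^ 2) : ℝ) : ℂ))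
        Filter.atTop (nhds ((Real.exp (-π * (0 * Real.exp s) ^ 2) : ℝ) : ℂ)) := by
      have hcont : Continuous (fun y : ℝ => ((Real.exp (-π * (y * Real.exp s) ^ 2) : ℝ) : ℂ)) := by
        fun_prop
      exact (hcont.tendsto 0).comp e1
    simpa using e2.mul_const (Real.exp (α * s) * J (Real.exp s) : ℂ)

/-- A superposition of modulated translates of a function on the line. -/
def transInt (Φ f : ℝ → ℂ) (t s : ℝ) : ℂ :=
  expInt volume (fun ρ => Φ ρ * f (s + Real.log ρ)) t

lemma measurable_transInt {Φ f : ℝ → ℂ} (hΦ : Measurable Φ) (hf : Measurable f) :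
    Measurable (Function.uncurry (transInt Φ f)) := by
  unfold transInt expInt
  refine StronglyMeasurable.measurable ?_
  refine StronglyMeasurable.integral_prod_right (ν := (volume : Measure ℝ))
    (f := fun (p : ℝ × ℝ) ρ => Complex.exp ((2 * π * inner ℝ ρ p.1 : ℝ) * Complex.I) *
    (Φ ρ * f (p.2 + Real.log ρ))) ?_
  refine Measurable.stronglyMeasurable ?_
  refine Measurable.mul ?_ (Measurable.mul (hΦ.comp measurable_snd) (hf.comp (by fun_prop)))
  exact Continuous.measurable (by fun_prop)

lemma lintegral_transInt_sq_le {Φ f : ℝ → ℂ} (hΦ : Measurable Φ) (hf : Measurable f)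
    (hi : ∀ s, Integrable (fun ρ => Φ ρ * f (s + Real.log ρ))) :
    ∫⁻ t, ∫⁻ s, ‖transInt Φ f t s‖ₑ ^ 2 ≤ 2 * (∫⁻ s, ‖f s‖ₑ ^ 2) * ∫⁻ ρ, ‖Φ ρ‖ₑ ^ 2 := by
  rw [lintegral_lintegral_swap (((measurable_transInt hΦ hf).enorm.pow_const 2).aemeasurable)]
  calc ∫⁻ s, ∫⁻ t, ‖transInt Φ f t s‖ₑ ^ 2
      ≤ ∫⁻ s, 2 * ∫⁻ ρ, ‖Φ ρ * f (s + Real.log ρ)‖ₑ ^ 2 :=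
        lintegral_mono fun s => lintegral_expInt_sq_le (hi s)
    _ = 2 * ∫⁻ ρ, ∫⁻ s, ‖Φ ρ * f (s + Real.log ρ)‖ₑ ^ 2 := by
        rw [lintegral_const_mul' _ _ (by simp), lintegral_lintegral_swap]
        refine Measurable.aemeasurable (Measurable.pow_const (Measurable.enorm ?_) 2)
        exact Measurable.mul (hΦ.comp measurable_snd) (hf.comp (by fun_prop))
    _ = 2 * ∫⁻ ρ, ‖Φ ρ‖ₑ ^ 2 * ∫⁻ s, ‖f s‖ₑ ^ 2 := by
        congr 1
        refine lintegral_congr fun ρ => ?_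
        simp only [enorm_mul, mul_pow]
        rw [lintegral_const_mul' _ _ (by simp),
          lintegral_add_right_eq_self (fun s => ‖f s‖ₑ ^ 2) (Real.log ρ)]
    _ = _ := by
        rw [lintegral_mul_const _ (hΦ.enorm.pow_const 2)]
        ring

lemma exp_mul_add_log {ρ : ℝ} (hρ : ρ ≠ 0) (a s : ℝ) :
    Real.exp (a * (s + Real.log ρ)) = Real.exp (a * s) * |ρ| ^ a := by
  rw [mul_add, Real.exp_add, Real.rpow_def_of_pos (abs_pos.2 hρ), Real.log_abs, mul_comm a (log ρ)]

lemma integrable_transInt {Φ f : ℝ → ℂ} (hΦ : Measurable Φ) (hf : Measurable f) {α b : ℝ}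
    (h0 : Integrable (fun ρ => ‖Φ ρ‖ * |ρ| ^ α))
    (h1 : Integrable (fun ρ => ‖Φ ρ‖ * |ρ| ^ (α + 1)))
    (hb : ∀ s, ‖f s‖ ≤ b * (Real.exp (α * s) + Real.exp ((α + 1) * s))) (s : ℝ) :
    Integrable (fun ρ => Φ ρ * f (s + Real.log ρ)) := by
  refine Integrable.mono' ((h0.const_mul (b * Real.exp (α * s))).add
    (h1.const_mul (b * Real.exp ((α + 1) * s)))) ?_ ?_
  · exact (hΦ.mul (hf.comp (by fun_prop))).aestronglyMeasurable
  · filter_upwards [compl_mem_ae_iff.2 (measure_singleton (0 : ℝ))] with ρ hρ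
    have := hb (s + Real.log ρ)
    rw [exp_mul_add_log hρ, exp_mul_add_log hρ] at this
    rw [norm_mul]
    calc _ ≤ ‖Φ ρ‖ * (b * (Real.exp (α * s) * |ρ| ^ α +
          Real.exp ((α + 1) * s) * |ρ| ^ (α + 1))) := by gcongr
      _ = _ := by simp only [Pi.add_apply]; ring

lemma hasDerivAt_transInt {Φ f f' : ℝ → ℂ} (hΦ : Measurable Φ) {α b : ℝ} (hα : 0 ≤ α)
    (h0 : Integrable (fun ρ => ‖Φ ρ‖ * |ρ| ^ α))
    (h1 : Integrable (fun ρ => ‖Φ ρ‖ * |ρ| ^ (α + 1)))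
    (hd : ∀ s, HasDerivAt f (f' s) s) (hf' : Continuous f')
    (hb : ∀ s, ‖f s‖ ≤ b * (Real.exp (α * s) + Real.exp ((α + 1) * s)))
    (hb' : ∀ s, ‖f' s‖ ≤ b * (Real.exp (α * s) + Real.exp ((α + 1) * s))) (t s : ℝ) :
    HasDerivAt (transInt Φ f t) (transInt Φ f' t s) s := by
  have hf : Continuous f := continuous_iff_continuousAt.2 fun s => (hd s).continuousAt
  have hb0 : 0 ≤ b := by
    have := (norm_nonneg _).trans (hb 0)
    exact nonneg_of_mul_nonneg_left this (by positivity)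
  have hi := integrable_transInt hΦ hf.measurable h0 h1 hb
  have hi' := integrable_transInt hΦ hf'.measurable h0 h1 hb'
  exact (hasDerivAt_integral_of_dominated_loc_of_deriv_le (μ := volume)
    (F := fun s ρ => Complex.exp ((2 * π * inner ℝ ρ t : ℝ) * Complex.I) *
      (Φ ρ * f (s + Real.log ρ)))
    (F' := fun s ρ => Complex.exp ((2 * π * inner ℝ ρ t : ℝ) * Complex.I) *
      (Φ ρ * f' (s + Real.log ρ))) (x₀ := s) (s := Iio (s + 1))
    (bound := fun ρ => b * Real.exp (α * (s + 1)) * (‖Φ ρ‖ * |ρ| ^ α) +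
      b * Real.exp ((α + 1) * (s + 1)) * (‖Φ ρ‖ * |ρ| ^ (α + 1)))
    (Iio_mem_nhds (by linarith))
    (.of_forall fun r => (integrable_char_mul (hi r) t).aestronglyMeasurable)
    (integrable_char_mul (hi s) t) (integrable_char_mul (hi' s) t).aestronglyMeasurable
    (by
      filter_upwards [compl_mem_ae_iff.2 (measure_singleton (0 : ℝ))] with ρ hρ r hr
      have hr' : r ≤ s + 1 := le_of_lt hr
      have := hb' (r + Real.log ρ)
      rw [exp_mul_add_log hρ, exp_mul_add_log hρ] at this
      rw [norm_mul, Complex.norm_exp_ofReal_mul_I, one_mul, norm_mul]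
      calc _ ≤ ‖Φ ρ‖ * (b * (Real.exp (α * r) * |ρ| ^ α +
            Real.exp ((α + 1) * r) * |ρ| ^ (α + 1))) := by gcongr
        _ = b * Real.exp (α * r) * (‖Φ ρ‖ * |ρ| ^ α) +
          b * Real.exp ((α + 1) * r) * (‖Φ ρ‖ * |ρ| ^ (α + 1)) := by ring
        _ ≤ _ := by gcongr)
    ((h0.const_mul _).add (h1.const_mul _))
    (.of_forall fun ρ r _ => (((hd (r + Real.log ρ)).comp_add_const r
      (Real.log ρ)).const_mul (Φ ρ)).const_mul _)).2

/-- A scaled one-dimensional Sobolev inequality. -/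
lemma enorm_sq_le_of_hasDerivAt {h h' : ℝ → ℂ} (hd : ∀ s, HasDerivAt h (h' s) s)
    (hc : Continuous h') {δ : ℝ} (hδ : 0 < δ) (s : ℝ) :
    ‖h s‖ₑ ^ 2 ≤ 2 * (ENNReal.ofReal δ⁻¹ * (∫⁻ r, ‖h r‖ₑ ^ 2) +
      ENNReal.ofReal δ * ∫⁻ r, ‖h' r‖ₑ ^ 2) := by
  have hh : Continuous h := continuous_iff_continuousAt.2 fun s => (hd s).continuousAt
  set N := ∫⁻ r, ‖h r‖ₑ ^ 2 with hN
  set N' := ∫⁻ r, ‖h' r‖ₑ ^ 2 with hN'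
  have hpt : ∀ r ∈ Ioc s (s + δ), ‖h s‖ₑ ^ 2 ≤ ‖h r‖ₑ ^ 2 + (ENNReal.ofReal δ⁻¹ * N +
      ENNReal.ofReal δ * N') := by
    intro r hr
    have hFTC : ∫ y in s..r, (2 * inner ℝ (h y) (h' y) : ℝ) = ‖h r‖ ^ 2 - ‖h s‖ ^ 2 :=
      intervalIntegral.integral_eq_sub_of_hasDerivAt (fun y _ => (hd y).norm_sq)
        (Continuous.intervalIntegrable (by fun_prop) _ _)
    have h1 : ‖h s‖ ^ 2 ≤ ‖h r‖ ^ 2 + ∫ y in s..r, (δ⁻¹ * ‖h y‖ ^ 2 + δ * ‖h' y‖ ^ 2) := by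
      have : ∫ y in s..r, -(2 * inner ℝ (h y) (h' y) : ℝ) ≤
          ∫ y in s..r, (δ⁻¹ * ‖h y‖ ^ 2 + δ * ‖h' y‖ ^ 2) := by
        refine intervalIntegral.integral_mono_on hr.1.le
          (Continuous.intervalIntegrable (by fun_prop) _ _)
          (Continuous.intervalIntegrable (by fun_prop) _ _) fun y _ => ?_
        have e1 := abs_le.1 (abs_real_inner_le_norm (h y) (h' y))
        have e2 : δ⁻¹ * ‖h y‖ ^ 2 + δ * ‖h' y‖ ^ 2 - 2 * (‖h y‖ * ‖h' y‖) =
            δ⁻¹ * (‖h y‖ - δ * ‖h' y‖) ^ 2 := by field_simp; ring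
        have e3 : 0 ≤ δ⁻¹ * (‖h y‖ - δ * ‖h' y‖) ^ 2 := by positivity
        linarith [e1.1]
      rw [intervalIntegral.integral_neg, hFTC] at this
      linarith
    have h2 : ENNReal.ofReal (∫ y in s..r, (δ⁻¹ * ‖h y‖ ^ 2 + δ * ‖h' y‖ ^ 2)) ≤
        ENNReal.ofReal δ⁻¹ * N + ENNReal.ofReal δ * N' := by
      rw [intervalIntegral.integral_of_le hr.1.le, ofReal_integral_eq_lintegral_ofReal
        (Continuous.integrableOn_Ioc (by fun_prop)) (.of_forall fun y => by positivity)]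
      calc _ ≤ ∫⁻ y, ENNReal.ofReal (δ⁻¹ * ‖h y‖ ^ 2 + δ * ‖h' y‖ ^ 2) :=
            setLIntegral_le_lintegral _ _
        _ = ∫⁻ y, (ENNReal.ofReal δ⁻¹ * ‖h y‖ₑ ^ 2 + ENNReal.ofReal δ * ‖h' y‖ₑ ^ 2) := by
            refine lintegral_congr fun y => ?_
            rw [ENNReal.ofReal_add (by positivity) (by positivity),
              ENNReal.ofReal_mul (by positivity), ENNReal.ofReal_mul (by positivity),
              enorm_sq_eq_ofReal, enorm_sq_eq_ofReal]
        _ = _ := by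
            rw [lintegral_add_left ((hh.measurable.enorm.pow_const 2).const_mul _),
              lintegral_const_mul' _ _ ENNReal.ofReal_ne_top,
              lintegral_const_mul' _ _ ENNReal.ofReal_ne_top]
    calc ‖h s‖ₑ ^ 2 ≤ ‖h r‖ₑ ^ 2 +
          ENNReal.ofReal (∫ y in s..r, (δ⁻¹ * ‖h y‖ ^ 2 + δ * ‖h' y‖ ^ 2)) := by
          rw [enorm_sq_eq_ofReal, enorm_sq_eq_ofReal]
          exact (ENNReal.ofReal_le_ofReal h1).trans ENNReal.ofReal_add_le
      _ ≤ _ := by gcongr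
  have hav : ‖h s‖ₑ ^ 2 * ENNReal.ofReal δ ≤
      N + (ENNReal.ofReal δ⁻¹ * N + ENNReal.ofReal δ * N') * ENNReal.ofReal δ := by
    calc ‖h s‖ₑ ^ 2 * ENNReal.ofReal δ = ∫⁻ _ in Ioc s (s + δ), ‖h s‖ₑ ^ 2 := by
          rw [setLIntegral_const, Real.volume_Ioc, add_sub_cancel_left]
      _ ≤ ∫⁻ r in Ioc s (s + δ), (‖h r‖ₑ ^ 2 + (ENNReal.ofReal δ⁻¹ * N +
          ENNReal.ofReal δ * N')) := setLIntegral_mono' measurableSet_Ioc hpt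
      _ = (∫⁻ r in Ioc s (s + δ), ‖h r‖ₑ ^ 2) + (ENNReal.ofReal δ⁻¹ * N +
          ENNReal.ofReal δ * N') * ENNReal.ofReal δ := by
          rw [lintegral_add_left (hh.measurable.enorm.pow_const 2), setLIntegral_const,
            Real.volume_Ioc, add_sub_cancel_left]
      _ ≤ _ := by gcongr; exact setLIntegral_le_lintegral _ _
  have hδδ : ENNReal.ofReal δ * ENNReal.ofReal δ⁻¹ = 1 := by
    rw [← ENNReal.ofReal_mul hδ.le, mul_inv_cancel₀ hδ.ne', ENNReal.ofReal_one]
  calc ‖h s‖ₑ ^ 2 = ‖h s‖ₑ ^ 2 * ENNReal.ofReal δ * ENNReal.ofReal δ⁻¹ := by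
        rw [mul_assoc, hδδ, mul_one]
    _ ≤ (N + (ENNReal.ofReal δ⁻¹ * N + ENNReal.ofReal δ * N') * ENNReal.ofReal δ) *
        ENNReal.ofReal δ⁻¹ := by gcongr
    _ = ENNReal.ofReal δ⁻¹ * N + (ENNReal.ofReal δ⁻¹ * N + ENNReal.ofReal δ * N') := by
        rw [add_mul, mul_assoc _ (ENNReal.ofReal δ), hδδ, mul_one, mul_comm N]
    _ ≤ (ENNReal.ofReal δ⁻¹ * N + ENNReal.ofReal δ * N') +
        (ENNReal.ofReal δ⁻¹ * N + ENNReal.ofReal δ * N') := by gcongr; exact le_self_add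
    _ = _ := (two_mul _).symm

/-- Interpolation between `L²` and the one-dimensional Sobolev inequality. -/
lemma eLpNorm_sq_le_of_hasDerivAt {h h' : ℝ → ℂ} (hd : ∀ s, HasDerivAt h (h' s) s)
    (hc : Continuous h') {δ : ℝ} (hδ : 0 < δ) {q : ℝ} (hq : 2 < q) :
    eLpNorm h (ENNReal.ofReal q) volume ^ 2 ≤ 2 * ENNReal.ofReal δ ^ (2 / q) *
      (ENNReal.ofReal δ⁻¹ * (∫⁻ r, ‖h r‖ₑ ^ 2) + ENNReal.ofReal δ * ∫⁻ r, ‖h' r‖ₑ ^ 2) := by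
  have hq0 : 0 < q := by linarith
  set B := ENNReal.ofReal δ⁻¹ * (∫⁻ r, ‖h r‖ₑ ^ 2) + ENNReal.ofReal δ * ∫⁻ r, ‖h' r‖ₑ ^ 2 with hB
  have hsup : ∀ s, ‖h s‖ₑ ^ 2 ≤ 2 * B := enorm_sq_le_of_hasDerivAt hd hc hδ
  have hh : Continuous h := continuous_iff_continuousAt.2 fun s => (hd s).continuousAt
  have hN : ∫⁻ r, ‖h r‖ₑ ^ 2 ≤ ENNReal.ofReal δ * B := by
    calc ∫⁻ r, ‖h r‖ₑ ^ 2 = ENNReal.ofReal δ * (ENNReal.ofReal δ⁻¹ * ∫⁻ r, ‖h r‖ₑ ^ 2) := by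
          rw [← mul_assoc, ← ENNReal.ofReal_mul hδ.le, mul_inv_cancel₀ hδ.ne', ENNReal.ofReal_one,
            one_mul]
      _ ≤ _ := by gcongr; exact le_self_add
  have hI : ∫⁻ s, ‖h s‖ₑ ^ q ≤ (2 * B) ^ ((q - 2) / 2) * (ENNReal.ofReal δ * B) := by
    calc ∫⁻ s, ‖h s‖ₑ ^ q ≤ ∫⁻ s, (2 * B) ^ ((q - 2) / 2) * ‖h s‖ₑ ^ 2 := by
          refine lintegral_mono fun s => ?_
          calc ‖h s‖ₑ ^ q = (‖h s‖ₑ ^ 2) ^ ((q - 2) / 2) * ‖h s‖ₑ ^ 2 := by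
                rw [← ENNReal.rpow_ofNat, ← ENNReal.rpow_mul,
                  ← ENNReal.rpow_add_of_nonneg _ _ (by linarith) (by norm_num)]
                congr 1; ring
            _ ≤ _ := by
                gcongr
                exact hsup s
      _ = (2 * B) ^ ((q - 2) / 2) * ∫⁻ s, ‖h s‖ₑ ^ 2 :=
          lintegral_const_mul _ (hh.measurable.enorm.pow_const 2)
      _ ≤ _ := by gcongr
  rw [eLpNorm_eq_lintegral_rpow_enorm_toReal (by simpa using hq0) ENNReal.ofReal_ne_top,
    ENNReal.toReal_ofReal hq0.le, ← ENNReal.rpow_ofNat, ← ENNReal.rpow_mul]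
  have e : 1 / q * OfNat.ofNat 2 = 2 / q := by ring
  rw [e]
  have hq2 : 0 ≤ 2 / q := by positivity
  calc (∫⁻ s, ‖h s‖ₑ ^ q) ^ (2 / q)
      ≤ ((2 * B) ^ ((q - 2) / 2) * (ENNReal.ofReal δ * B)) ^ (2 / q) := by gcongr
    _ = (2 * B) ^ ((q - 2) / q) * (ENNReal.ofReal δ ^ (2 / q) * B ^ (2 / q)) := by
        rw [ENNReal.mul_rpow_of_nonneg _ _ hq2, ENNReal.mul_rpow_of_nonneg _ _ hq2,
          ← ENNReal.rpow_mul]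
        congr 2
        field_simp
    _ ≤ (2 * B) ^ ((q - 2) / q) * (ENNReal.ofReal δ ^ (2 / q) * (2 * B) ^ (2 / q)) := by
        gcongr
        exact le_mul_of_one_le_left (zero_le) (by norm_num)
    _ = ENNReal.ofReal δ ^ (2 / q) * ((2 * B) ^ ((q - 2) / q) * (2 * B) ^ (2 / q)) := by ring
    _ = _ := by
        rw [← ENNReal.rpow_add_of_nonneg _ _ (div_nonneg (by linarith) hq0.le) hq2,
          show (q - 2) / q + 2 / q = 1 by field_simp; ring, ENNReal.rpow_one]
        ring

lemma ENNReal.sum_sq_le_mul_sum_inv {ι : Type*} (s : Finset ι) (f w : ι → ℝ≥0∞)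
    (hw : ∀ i, w i ≠ 0) (hw' : ∀ i, w i ≠ ∞) :
    (∑ i ∈ s, f i) ^ 2 ≤ (∑ i ∈ s, w i) * ∑ i ∈ s, (w i)⁻¹ * f i ^ 2 := by
  have h := ENNReal.inner_le_Lp_mul_Lq s (fun i => w i ^ (1 / 2 : ℝ))
    (fun i => (w i)⁻¹ ^ (1 / 2 : ℝ) * f i) Real.HolderConjugate.two_two
  have e1 : ∀ i, w i ^ (1 / 2 : ℝ) * ((w i)⁻¹ ^ (1 / 2 : ℝ) * f i) = f i := fun i => by
    rw [← mul_assoc, ← ENNReal.mul_rpow_of_nonneg _ _ (by norm_num),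
      ENNReal.mul_inv_cancel (hw i) (hw' i), ENNReal.one_rpow, one_mul]
  have e2 : ∀ i, (w i ^ (1 / 2 : ℝ)) ^ (2 : ℝ) = w i := fun i => by
    rw [← ENNReal.rpow_mul]; norm_num
  have e3 : ∀ i, ((w i)⁻¹ ^ (1 / 2 : ℝ) * f i) ^ (2 : ℝ) = (w i)⁻¹ * f i ^ 2 := fun i => by
    rw [ENNReal.mul_rpow_of_nonneg _ _ (by norm_num), ← ENNReal.rpow_mul]; norm_num
  simp only [e1, e2, e3] at h
  calc (∑ i ∈ s, f i) ^ 2 ≤ ((∑ i ∈ s, w i) ^ (1 / 2 : ℝ) *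
        (∑ i ∈ s, (w i)⁻¹ * f i ^ 2) ^ (1 / 2 : ℝ)) ^ 2 := by gcongr
    _ = _ := by
      rw [← ENNReal.mul_rpow_of_nonneg _ _ (by norm_num), ← ENNReal.rpow_ofNat,
        ← ENNReal.rpow_mul]
      norm_num

lemma measurable_eLpNorm_transInt {Φ f : ℝ → ℂ} (hΦ : Measurable Φ) (hf : Measurable f) {q : ℝ}
    (hq : 0 < q) : Measurable fun t => eLpNorm (transInt Φ f t) (ENNReal.ofReal q) volume := by
  simp only [eLpNorm_eq_lintegral_rpow_enorm_toReal (p := ENNReal.ofReal q) (by simpa using hq)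
    ENNReal.ofReal_ne_top]
  exact (Measurable.lintegral_prod_right'
    ((measurable_transInt hΦ hf).enorm.pow_const _)).pow_const _

lemma continuous_transInt {Φ f : ℝ → ℂ} (hΦ : Measurable Φ) {α b : ℝ} (hα : 0 ≤ α)
    (h0 : Integrable (fun ρ => ‖Φ ρ‖ * |ρ| ^ α))
    (h1 : Integrable (fun ρ => ‖Φ ρ‖ * |ρ| ^ (α + 1))) (hf : Continuous f)
    (hb : ∀ s, ‖f s‖ ≤ b * (Real.exp (α * s) + Real.exp ((α + 1) * s))) (t : ℝ) :
    Continuous (transInt Φ f t) := by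
  have hb0 : 0 ≤ b := by
    have := (norm_nonneg _).trans (hb 0)
    exact nonneg_of_mul_nonneg_left this (by positivity)
  have hi := integrable_transInt hΦ hf.measurable h0 h1 hb
  refine continuous_iff_continuousAt.2 fun s => continuousAt_of_dominated
    (bound := fun ρ => b * Real.exp (α * (s + 1)) * (‖Φ ρ‖ * |ρ| ^ α) +
      b * Real.exp ((α + 1) * (s + 1)) * (‖Φ ρ‖ * |ρ| ^ (α + 1)))
    (.of_forall fun r => (integrable_char_mul (hi r) t).aestronglyMeasurable) ?_
    ((h0.const_mul _).add (h1.const_mul _))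
    (.of_forall fun ρ => Continuous.continuousAt (by fun_prop))
  filter_upwards [Iio_mem_nhds (show s < s + 1 by linarith)] with r hr
  filter_upwards [compl_mem_ae_iff.2 (measure_singleton (0 : ℝ))] with ρ hρ
  have hr' : r ≤ s + 1 := le_of_lt hr
  have := hb (r + Real.log ρ)
  rw [exp_mul_add_log hρ, exp_mul_add_log hρ] at this
  rw [norm_mul, Complex.norm_exp_ofReal_mul_I, one_mul, norm_mul]
  calc _ ≤ ‖Φ ρ‖ * (b * (Real.exp (α * r) * |ρ| ^ α +
        Real.exp ((α + 1) * r) * |ρ| ^ (α + 1))) := by gcongr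
    _ = b * Real.exp (α * r) * (‖Φ ρ‖ * |ρ| ^ α) +
      b * Real.exp ((α + 1) * r) * (‖Φ ρ‖ * |ρ| ^ (α + 1)) := by ring
    _ ≤ _ := by gcongr

namespace DyKernel

variable {α : ℝ} {k : ℝ → ℂ}

lemma continuous_piece (K : DyKernel α k) (n : ℕ) : Continuous (K.piece n) :=
  continuous_iff_continuousAt.2 fun s => (K.hasDerivAt n s).continuousAt

lemma norm_piece_le (K : DyKernel α k) (n : ℕ) (s : ℝ) :
    ‖K.piece n s‖ ≤ K.bd * (Real.exp (α * s) + Real.exp ((α + 1) * s)) :=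
  (K.norm_le n s).trans (mul_le_mul_of_nonneg_left
    (le_add_of_nonneg_right (Real.exp_pos _).le) K.bd_nonneg)

lemma lintegral_eLpNorm_piece_le (K : DyKernel α k) (hα : 0 ≤ α) {q : ℝ} (hq : 2 < q)
    {Φ : ℝ → ℂ} (hΦ : Measurable Φ) (h0 : Integrable (fun ρ => ‖Φ ρ‖ * |ρ| ^ α))
    (h1 : Integrable (fun ρ => ‖Φ ρ‖ * |ρ| ^ (α + 1))) (n : ℕ) :
    ∫⁻ t, eLpNorm (transInt Φ (K.piece n) t) (ENNReal.ofReal q) volume ^ 2 ≤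
      8 * ENNReal.ofReal K.bd * (∫⁻ ρ, ‖Φ ρ‖ₑ ^ 2) *
        (ENNReal.ofReal ((1 / 2) ^ (1 / q)) ^ n) ^ 2 := by
  have hc := K.continuous_piece n
  set A := ∫⁻ ρ, ‖Φ ρ‖ₑ ^ 2
  have hδ : (0 : ℝ) < (1 / 2) ^ n := by positivity
  have hi := integrable_transInt hΦ hc.measurable h0 h1 (K.norm_piece_le n)
  have hi' := integrable_transInt hΦ (K.continuous' n).measurable h0 h1 (K.norm_le' n)
  have hcont : ∀ t, Continuous (transInt Φ (K.piece' n) t) := by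
    exact fun t => continuous_transInt hΦ hα h0 h1 (K.continuous' n) (K.norm_le' n) t
  have hpt : ∀ t, eLpNorm (transInt Φ (K.piece n) t) (ENNReal.ofReal q) volume ^ 2 ≤
      2 * ENNReal.ofReal ((1 / 2) ^ n) ^ (2 / q) * (ENNReal.ofReal ((1 / 2) ^ n)⁻¹ *
      (∫⁻ s, ‖transInt Φ (K.piece n) t s‖ₑ ^ 2) + ENNReal.ofReal ((1 / 2) ^ n) *
      ∫⁻ s, ‖transInt Φ (K.piece' n) t s‖ₑ ^ 2) := fun t =>
    eLpNorm_sq_le_of_hasDerivAt (fun s => hasDerivAt_transInt hΦ hα h0 h1 (K.hasDerivAt n)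
      (K.continuous' n) (K.norm_piece_le n) (K.norm_le' n) t s) (hcont t) hδ hq
  have hδq : ENNReal.ofReal ((1 / 2) ^ n) ^ (2 / q) =
      (ENNReal.ofReal ((1 / 2) ^ (1 / q)) ^ n) ^ 2 := by
    rw [ENNReal.ofReal_rpow_of_pos hδ, ← ENNReal.ofReal_pow (by positivity),
      ← ENNReal.ofReal_pow (by positivity)]
    congr 1
    rw [← pow_mul, ← Real.rpow_natCast, ← Real.rpow_natCast, ← Real.rpow_mul (by norm_num),
      ← Real.rpow_mul (by norm_num)]
    congr 1
    push_cast
    ring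
  have hm1 : Measurable fun t => ∫⁻ s, ‖transInt Φ (K.piece n) t s‖ₑ ^ 2 :=
    Measurable.lintegral_prod_right' ((measurable_transInt hΦ hc.measurable).enorm.pow_const _)
  have hm2 : Measurable fun t => ∫⁻ s, ‖transInt Φ (K.piece' n) t s‖ₑ ^ 2 :=
    Measurable.lintegral_prod_right'
      ((measurable_transInt hΦ (K.continuous' n).measurable).enorm.pow_const _)
  have hb1 : ENNReal.ofReal ((1 / 2) ^ n)⁻¹ * ENNReal.ofReal (K.bd / 2 ^ n) =
      ENNReal.ofReal K.bd := by
    rw [← ENNReal.ofReal_mul (by positivity)]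
    congr 1
    rw [one_div, inv_pow, inv_inv]; field_simp
  have hb2 : ENNReal.ofReal ((1 / 2) ^ n) * ENNReal.ofReal (K.bd * 2 ^ n) =
      ENNReal.ofReal K.bd := by
    rw [← ENNReal.ofReal_mul (by positivity)]
    congr 1
    rw [one_div, inv_pow]; field_simp
  calc ∫⁻ t, eLpNorm (transInt Φ (K.piece n) t) (ENNReal.ofReal q) volume ^ 2
      ≤ ∫⁻ t, _ := lintegral_mono hpt
    _ = 2 * ENNReal.ofReal ((1 / 2) ^ n) ^ (2 / q) * (ENNReal.ofReal ((1 / 2) ^ n)⁻¹ *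
      (∫⁻ t, ∫⁻ s, ‖transInt Φ (K.piece n) t s‖ₑ ^ 2) + ENNReal.ofReal ((1 / 2) ^ n) *
      ∫⁻ t, ∫⁻ s, ‖transInt Φ (K.piece' n) t s‖ₑ ^ 2) := by
        rw [lintegral_const_mul _ (by fun_prop), lintegral_add_left (hm1.const_mul _),
            lintegral_const_mul _ hm1,
          lintegral_const_mul _ hm2]
    _ ≤ 2 * ENNReal.ofReal ((1 / 2) ^ n) ^ (2 / q) * (ENNReal.ofReal ((1 / 2) ^ n)⁻¹ *
      (2 * ENNReal.ofReal (K.bd / 2 ^ n) * A) + ENNReal.ofReal ((1 / 2) ^ n) *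
      (2 * ENNReal.ofReal (K.bd * 2 ^ n) * A)) := by
        gcongr
        · exact (lintegral_transInt_sq_le hΦ hc.measurable hi).trans
            (mul_le_mul_left (mul_le_mul_right (K.lintegral_le n) _) _)
        · exact (lintegral_transInt_sq_le hΦ (K.continuous' n).measurable hi').trans
            (mul_le_mul_left (mul_le_mul_right (K.lintegral_le' n) _) _)
    _ = 2 * ENNReal.ofReal ((1 / 2) ^ n) ^ (2 / q) *
        (2 * (ENNReal.ofReal ((1 / 2) ^ n)⁻¹ * ENNReal.ofReal (K.bd / 2 ^ n)) * A +
        2 * (ENNReal.ofReal ((1 / 2) ^ n) * ENNReal.ofReal (K.bd * 2 ^ n)) * A) := by ring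
    _ = _ := by rw [hb1, hb2, hδq]; ring

lemma transInt_sum_piece (K : DyKernel α k)
    {Φ : ℝ → ℂ} (hΦ : Measurable Φ) (h0 : Integrable (fun ρ => ‖Φ ρ‖ * |ρ| ^ α))
    (h1 : Integrable (fun ρ => ‖Φ ρ‖ * |ρ| ^ (α + 1))) (t : ℝ) (S : Finset ℕ) :
    transInt Φ (fun s => ∑ n ∈ S, K.piece n s) t = ∑ n ∈ S, transInt Φ (K.piece n) t := by
  ext s
  simp only [transInt, expInt, Finset.sum_apply, Finset.mul_sum]
  exact integral_finsetSum _ fun n _ => integrable_char_mul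
    (integrable_transInt hΦ (K.continuous_piece n).measurable h0 h1 (K.norm_piece_le n) s) t

lemma tendsto_transInt (K : DyKernel α k)
    {Φ : ℝ → ℂ} (hΦ : Measurable Φ) (h0 : Integrable (fun ρ => ‖Φ ρ‖ * |ρ| ^ α)) (t s : ℝ) :
    Filter.Tendsto (fun N : ℕ => transInt Φ (fun s => ∑ n ∈ Finset.range (N + 1), K.piece n s) t s)
      Filter.atTop (nhds (transInt Φ k t s)) := by
  refine tendsto_integral_of_dominated_convergence
    (fun ρ => K.bd * Real.exp (α * s) * (‖Φ ρ‖ * |ρ| ^ α)) (fun N => ?_) (h0.const_mul _)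
    (fun N => ?_) (.of_forall fun ρ => ((K.tendsto_sum _).const_mul _).const_mul _)
  · refine (Measurable.mul (Continuous.measurable (by fun_prop))
      (hΦ.mul ?_)).aestronglyMeasurable
    exact Finset.measurable_fun_sum _ fun n _ =>
      (K.continuous_piece n).measurable.comp (by fun_prop)
  · filter_upwards [compl_mem_ae_iff.2 (measure_singleton (0 : ℝ))] with ρ hρ
    have := K.norm_sum_le N (s + Real.log ρ)
    rw [exp_mul_add_log hρ] at this
    rw [norm_mul, Complex.norm_exp_ofReal_mul_I, one_mul, norm_mul]
    calc _ ≤ ‖Φ ρ‖ * (K.bd * (Real.exp (α * s) * |ρ| ^ α)) := by gcongr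
      _ = _ := by ring

lemma eLpNorm_transInt_sq_le (K : DyKernel α k) {q : ℝ} (hq : 1 ≤ q)
    {Φ : ℝ → ℂ} (hΦ : Measurable Φ) (h0 : Integrable (fun ρ => ‖Φ ρ‖ * |ρ| ^ α))
    (h1 : Integrable (fun ρ => ‖Φ ρ‖ * |ρ| ^ (α + 1))) (w : ℕ → ℝ≥0∞)
    (hw : ∀ n, w n ≠ 0) (hw' : ∀ n, w n ≠ ∞) (t : ℝ) :
    eLpNorm (transInt Φ k t) (ENNReal.ofReal q) volume ^ 2 ≤
      (∑' n, w n) * ∑' n, (w n)⁻¹ *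
        eLpNorm (transInt Φ (K.piece n) t) (ENNReal.ofReal q) volume ^ 2 := by
  set F : ℕ → ℝ≥0∞ := fun n =>
    eLpNorm (transInt Φ (K.piece n) t) (ENNReal.ofReal q) volume with hF
  have hmeas : ∀ n, AEStronglyMeasurable (transInt Φ (K.piece n) t) volume := fun n =>
    ((measurable_transInt hΦ (K.continuous_piece n).measurable).comp
      measurable_prodMk_left).aestronglyMeasurable
  have hN : ∀ N : ℕ, eLpNorm (transInt Φ (fun s => ∑ n ∈ Finset.range (N + 1), K.piece n s) t)
      (ENNReal.ofReal q) volume ≤ ((∑' n, w n) * ∑' n, (w n)⁻¹ * F n ^ 2) ^ (2⁻¹ : ℝ) := by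
    intro N
    rw [K.transInt_sum_piece hΦ h0 h1, ENNReal.le_rpow_inv_iff (by norm_num),
      ENNReal.rpow_ofNat]
    calc _ ≤ (∑ n ∈ Finset.range (N + 1), F n) ^ 2 := by
          gcongr
          exact eLpNorm_sum_le (fun n _ => hmeas n) (ENNReal.one_le_ofReal.2 hq)
      _ ≤ (∑ n ∈ Finset.range (N + 1), w n) *
          ∑ n ∈ Finset.range (N + 1), (w n)⁻¹ * F n ^ 2 :=
          ENNReal.sum_sq_le_mul_sum_inv _ _ _ hw hw'
      _ ≤ _ := by gcongr <;> exact ENNReal.sum_le_tsum _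
  have hlim : eLpNorm (transInt Φ k t) (ENNReal.ofReal q) volume ≤
      ((∑' n, w n) * ∑' n, (w n)⁻¹ * F n ^ 2) ^ (2⁻¹ : ℝ) := by
    refine (Lp.eLpNorm_lim_le_liminf_eLpNorm
      (f := fun N => transInt Φ (fun s => ∑ n ∈ Finset.range (N + 1), K.piece n s) t)
      (fun N => ?_) _ (.of_forall fun s => K.tendsto_transInt hΦ h0 t s)).trans
      (Filter.liminf_le_of_frequently_le' (Filter.Frequently.of_forall hN))
    rw [K.transInt_sum_piece hΦ h0 h1]
    exact Finset.aestronglyMeasurable_sum _ fun n _ => hmeas n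
  rwa [ENNReal.le_rpow_inv_iff (by norm_num), ENNReal.rpow_ofNat] at hlim

/-- The translates of a kernel with a dyadic decomposition satisfy an `L²_t L^q_s` bound. -/
theorem exists_lintegral_eLpNorm_transInt_le (K : DyKernel α k) (hα : 0 ≤ α) {q : ℝ} (hq : 2 < q) :
    ∃ C : ℝ, 0 ≤ C ∧ ∀ Φ : ℝ → ℂ, Measurable Φ → Integrable (fun ρ => ‖Φ ρ‖ * |ρ| ^ α) →
      Integrable (fun ρ => ‖Φ ρ‖ * |ρ| ^ (α + 1)) →
      ∫⁻ t, eLpNorm (transInt Φ k t) (ENNReal.ofReal q) volume ^ 2 ≤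
        ENNReal.ofReal C * ∫⁻ ρ, ‖Φ ρ‖ₑ ^ 2 := by
  have hq0 : 0 < q := by linarith
  have hr1 : ((1 / 2 : ℝ)) ^ (1 / q) < 1 :=
    Real.rpow_lt_one (by norm_num) (by norm_num) (by positivity)
  have hr0 : (0 : ℝ) < (1 / 2 : ℝ) ^ (1 / q) := by positivity
  obtain ⟨r, hr⟩ : ∃ r : ℝ≥0∞, r = ENNReal.ofReal ((1 / 2) ^ (1 / q)) := ⟨_, rfl⟩
  have hrlt : r < 1 := by rw [hr]; exact ENNReal.ofReal_lt_one.2 hr1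
  have hrne : r ≠ 0 := by rw [hr]; exact (ENNReal.ofReal_pos.2 hr0).ne'
  have hDt : (∑' n : ℕ, r ^ n) ^ 2 * (8 * ENNReal.ofReal K.bd) ≠ ∞ := by
    rw [ENNReal.tsum_geometric]
    refine ENNReal.mul_ne_top (ENNReal.pow_ne_top (ENNReal.inv_ne_top.2 ?_))
      (ENNReal.mul_ne_top (by norm_num) ENNReal.ofReal_ne_top)
    exact (tsub_pos_of_lt hrlt).ne'
  refine ⟨((∑' n : ℕ, r ^ n) ^ 2 * (8 * ENNReal.ofReal K.bd)).toReal, ENNReal.toReal_nonneg,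
    fun Φ hΦ h0 h1 => ?_⟩
  rw [ENNReal.ofReal_toReal hDt]
  have hFm : ∀ n, Measurable fun t => eLpNorm (transInt Φ (K.piece n) t)
      (ENNReal.ofReal q) volume ^ 2 := fun n =>
    (measurable_eLpNorm_transInt hΦ (K.continuous_piece n).measurable hq0).pow_const 2
  have hw : ∀ n, r ^ n ≠ 0 := fun n => pow_ne_zero _ hrne
  have hw' : ∀ n, r ^ n ≠ ∞ := fun n => ENNReal.pow_ne_top hrlt.ne_top
  have hF : ∀ n, ∫⁻ t, eLpNorm (transInt Φ (K.piece n) t) (ENNReal.ofReal q) volume ^ 2 ≤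
      8 * ENNReal.ofReal K.bd * (∫⁻ ρ, ‖Φ ρ‖ₑ ^ 2) * (r ^ n) ^ 2 := fun n => by
    rw [hr]
    exact K.lintegral_eLpNorm_piece_le hα hq hΦ h0 h1 n
  have hpt := K.eLpNorm_transInt_sq_le (q := q) (by linarith) hΦ h0 h1 (fun n => r ^ n) hw hw'
  generalize (∫⁻ ρ, ‖Φ ρ‖ₑ ^ 2) = A at *
  calc ∫⁻ t, eLpNorm (transInt Φ k t) (ENNReal.ofReal q) volume ^ 2
      ≤ ∫⁻ t, (∑' n : ℕ, r ^ n) * ∑' n, (r ^ n)⁻¹ * eLpNorm (transInt Φ (K.piece n) t)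
          (ENNReal.ofReal q) volume ^ 2 := lintegral_mono hpt
    _ = (∑' n : ℕ, r ^ n) * ∑' n, (r ^ n)⁻¹ * ∫⁻ t, eLpNorm (transInt Φ (K.piece n) t)
          (ENNReal.ofReal q) volume ^ 2 := by
        rw [lintegral_const_mul _ (Measurable.tsum fun n => (hFm n).const_mul _),
          lintegral_tsum fun n => ((hFm n).const_mul _).aemeasurable]
        congr 2
        ext n
        rw [lintegral_const_mul _ (hFm n)]
    _ ≤ (∑' n : ℕ, r ^ n) * ∑' n : ℕ, (8 * ENNReal.ofReal K.bd * A) * r ^ n := by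
        refine mul_le_mul_right (ENNReal.tsum_le_tsum fun n => ?_) _
        calc (r ^ n)⁻¹ * ∫⁻ t, eLpNorm (transInt Φ (K.piece n) t) (ENNReal.ofReal q) volume ^ 2
            ≤ (r ^ n)⁻¹ * (8 * ENNReal.ofReal K.bd * A * (r ^ n) ^ 2) :=
              mul_le_mul_right (hF n) _
          _ = 8 * ENNReal.ofReal K.bd * A * r ^ n * ((r ^ n)⁻¹ * r ^ n) := by ring
          _ = _ := by rw [ENNReal.inv_mul_cancel (hw n) (hw' n), mul_one]
    _ = (∑' n : ℕ, r ^ n) ^ 2 * (8 * ENNReal.ofReal K.bd) * A := by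
        rw [ENNReal.tsum_mul_left]
        ring

end DyKernel

section Uniqueness

variable {d : ℕ}

/-- The directional derivative of `W` along `a`. -/
def dirDeriv {P F : Type*} [NormedAddCommGroup P] [NormedSpace ℝ P] [NormedAddCommGroup F]
    [NormedSpace ℝ F] (W : P → F) (a p : P) : F := fderiv ℝ W p a

/-- Vanishing for `x` far away, locally uniformly in `t`. -/
def SpatialCompact (G : ℝ × Euc d → ℝ) : Prop :=
  ∀ T : ℝ, ∃ ρ : ℝ, ∀ t x, |t| ≤ T → ρ < ‖x‖ → G (t, x) = 0

lemma SpatialCompact.hasCompactSupport {G : ℝ × Euc d → ℝ} (hs : SpatialCompact G) (t : ℝ) :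
    HasCompactSupport fun x => G (t, x) := by
  obtain ⟨ρ, hρ⟩ := hs |t|
  refine HasCompactSupport.intro (isCompact_closedBall (0 : Euc d) ρ) fun x hx => hρ t x le_rfl ?_
  simpa using hx

lemma SpatialCompact.dirDeriv {G : ℝ × Euc d → ℝ} (hs : SpatialCompact G) (a : ℝ × Euc d) :
    SpatialCompact (dirDeriv G a) := by
  intro T
  obtain ⟨ρ, hρ⟩ := hs (T + 1)
  refine ⟨ρ, fun t x ht hx => ?_⟩
  have : G =ᶠ[nhds (t, x)] fun _ => 0 := by
    have h1 : ∀ᶠ y : ℝ × Euc d in nhds (t, x), |y.1| < T + 1 :=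
      (Continuous.tendsto (by fun_prop) _).eventually_lt_const (by simpa using by linarith)
    have h2 : ∀ᶠ y : ℝ × Euc d in nhds (t, x), ρ < ‖y.2‖ :=
      (Continuous.tendsto (by fun_prop) _).eventually_const_lt (by simpa using hx)
    filter_upwards [h1, h2] with y hy1 hy2 using hρ y.1 y.2 hy1.le hy2
  simp [_root_.dirDeriv, this.fderiv_eq]

lemma continuous_dirDeriv {P F : Type*} [NormedAddCommGroup P] [NormedSpace ℝ P]
    [NormedAddCommGroup F] [NormedSpace ℝ F] {W : P → F} (hW : ContDiff ℝ 1 W) (a : P) :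
    Continuous (dirDeriv W a) := by
  have := hW.continuous_fderiv (by norm_num)
  unfold dirDeriv
  fun_prop

lemma hasDerivAt_integral_of_spatialCompact {G : ℝ × Euc d → ℝ} (hG : ContDiff ℝ 1 G)
    (hs : SpatialCompact G) (t : ℝ) :
    HasDerivAt (fun t => ∫ x, G (t, x)) (∫ x, dirDeriv G (1, 0) (t, x)) t := by
  have hc := continuous_dirDeriv hG (1, 0)
  obtain ⟨ρ, hρ⟩ := hs.dirDeriv (1, 0) (|t| + 1)
  obtain ⟨M, hM⟩ := ((isCompact_Icc (a := t - 1) (b := t + 1)).prod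
    (isCompact_closedBall (0 : Euc d) ρ)).exists_bound_of_continuousOn hc.continuousOn
  have hGi : ∀ t, Integrable fun x => G (t, x) := fun t =>
    (hG.continuous.comp (by fun_prop)).integrable_of_hasCompactSupport (hs.hasCompactSupport t)
  refine (hasDerivAt_integral_of_dominated_loc_of_deriv_le (F := fun t x => G (t, x))
    (F' := fun t x => dirDeriv G (1, 0) (t, x)) (s := Ioo (t - 1) (t + 1))
    (bound := (Metric.closedBall (0 : Euc d) ρ).indicator fun _ => M)
    (Ioo_mem_nhds (by linarith) (by linarith))
    (.of_forall fun t => (hGi t).aestronglyMeasurable) (hGi t)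
    (Continuous.aestronglyMeasurable (hc.comp (by fun_prop)))
    (.of_forall fun x s hs => ?_) ?_ (.of_forall fun x s _ => ?_)).2
  · by_cases hx : x ∈ Metric.closedBall (0 : Euc d) ρ
    · rw [indicator_of_mem hx]
      exact hM (s, x) ⟨⟨hs.1.le, hs.2.le⟩, hx⟩
    · rw [indicator_of_notMem hx, hρ s x]
      · simp
      · rw [abs_le]
        constructor <;> cases abs_cases t <;> linarith [hs.1, hs.2]
      · simpa using hx
  · exact (integrable_indicator_iff measurableSet_closedBall).2
      (integrableOn_const (measure_closedBall_lt_top.ne))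
  · have h1 : HasDerivAt (fun s : ℝ => (s, x)) ((1 : ℝ), (0 : Euc d)) s :=
      (hasDerivAt_id s).prodMk (hasDerivAt_const s x)
    exact ((hG.differentiable (by norm_num)) (s, x)).hasFDerivAt.comp_hasDerivAt s h1

lemma integral_dirDeriv_space {G : ℝ × Euc d → ℝ} (hG : ContDiff ℝ 1 G)
    (hs : SpatialCompact G) (t : ℝ) (v : Euc d) :
    ∫ x, dirDeriv G (0, v) (t, x) = 0 := by
  have hd : ∀ x, HasFDerivAt (fun x => G (t, x))
      ((fderiv ℝ G (t, x)).comp (ContinuousLinearMap.inr ℝ ℝ (Euc d))) x := fun x =>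
    ((hG.differentiable (by norm_num)) (t, x)).hasFDerivAt.comp x (hasFDerivAt_prodMk_right t x)
  have he : ∀ x, fderiv ℝ (fun x => G (t, x)) x v = dirDeriv G (0, v) (t, x) := fun x => by
    rw [(hd x).fderiv]; simp [dirDeriv]
  have h := integral_mul_fderiv_eq_neg_fderiv_mul_of_integrable (μ := (volume : Measure (Euc d)))
    (f := fun _ => (1 : ℝ)) (g := fun x => G (t, x)) (v := v) (by simp) ?_ ?_ (by simp)
    (fun x _ => (hd x).differentiableAt)
  · simpa [he] using h
  · simp only [one_mul, he]
    exact ((continuous_dirDeriv hG (0, v)).comp (by fun_prop)).integrable_of_hasCompactSupport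
      ((hs.dirDeriv (0, v)).hasCompactSupport t)
  · simp only [one_mul]
    exact (hG.continuous.comp (by fun_prop)).integrable_of_hasCompactSupport
      (hs.hasCompactSupport t)

/-- A cutoff to the backward light cone. -/
def coneCut (R : ℝ) (p : ℝ × Euc d) : ℝ := expNegInvGlue (R - p.1 - √(1 + ‖p.2‖ ^ 2))

lemma coneCut_nonneg (R : ℝ) (p : ℝ × Euc d) : 0 ≤ coneCut R p := expNegInvGlue.nonneg _

lemma contDiff_coneCut (R : ℝ) : ContDiff ℝ 1 (coneCut R : ℝ × Euc d → ℝ) := by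
  refine (expNegInvGlue.contDiff (n := 1)).comp ((contDiff_const.sub contDiff_fst).sub ?_)
  exact (contDiff_const.add (contDiff_snd.norm_sq ℝ)).sqrt fun p => by positivity

lemma coneCut_pos {R t : ℝ} {x : Euc d} (h : t + √(1 + ‖x‖ ^ 2) < R) : 0 < coneCut R (t, x) :=
  expNegInvGlue.pos_of_pos (by simp only; linarith)

lemma spatialCompact_coneCut_mul (R : ℝ) (e : ℝ × Euc d → ℝ) :
    SpatialCompact fun p => coneCut R p * e p := by
  refine fun T => ⟨R + T, fun t x ht hx => ?_⟩
  have h1 : ‖x‖ ≤ √(1 + ‖x‖ ^ 2) := Real.le_sqrt_of_sq_le (by linarith)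
  have : coneCut R (t, x) = 0 := expNegInvGlue.zero_of_nonpos (by
    simp only; linarith [(abs_le.1 ht).1])
  simp [this]

lemma exists_hasFDerivAt_coneCut (R : ℝ) (p : ℝ × Euc d) : ∃ c : ℝ, 0 ≤ c ∧
    HasFDerivAt (coneCut R) (c • (-(ContinuousLinearMap.fst ℝ ℝ (Euc d)) -
      (√(1 + ‖p.2‖ ^ 2))⁻¹ • (innerSL ℝ p.2).comp (ContinuousLinearMap.snd ℝ ℝ (Euc d)))) p := by
  refine ⟨deriv expNegInvGlue (R - p.1 - √(1 + ‖p.2‖ ^ 2)), expNegInvGlue.monotone.deriv_nonneg,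
    ?_⟩
  have h1 : HasFDerivAt (fun p : ℝ × Euc d => R - p.1 - √(1 + ‖p.2‖ ^ 2))
      (-(ContinuousLinearMap.fst ℝ ℝ (Euc d)) -
      (√(1 + ‖p.2‖ ^ 2))⁻¹ • (innerSL ℝ p.2).comp (ContinuousLinearMap.snd ℝ ℝ (Euc d))) p := by
    refine HasFDerivAt.congr_fderiv ((hasFDerivAt_fst.const_sub R).sub
      ((hasFDerivAt_snd.norm_sq.const_add 1).sqrt (by positivity))) ?_
    congr 1
    ext y <;> simp
    ring
  exact (((expNegInvGlue.contDiff (n := 1)).differentiable (by norm_num)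
    _).hasDerivAt).comp_hasFDerivAt p h1

end Uniqueness

section Energy

variable {d : ℕ}

/-- The time direction in space-time. -/
def timeDir (d : ℕ) : ℝ × Euc d := (1, 0)

/-- The spatial coordinate directions in space-time. -/
def spaceDir {d : ℕ} (i : Fin d) : ℝ × Euc d := (0, EuclideanSpace.single i 1)

/-- The energy density. -/
def waveEnergy (W : ℝ × Euc d → ℂ) (p : ℝ × Euc d) : ℝ :=
  ‖dirDeriv W (timeDir d) p‖ ^ 2 + ∑ i, ‖dirDeriv W (spaceDir i) p‖ ^ 2

lemma contDiff_dirDeriv {P F : Type*} [NormedAddCommGroup P] [NormedSpace ℝ P]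
    [NormedAddCommGroup F] [NormedSpace ℝ F] {W : P → F} {n m : WithTop ℕ∞} (hW : ContDiff ℝ n W)
    (hm : m + 1 ≤ n) (a : P) : ContDiff ℝ m (dirDeriv W a) :=
  (hW.fderiv_right hm).clm_apply contDiff_const

lemma contDiff_waveEnergy {W : ℝ × Euc d → ℂ} (hW : ContDiff ℝ 2 W) :
    ContDiff ℝ 1 (waveEnergy W) := by
  have h : ∀ a, ContDiff ℝ 1 (dirDeriv W a) := fun a => contDiff_dirDeriv hW (by norm_num) a
  exact ((h _).norm_sq ℝ).add (ContDiff.sum fun i _ => (h _).norm_sq ℝ)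

lemma dirDeriv_dirDeriv_comm {P F : Type*} [NormedAddCommGroup P] [NormedSpace ℝ P]
    [NormedAddCommGroup F] [NormedSpace ℝ F] {W : P → F} (hW : ContDiff ℝ 2 W) (a b p : P) :
    dirDeriv (dirDeriv W a) b p = dirDeriv (dirDeriv W b) a p := by
  have hd : DifferentiableAt ℝ (fderiv ℝ W) p :=
    (hW.fderiv_right (m := 1) (by norm_num)).differentiable (by norm_num) p
  have h : ∀ a b, dirDeriv (dirDeriv W a) b p = fderiv ℝ (fderiv ℝ W) p b a := fun a b => by
    unfold dirDeriv
    rw [fderiv_clm_apply hd (differentiableAt_const a)]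
    simp
  rw [h, h]
  exact (hW.contDiffAt.isSymmSndFDerivAt (by simp)).eq b a

lemma dirDeriv_energy_sub_le {W : ℝ × Euc d → ℂ} (hW : ContDiff ℝ 2 W)
    (hwave : ∀ p, dirDeriv (dirDeriv W (timeDir d)) (timeDir d) p =
      ∑ i, dirDeriv (dirDeriv W (spaceDir i)) (spaceDir i) p) (R : ℝ) (p : ℝ × Euc d) :
    dirDeriv (fun p => coneCut R p * waveEnergy W p) (timeDir d) p ≤
      ∑ i, dirDeriv (fun p => coneCut R p * (2 * inner ℝ (dirDeriv W (timeDir d) p)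
        (dirDeriv W (spaceDir i) p))) (spaceDir i) p := by
  obtain ⟨c, hc, hψ⟩ := exists_hasFDerivAt_coneCut R p
  have hA : ∀ a, DifferentiableAt ℝ (dirDeriv W a) p := fun a =>
    (contDiff_dirDeriv (m := 1) hW (by norm_num) a).differentiable (by norm_num) p
  have hmul : ∀ (e : ℝ × Euc d → ℝ) v, DifferentiableAt ℝ e p →
      dirDeriv (fun p => coneCut R p * e p) v p =
      coneCut R p * dirDeriv e v p + e p * dirDeriv (coneCut R) v p := fun e v he => by
    simp only [dirDeriv]
    rw [fderiv_fun_mul hψ.differentiableAt he]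
    simp
  have hen : dirDeriv (waveEnergy W) (timeDir d) p = 2 * inner ℝ (dirDeriv W (timeDir d) p)
        (dirDeriv (dirDeriv W (timeDir d)) (timeDir d) p) +
      ∑ i, 2 * inner ℝ (dirDeriv W (spaceDir i) p)
        (dirDeriv (dirDeriv W (spaceDir i)) (timeDir d) p) := by
    have := ((hA (timeDir d)).hasFDerivAt.norm_sq.add (HasFDerivAt.fun_sum
      fun i (_ : i ∈ Finset.univ) => (hA (spaceDir i)).hasFDerivAt.norm_sq)).fderiv
    refine (congrArg (fun L => L (timeDir d)) this).trans ?_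
    simp [dirDeriv, mul_add]
  have hfl : ∀ i : Fin d, dirDeriv (fun p => (2 * inner ℝ (dirDeriv W (timeDir d) p)
      (dirDeriv W (spaceDir i) p) : ℝ)) (spaceDir i) p =
      2 * (inner ℝ (dirDeriv W (timeDir d) p) (dirDeriv (dirDeriv W (spaceDir i)) (spaceDir i) p) +
      inner ℝ (dirDeriv (dirDeriv W (timeDir d)) (spaceDir i) p) (dirDeriv W (spaceDir i) p)) :=
    fun i => by
    have := (((hA (timeDir d)).hasFDerivAt.inner ℝ
      (hA (spaceDir i)).hasFDerivAt).const_mul 2).fderiv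
    refine (congrArg (fun L => L (spaceDir i)) this).trans ?_
    simp [dirDeriv]
  have hψt : dirDeriv (coneCut R) (timeDir d) p = -c := by
    simp [dirDeriv, hψ.fderiv, timeDir]
  have hψx : ∀ i : Fin d, dirDeriv (coneCut R) (spaceDir i) p =
      -(c * ((√(1 + ‖p.2‖ ^ 2))⁻¹ * p.2 i)) := fun i => by
    simp [dirDeriv, hψ.fderiv, spaceDir, EuclideanSpace.inner_single_right]
  rw [hmul _ _ ((contDiff_waveEnergy hW).differentiable (by norm_num) p), hen, hψt]
  have hfd : ∀ i : Fin d, DifferentiableAt ℝ (fun p => (2 * inner ℝ (dirDeriv W (timeDir d) p)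
      (dirDeriv W (spaceDir i) p) : ℝ)) p := fun i => ((hA _).inner ℝ (hA _)).const_mul 2
  simp only [fun i => hmul _ (spaceDir i) (hfd i), hfl, hψx]
  rw [hwave p, inner_sum]
  have hcomm : ∀ i : Fin d, dirDeriv (dirDeriv W (spaceDir i)) (timeDir d) p =
      dirDeriv (dirDeriv W (timeDir d)) (spaceDir i) p := fun i => dirDeriv_dirDeriv_comm hW _ _ _
  simp only [hcomm]
  set A := dirDeriv W (timeDir d) p with hAdef
  set b : Fin d → ℝ := fun i => (√(1 + ‖p.2‖ ^ 2))⁻¹ * p.2 i with hb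
  have hb1 : ∑ i, b i ^ 2 ≤ 1 := by
    have h := EuclideanSpace.norm_sq_eq p.2
    simp only [Real.norm_eq_abs, sq_abs] at h
    simp only [hb, mul_pow, ← Finset.mul_sum, ← h, inv_pow]
    rw [Real.sq_sqrt (by positivity), inv_mul_le_iff₀ (by positivity)]
    linarith
  have key : ∑ i, 2 * inner ℝ A (dirDeriv W (spaceDir i) p) * b i ≤ waveEnergy W p := by
    calc ∑ i, 2 * inner ℝ A (dirDeriv W (spaceDir i) p) * b i
        ≤ ∑ i, (b i ^ 2 * ‖A‖ ^ 2 + ‖dirDeriv W (spaceDir i) p‖ ^ 2) := by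
          refine Finset.sum_le_sum fun i _ => ?_
          have e1 := abs_real_inner_le_norm A (dirDeriv W (spaceDir i) p)
          have e2 : inner ℝ A (dirDeriv W (spaceDir i) p) * b i ≤
              ‖A‖ * ‖dirDeriv W (spaceDir i) p‖ * |b i| := by
            refine (le_abs_self _).trans ?_
            rw [abs_mul]
            gcongr
          nlinarith [sq_nonneg (|b i| * ‖A‖ - ‖dirDeriv W (spaceDir i) p‖), sq_abs (b i)]
      _ = (∑ i, b i ^ 2) * ‖A‖ ^ 2 + ∑ i, ‖dirDeriv W (spaceDir i) p‖ ^ 2 := by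
          rw [Finset.sum_add_distrib, Finset.sum_mul]
      _ ≤ _ := by
          unfold waveEnergy
          gcongr
          exact mul_le_of_le_one_left (by positivity) hb1
  have hsum : ∑ i, (coneCut R p * (2 * (inner ℝ A (dirDeriv (dirDeriv W (spaceDir i))
      (spaceDir i) p) + inner ℝ (dirDeriv (dirDeriv W (timeDir d)) (spaceDir i) p)
      (dirDeriv W (spaceDir i) p))) + 2 * inner ℝ A (dirDeriv W (spaceDir i) p) *
      -(c * b i)) = coneCut R p * (2 * ∑ i, inner ℝ A (dirDeriv (dirDeriv W (spaceDir i))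
      (spaceDir i) p) + ∑ i, 2 * inner ℝ (dirDeriv W (spaceDir i) p)
      (dirDeriv (dirDeriv W (timeDir d)) (spaceDir i) p)) -
      c * ∑ i, 2 * inner ℝ A (dirDeriv W (spaceDir i) p) * b i := by
    simp only [Finset.mul_sum, ← Finset.sum_add_distrib, ← Finset.sum_sub_distrib]
    refine Finset.sum_congr rfl fun i _ => ?_
    rw [real_inner_comm (dirDeriv W (spaceDir i) p)]
    ring
  rw [hsum]
  have := mul_le_mul_of_nonneg_left key hc
  linarith

lemma dirDeriv_time_eq_zero_of_nonneg {W : ℝ × Euc d → ℂ} (hW : ContDiff ℝ 2 W)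
    (hwave : ∀ p, dirDeriv (dirDeriv W (timeDir d)) (timeDir d) p =
      ∑ i, dirDeriv (dirDeriv W (spaceDir i)) (spaceDir i) p)
    (h0 : ∀ x, W (0, x) = 0) (h1 : ∀ x, dirDeriv W (timeDir d) (0, x) = 0) {t : ℝ} (ht : 0 ≤ t)
    (x : Euc d) : dirDeriv W (timeDir d) (t, x) = 0 := by
  set R : ℝ := t + √(1 + ‖x‖ ^ 2) + 1 with hR
  have hA : ∀ a, ContDiff ℝ 1 (dirDeriv W a) := fun a => contDiff_dirDeriv hW (by norm_num) a
  have hsp := spatialCompact_coneCut_mul R (waveEnergy W)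
  have hG : ContDiff ℝ 1 fun p => coneCut R p * waveEnergy W p :=
    (contDiff_coneCut R).mul (contDiff_waveEnergy hW)
  have hF : ∀ i : Fin d, ContDiff ℝ 1 fun p => coneCut R p * (2 * inner ℝ
      (dirDeriv W (timeDir d) p) (dirDeriv W (spaceDir i) p)) := fun i =>
    (contDiff_coneCut R).mul (contDiff_const.mul ((hA _).inner ℝ (hA _)))
  have h_Gint : ∀ {G : ℝ × Euc d → ℝ} (t) (a), ContDiff ℝ 1 G → SpatialCompact G →
      Integrable fun x => dirDeriv G a (t, x) := fun t a hG hs =>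
    ((continuous_dirDeriv hG a).comp (by fun_prop)).integrable_of_hasCompactSupport
      ((hs.dirDeriv a).hasCompactSupport t)
  have hanti : Antitone fun t => ∫ x, coneCut R (t, x) * waveEnergy W (t, x) := by
    refine antitone_of_hasDerivAt_nonpos (hasDerivAt_integral_of_spatialCompact hG hsp) fun t => ?_
    calc ∫ x, dirDeriv (fun p => coneCut R p * waveEnergy W p) (1, 0) (t, x)
        ≤ ∫ x, ∑ i, dirDeriv (fun p => coneCut R p * (2 * inner ℝ (dirDeriv W (timeDir d) p)
        (dirDeriv W (spaceDir i) p))) (spaceDir i) (t, x) :=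
          integral_mono (h_Gint t _ hG hsp) (integrable_finsetSum _ fun i _ => h_Gint t _ (hF i)
            (spatialCompact_coneCut_mul R _)) fun x => dirDeriv_energy_sub_le hW hwave R (t, x)
      _ = 0 := by
          rw [integral_finsetSum _ fun i _ => h_Gint t _ (hF i) (spatialCompact_coneCut_mul R _)]
          exact Finset.sum_eq_zero fun i _ =>
            integral_dirDeriv_space (hF i) (spatialCompact_coneCut_mul R _) t _
  have hE0 : ∫ x, coneCut R (0, x) * waveEnergy W (0, x) = 0 := by
    have hs : ∀ (x : Euc d) (i : Fin d), dirDeriv W (spaceDir i) (0, x) = 0 := fun x i => by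
      have hd : HasFDerivAt (fun x => W (0, x))
        ((fderiv ℝ W (0, x)).comp (ContinuousLinearMap.inr ℝ ℝ (Euc d))) x :=
        ((hW.differentiable (by norm_num)) (0, x)).hasFDerivAt.comp x (hasFDerivAt_prodMk_right 0 x)
      have := hd.unique (by simp only [h0]; exact hasFDerivAt_const _ _)
      simpa [dirDeriv, spaceDir] using congrArg (fun L => L (EuclideanSpace.single i 1)) this
    simp [waveEnergy, h1, hs]
  have hnn : 0 ≤ fun x => coneCut R (t, x) * waveEnergy W (t, x) := fun x =>
    mul_nonneg (coneCut_nonneg _ _) (by unfold waveEnergy; positivity)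
  have hEt : ¬ 0 < ∫ x, coneCut R (t, x) * waveEnergy W (t, x) :=
    not_lt.2 ((hanti ht).trans_eq hE0)
  by_contra hne
  refine hEt (Continuous.integral_pos_of_hasCompactSupport_nonneg_nonzero (x := x)
    (hG.continuous.comp (by fun_prop : Continuous fun x : Euc d => (t, x)))
    (hsp.hasCompactSupport t) hnn (mul_pos (coneCut_pos (by linarith)) ?_).ne')
  unfold waveEnergy
  have : 0 < ‖dirDeriv W (timeDir d) (t, x)‖ ^ 2 := by positivity
  positivity

/-- Uniqueness for the wave equation with vanishing data. -/
theorem eq_zero_of_wave {W : ℝ × Euc d → ℂ} (hW : ContDiff ℝ 2 W)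
    (hwave : ∀ p, dirDeriv (dirDeriv W (timeDir d)) (timeDir d) p =
      ∑ i, dirDeriv (dirDeriv W (spaceDir i)) (spaceDir i) p)
    (h0 : ∀ x, W (0, x) = 0) (h1 : ∀ x, dirDeriv W (timeDir d) (0, x) = 0) (p : ℝ × Euc d) :
    W p = 0 := by
  have hneg : ∀ {F : Type} [NormedAddCommGroup F] [NormedSpace ℝ F] (V : ℝ × Euc d → F) (a p),
      Differentiable ℝ V → dirDeriv (fun q : ℝ × Euc d => V (-q.1, q.2)) a p =
        dirDeriv V (-a.1, a.2) (-p.1, p.2) := by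
    intro F _ _ V a p hV
    have h : HasFDerivAt (fun q : ℝ × Euc d => (-q.1, q.2))
      ((-(ContinuousLinearMap.fst ℝ ℝ (Euc d))).prod (ContinuousLinearMap.snd ℝ ℝ (Euc d))) p :=
      hasFDerivAt_fst.neg.prodMk hasFDerivAt_snd
    have := ((hV (-p.1, p.2)).hasFDerivAt.comp p h).fderiv
    simpa [dirDeriv, Function.comp_def] using congrArg (fun L => L a) this
  have ht : ∀ t x, dirDeriv W (timeDir d) (t, x) = 0 := by
    intro t x
    rcases le_total 0 t with h | h
    · exact dirDeriv_time_eq_zero_of_nonneg hW hwave h0 h1 h x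
    have hd := hW.differentiable (by norm_num)
    have hdd : ∀ a, Differentiable ℝ (dirDeriv W a) := fun a =>
      (contDiff_dirDeriv (m := 1) hW (by norm_num) a).differentiable (by norm_num)
    have e1 : ∀ a : ℝ × Euc d, dirDeriv (fun q : ℝ × Euc d => W (-q.1, q.2)) a =
        fun q => dirDeriv W (-a.1, a.2) (-q.1, q.2) := fun a => funext fun q => hneg W a q hd
    have et : dirDeriv W (-(timeDir d).1, (timeDir d).2) = -dirDeriv W (timeDir d) := by
      ext q
      have : (-(timeDir d).1, (timeDir d).2) = -timeDir d := by simp [timeDir]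
      simp [dirDeriv, this]
    have := dirDeriv_time_eq_zero_of_nonneg (W := fun q : ℝ × Euc d => W (-q.1, q.2))
      (hW.comp (by fun_prop : ContDiff ℝ 2 fun q : ℝ × Euc d => (-q.1, q.2))) (fun p => ?_)
      (fun x => by simpa using h0 x) (fun x => ?_) (neg_nonneg.2 h) x
    · rw [e1] at this
      simpa [et] using this
    · simp only [e1, fun a a' p => hneg _ a p (hdd a')]
      have h2 : dirDeriv (dirDeriv W (-(timeDir d).1, (timeDir d).2))
          (-(timeDir d).1, (timeDir d).2) (-p.1, p.2) =
          dirDeriv (dirDeriv W (timeDir d)) (timeDir d) (-p.1, p.2) := by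
        have h3 : (-(timeDir d).1, (timeDir d).2) = -timeDir d := by simp [timeDir]
        rw [et]
        rw [dirDeriv, fderiv_neg, h3]
        simp [dirDeriv]
      rw [h2, hwave]
      simp [spaceDir]
    · rw [e1]
      simp [et, h1]
  have hc : ∀ t x, HasDerivAt (fun t => W (t, x)) 0 t := fun t x => by
    have h1 : HasDerivAt (fun s : ℝ => (s, x)) ((1 : ℝ), (0 : Euc d)) t :=
      (hasDerivAt_id t).prodMk (hasDerivAt_const t x)
    rw [← ht t x]
    exact ((hW.differentiable (by norm_num)) (t, x)).hasFDerivAt.comp_hasDerivAt t h1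
  have := is_const_of_deriv_eq_zero (f := fun t => W (t, p.2)) (fun t => (hc t p.2).differentiableAt)
    (fun t => (hc t p.2).deriv) p.1 0
  simpa [h0] using this

end Energy

section HalfWave

variable {d : ℕ}

/-- A measurable amplitude all of whose moments are integrable. -/
def HasMoments (a : Euc d → ℂ) : Prop :=
  Measurable a ∧ ∀ n : ℕ, Integrable (fun ξ => ‖ξ‖ ^ n * ‖a ξ‖)

lemma HasMoments.integrable {a : Euc d → ℂ} (ha : HasMoments a) : Integrable a := by
  refine (integrable_norm_iff ha.1.aestronglyMeasurable).1 ?_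
  simpa using ha.2 0

/-- The superposition `∫ exp (2πi (σ t |ξ| + ⟨ξ, x⟩)) a(ξ) dξ` of plane waves on one sheet of the
light cone. -/
def halfWave (σ : ℝ) (a : Euc d → ℂ) (p : ℝ × Euc d) : ℂ :=
  ∫ ξ, Complex.exp ((2 * π * (σ * ‖ξ‖ * p.1 + inner ℝ ξ p.2) : ℝ) * Complex.I) * a ξ

/-- Minus the Euclidean pairing on space-time. -/
def conePairing (d : ℕ) : (ℝ × Euc d) →L[ℝ] (ℝ × Euc d) →L[ℝ] ℝ :=
  -((ContinuousLinearMap.mul ℝ ℝ).bilinearComp (.fst ℝ ℝ (Euc d)) (.fst ℝ ℝ (Euc d)) +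
    ContinuousLinearMap.bilinearComp (σ₁₃ := .id ℝ) (σ₂₃ := .id ℝ)
      (innerSL ℝ : Euc d →L[ℝ] Euc d →L[ℝ] ℝ) (.snd ℝ ℝ (Euc d)) (.snd ℝ ℝ (Euc d)))

lemma conePairing_apply (v w : ℝ × Euc d) :
    conePairing d v w = -(v.1 * w.1 + inner ℝ v.2 w.2) := by
  simp [conePairing, innerSL_apply_apply ℝ]

/-- Lebesgue measure lifted to one sheet of the light cone. -/
def coneMeasure (d : ℕ) (σ : ℝ) : Measure (ℝ × Euc d) :=
  volume.map fun ξ : Euc d => (σ * ‖ξ‖, ξ)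

lemma measurable_coneLift (σ : ℝ) : Measurable fun ξ : Euc d => (σ * ‖ξ‖, ξ) := by fun_prop

lemma halfWave_eq_fourierIntegral {a : Euc d → ℂ} (ha : Measurable a) (σ : ℝ) :
    halfWave σ a = VectorFourier.fourierIntegral Real.fourierChar (coneMeasure d σ)
      (conePairing d).toLinearMap₁₂ fun v => a v.2 := by
  ext p
  have hc : Continuous fun v : ℝ × Euc d => conePairing d v p := by fun_prop
  rw [VectorFourier.fourierIntegral, coneMeasure, integral_map (measurable_coneLift σ).aemeasurable]
  · refine integral_congr_ae (ae_of_all _ fun ξ => ?_)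
    simp [Circle.smul_def, Real.fourierChar_apply, conePairing_apply]
  · refine AEStronglyMeasurable.fun_smul ?_ (ha.comp measurable_snd).aestronglyMeasurable
    exact (Real.continuous_fourierChar.comp hc.neg).aestronglyMeasurable

lemma integrable_coneMeasure {a : Euc d → ℂ} (ha : HasMoments a) {σ : ℝ} (hσ : |σ| = 1) (n : ℕ) :
    Integrable (fun v => ‖v‖ ^ n * ‖a v.2‖) (coneMeasure d σ) := by
  have hm : Measurable fun v : ℝ × Euc d => ‖v‖ ^ n * ‖a v.2‖ :=
    (measurable_norm.pow_const n).mul (ha.1.comp measurable_snd).norm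
  rw [coneMeasure, integrable_map_measure hm.aestronglyMeasurable (measurable_coneLift σ).aemeasurable]
  simpa [Function.comp_def, Prod.norm_def, hσ] using ha.2 n

lemma contDiff_halfWave {a : Euc d → ℂ} (ha : HasMoments a) {σ : ℝ} (hσ : |σ| = 1) :
    ContDiff ℝ 2 (halfWave σ a) := by
  rw [halfWave_eq_fourierIntegral ha.1]
  exact VectorFourier.contDiff_fourierIntegral (N := 2) _ fun n _ => integrable_coneMeasure ha hσ n

/-- The symbol of a directional derivative. -/
def coneSymbol (σ : ℝ) (b : ℝ × Euc d) (ξ : Euc d) : ℂ :=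
  (2 * π * (σ * ‖ξ‖ * b.1 + inner ℝ ξ b.2) : ℝ) * Complex.I

lemma HasMoments.coneSymbol_mul {a : Euc d → ℂ} (ha : HasMoments a) {σ : ℝ} (hσ : |σ| = 1)
    (b : ℝ × Euc d) : HasMoments fun ξ => coneSymbol σ b ξ * a ξ := by
  have hm : Measurable (coneSymbol σ b) := by unfold coneSymbol; fun_prop
  refine ⟨hm.mul ha.1, fun n => ?_⟩
  refine ((ha.2 (n + 1)).const_mul (2 * π * (|b.1| + ‖b.2‖))).mono' ?_ (ae_of_all _ fun ξ => ?_)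
  · exact ((measurable_norm.pow_const n).mul (hm.mul ha.1).norm).aestronglyMeasurable
  · have h : ‖coneSymbol σ b ξ‖ ≤ 2 * π * (|b.1| + ‖b.2‖) * ‖ξ‖ := by
      have h' : |σ * ‖ξ‖ * b.1 + inner ℝ ξ b.2| ≤ (|b.1| + ‖b.2‖) * ‖ξ‖ := by
        refine (abs_add_le _ _).trans ?_
        rw [abs_mul, abs_mul, hσ, abs_norm]
        linarith [abs_real_inner_le_norm ξ b.2]
      rw [coneSymbol, norm_mul, Complex.norm_I, mul_one, Complex.norm_real, Real.norm_eq_abs,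
        abs_mul, abs_of_nonneg (by positivity : 0 ≤ 2 * π), mul_assoc (2 * π)]
      gcongr
    rw [norm_mul, norm_pow, norm_norm, norm_norm, norm_mul]
    calc ‖ξ‖ ^ n * (‖coneSymbol σ b ξ‖ * ‖a ξ‖)
        ≤ ‖ξ‖ ^ n * ((2 * π * (|b.1| + ‖b.2‖) * ‖ξ‖) * ‖a ξ‖) := by gcongr
      _ = _ := by ring

lemma dirDeriv_halfWave {a : Euc d → ℂ} (ha : HasMoments a) {σ : ℝ} (hσ : |σ| = 1)
    (b : ℝ × Euc d) :
    dirDeriv (halfWave σ a) b = halfWave σ fun ξ => coneSymbol σ b ξ * a ξ := by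
  have h0 : Integrable (fun v : ℝ × Euc d => a v.2) (coneMeasure d σ) := by
    refine (integrable_norm_iff (ha.1.comp measurable_snd).aestronglyMeasurable).1 ?_
    simpa using integrable_coneMeasure ha hσ 0
  have h1 : Integrable (fun v : ℝ × Euc d => ‖v‖ * ‖a v.2‖) (coneMeasure d σ) := by
    simpa using integrable_coneMeasure ha hσ 1
  ext p
  have h := (VectorFourier.hasFDerivAt_fourierIntegral (conePairing d) h0 h1 p).fderiv
  rw [dirDeriv, halfWave_eq_fourierIntegral ha.1, h]
  have hi : Integrable (fun v => Real.fourierChar (-(conePairing d).toLinearMap₁₂ v p) •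
      VectorFourier.fourierSMulRight (conePairing d) (fun v => a v.2) v) (coneMeasure d σ) := by
    refine (VectorFourier.fourierIntegral_convergent_iff Real.continuous_fourierChar
      (conePairing d).continuous₂ p).2 ?_
    refine (h1.const_mul (2 * π * ‖conePairing d‖)).mono' h0.1.fourierSMulRight
      (ae_of_all _ fun v => ?_)
    simpa only [mul_assoc] using VectorFourier.norm_fourierSMulRight_le (conePairing d)
      (fun v => a v.2) v
  rw [VectorFourier.fourierIntegral, ContinuousLinearMap.integral_apply hi]
  have hm := (hi.apply_continuousLinearMap b).aestronglyMeasurable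
  rw [coneMeasure] at hm ⊢
  rw [integral_map (measurable_coneLift σ).aemeasurable hm, halfWave]
  refine integral_congr_ae (ae_of_all _ fun ξ => ?_)
  simp [Circle.smul_def, Real.fourierChar_apply, conePairing_apply, coneSymbol]
  ring

end HalfWave

section Representation

variable {d : ℕ}

lemma HasMoments.integrable_char_mul {a : Euc d → ℂ} (ha : HasMoments a) (σ : ℝ)
    (p : ℝ × Euc d) :
    Integrable fun ξ => Complex.exp
      ((2 * π * (σ * ‖ξ‖ * p.1 + inner ℝ ξ p.2) : ℝ) * Complex.I) * a ξ := by
  refine ha.integrable.norm.mono' ((Continuous.measurable (by fun_prop)).mul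
    ha.1).aestronglyMeasurable (ae_of_all _ fun ξ => ?_)
  rw [norm_mul, Complex.norm_exp_ofReal_mul_I, one_mul]

lemma halfWave_wave {a : Euc d → ℂ} (ha : HasMoments a) {σ : ℝ} (hσ : |σ| = 1)
    (p : ℝ × Euc d) :
    dirDeriv (dirDeriv (halfWave σ a) (timeDir d)) (timeDir d) p =
      ∑ i, dirDeriv (dirDeriv (halfWave σ a) (spaceDir i)) (spaceDir i) p := by
  have hb : ∀ b, HasMoments fun ξ => coneSymbol σ b ξ * (coneSymbol σ b ξ * a ξ) := fun b =>
    (ha.coneSymbol_mul hσ b).coneSymbol_mul hσ b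
  have h : ∀ b, dirDeriv (dirDeriv (halfWave σ a) b) b p =
      halfWave σ (fun ξ => coneSymbol σ b ξ * (coneSymbol σ b ξ * a ξ)) p := fun b => by
    rw [dirDeriv_halfWave ha hσ, dirDeriv_halfWave (ha.coneSymbol_mul hσ b) hσ]
  simp only [h, halfWave]
  rw [← integral_finsetSum _ fun i _ => (hb _).integrable_char_mul σ p]
  refine integral_congr_ae (ae_of_all _ fun ξ => ?_)
  have hσ2 : (σ : ℂ) ^ 2 = 1 := by rw [← Complex.ofReal_pow, ← sq_abs, hσ]; norm_num
  have hn : ((‖ξ‖ : ℝ) : ℂ) ^ 2 = ∑ i, ((ξ i : ℝ) : ℂ) ^ 2 := by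
    rw [← Complex.ofReal_pow, EuclideanSpace.norm_sq_eq]
    simp
  simp only [coneSymbol, timeDir, spaceDir, inner_zero_right, add_zero, mul_one, mul_zero,
    zero_add, EuclideanSpace.inner_single_right, one_mul]
  rw [← Finset.mul_sum]
  congr 1
  push_cast
  have : ∀ c : ℝ, (2 * (π : ℂ) * c * Complex.I) * (2 * (π : ℂ) * c * Complex.I * a ξ) =
      -(4 * π ^ 2 * a ξ) * (c : ℂ) ^ 2 := fun c => by
    linear_combination (4 * π ^ 2 * a ξ * (c : ℂ) ^ 2) * Complex.I_sq
  simp only [conj_trivial, this, ← Finset.mul_sum, ← hn]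
  have := this (σ * ‖ξ‖)
  push_cast at this
  rw [this, mul_pow, hσ2, one_mul]

lemma halfWave_zero_left (σ : ℝ) (a : Euc d → ℂ) (x : Euc d) :
    halfWave σ a (0, x) = FourierTransform.fourierInv a x := by
  rw [Real.fourierInv_eq', halfWave]
  simp

lemma HasMoments.add {a b : Euc d → ℂ} (ha : HasMoments a) (hb : HasMoments b) :
    HasMoments fun ξ => a ξ + b ξ := by
  refine ⟨ha.1.add hb.1, fun n => ((ha.2 n).add (hb.2 n)).mono'
    ((measurable_norm.pow_const n).mul (ha.1.add hb.1).norm).aestronglyMeasurable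
    (ae_of_all _ fun ξ => ?_)⟩
  rw [norm_mul, norm_pow, norm_norm, norm_norm, Pi.add_apply, ← mul_add]
  gcongr
  exact norm_add_le _ _

lemma HasMoments.const_mul {a : Euc d → ℂ} (ha : HasMoments a) (c : ℂ) :
    HasMoments fun ξ => c * a ξ := by
  refine ⟨ha.1.const_mul c, fun n => ?_⟩
  simpa [mul_left_comm] using (ha.2 n).const_mul ‖c‖

lemma hasMoments_schwartz (φ : SchwartzMap (Euc d) ℂ) : HasMoments φ :=
  ⟨φ.continuous.measurable, fun n => φ.integrable_pow_mul volume n⟩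

lemma integrable_indicator_inv_norm [Nontrivial (Euc d)] (hd : 2 ≤ d) :
    Integrable fun ξ : Euc d => (Iic (1 : ℝ)).indicator (fun r => r⁻¹) ‖ξ‖ := by
  have hm : Measurable ((Iic (1 : ℝ)).indicator fun r : ℝ => r⁻¹) :=
    measurable_inv.indicator measurableSet_Iic
  refine ⟨(hm.comp measurable_norm).aestronglyMeasurable, ?_⟩
  rw [hasFiniteIntegral_iff_enorm]
  rw [lintegral_comp_norm (f := fun r => ‖(Iic (1 : ℝ)).indicator (fun r => r⁻¹) r‖ₑ) hm.enorm]
  refine ENNReal.mul_lt_top (measure_lt_top _ _) ?_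
  calc _ ≤ ∫⁻ r in Ioi (0 : ℝ), (Iic (1 : ℝ)).indicator 1 r := by
        refine setLIntegral_mono (measurable_one.indicator measurableSet_Iic) fun r hr => ?_
        by_cases h : r ≤ 1
        · rw [indicator_of_mem (by exact h), indicator_of_mem (by exact h),
            enorm_of_nonneg (inv_nonneg.2 (mem_Ioi.1 hr).le),
            ← ENNReal.ofReal_mul (pow_nonneg (mem_Ioi.1 hr).le _), finrank_euclideanSpace_fin,
            Pi.one_apply, ENNReal.ofReal_le_one]
          obtain ⟨k, rfl⟩ := Nat.exists_eq_add_of_le hd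
          rw [show 2 + k - 1 = k + 1 by omega, pow_succ, mul_assoc,
            mul_inv_cancel₀ (mem_Ioi.1 hr).ne', mul_one]
          exact pow_le_one₀ (mem_Ioi.1 hr).le h
        · simp [h]
    _ ≤ volume (Ioc (0 : ℝ) 1) := by
        rw [lintegral_indicator_one measurableSet_Iic, Measure.restrict_apply measurableSet_Iic,
          inter_comm, Ioi_inter_Iic]
    _ < ∞ := by simp

lemma HasMoments.inv_norm_mul {a : Euc d → ℂ} [Nontrivial (Euc d)] (hd : 2 ≤ d)
    (ha : HasMoments a) {M : ℝ} (hM : ∀ ξ, ‖a ξ‖ ≤ M) :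
    HasMoments fun ξ => ((‖ξ‖⁻¹ : ℝ) : ℂ) * a ξ := by
  have hm : Measurable fun ξ => ((‖ξ‖⁻¹ : ℝ) : ℂ) * a ξ :=
    (Complex.measurable_ofReal.comp measurable_norm.inv).mul ha.1
  refine ⟨hm, fun n => ?_⟩
  have hm' := fun n => ((measurable_norm.pow_const n).mul hm.norm).aestronglyMeasurable (μ := volume)
  have hM0 : 0 ≤ M := (norm_nonneg _).trans (hM 0)
  cases n with
  | zero =>
    refine (((integrable_indicator_inv_norm hd).const_mul M).add (ha.2 0)).mono' (hm' 0)
      (ae_of_all _ fun ξ => ?_)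
    simp only [pow_zero, one_mul, norm_norm, norm_mul, Complex.norm_real, norm_inv, Pi.add_apply]
    by_cases h : ‖ξ‖ ≤ 1
    · rw [indicator_of_mem (by exact h), mul_comm]
      have := mul_le_mul_of_nonneg_right (hM ξ) (inv_nonneg.2 (norm_nonneg ξ))
      linarith [norm_nonneg (a ξ)]
    · rw [indicator_of_notMem (by exact h), mul_zero, zero_add]
      exact mul_le_of_le_one_left (norm_nonneg _) (inv_le_one_of_one_le₀ (not_le.1 h).le)
  | succ n =>
    refine (ha.2 n).mono' (hm' _) (ae_of_all _ fun ξ => ?_)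
    simp only [norm_norm, norm_mul, norm_pow, Complex.norm_real, norm_inv]
    rw [pow_succ, mul_assoc, ← mul_assoc ‖ξ‖]
    gcongr
    exact mul_le_of_le_one_left (norm_nonneg _) mul_inv_le_one

/-- The half-wave amplitudes of the free wave with data `(f, g)`. -/
def waveAmp (σ : ℝ) (f g : Euc d → ℂ) (ξ : Euc d) : ℂ :=
  1 / 2 * FourierTransform.fourier f ξ +
    σ / (4 * π * Complex.I) * (((‖ξ‖⁻¹ : ℝ) : ℂ) * FourierTransform.fourier g ξ)

lemma hasMoments_waveAmp [Nontrivial (Euc d)] (hd : 2 ≤ d) (σ : ℝ)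
    (f g : SchwartzMap (Euc d) ℂ) : HasMoments (waveAmp σ f g) := by
  have hF : ∀ f : SchwartzMap (Euc d) ℂ, HasMoments (FourierTransform.fourier (f : Euc d → ℂ)) :=
    fun f => by
      rw [← SchwartzMap.fourier_coe]
      exact hasMoments_schwartz _
  have hb : ∀ ξ, ‖FourierTransform.fourier (g : Euc d → ℂ) ξ‖ ≤
      SchwartzMap.seminorm ℝ 0 0 (FourierTransform.fourier g) := fun ξ => by
    rw [← SchwartzMap.fourier_coe]
    exact SchwartzMap.norm_le_seminorm ℝ _ ξ
  exact ((hF f).const_mul _).add (((hF g).inv_norm_mul hd hb).const_mul _)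

lemma halfWave_zero_left_add {a b : Euc d → ℂ} {φ : SchwartzMap (Euc d) ℂ} (ha : HasMoments a)
    (hb : HasMoments b)
    (h : ∀ᵐ ξ, a ξ + b ξ = FourierTransform.fourier (φ : Euc d → ℂ) ξ) (σ τ : ℝ) (x : Euc d) :
    halfWave σ a (0, x) + halfWave τ b (0, x) = φ x := by
  rw [halfWave_zero_left τ, ← halfWave_zero_left σ, halfWave, halfWave,
    ← integral_add (ha.integrable_char_mul σ _) (hb.integrable_char_mul σ _)]
  have hφ : FourierTransform.fourierInv (FourierTransform.fourier (φ : Euc d → ℂ)) x = φ x := by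
    rw [← SchwartzMap.fourier_coe, ← SchwartzMap.fourierInv_coe,
      FourierTransform.fourierInv_fourier_eq]
  rw [← hφ, ← halfWave_zero_left σ, halfWave]
  refine integral_congr_ae ?_
  filter_upwards [h] with ξ hξ
  rw [← hξ]
  ring

lemma wave_eq_halfWave_add [Nontrivial (Euc d)] (hd : 2 ≤ d) {u : ℝ → Euc d → ℂ}
    (hu : ContDiff ℝ 2 (Function.uncurry u))
    (hwave : ∀ t x, timeDeriv2C d u t x = spatialLapC d (u t) x)
    (f g : SchwartzMap (Euc d) ℂ) (h0 : ∀ x, u 0 x = f x)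
    (h1 : ∀ x, timeDerivC d u 0 x = g x) (t : ℝ) (x : Euc d) :
    u t x = halfWave 1 (waveAmp 1 f g) (t, x) + halfWave (-1) (waveAmp (-1) f g) (t, x) := by
  have hA : ∀ σ, HasMoments (waveAmp σ f g) := fun σ => hasMoments_waveAmp hd σ f g
  have hp : |(1 : ℝ)| = 1 := abs_one
  have hn : |(-1 : ℝ)| = 1 := by simp
  have hv1 := contDiff_halfWave (hA 1) hp
  have hv2 := contDiff_halfWave (hA (-1)) hn
  have hsub : ∀ {F G : ℝ × Euc d → ℂ} (b p), Differentiable ℝ F → Differentiable ℝ G →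
      dirDeriv (fun p => F p - G p) b p = dirDeriv F b p - dirDeriv G b p := fun b p hF hG => by
    simp [dirDeriv, fderiv_fun_sub (hF p) (hG p)]
  have hsub2 : ∀ {F G : ℝ × Euc d → ℂ} (b p), ContDiff ℝ 2 F → ContDiff ℝ 2 G →
      dirDeriv (dirDeriv (fun p => F p - G p) b) b p =
        dirDeriv (dirDeriv F b) b p - dirDeriv (dirDeriv G b) b p := fun b p hF hG => by
    rw [← hsub b p ((contDiff_dirDeriv (m := 1) hF (by norm_num) b).differentiable (by norm_num))
      ((contDiff_dirDeriv (m := 1) hG (by norm_num) b).differentiable (by norm_num))]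
    congr 1
    ext q
    exact hsub b q (hF.differentiable (by norm_num)) (hG.differentiable (by norm_num))
  have hdu := hu.differentiable (by norm_num)
  have ht : ∀ (F : ℝ × Euc d → ℂ), Differentiable ℝ F → ∀ t x,
      deriv (fun s => F (s, x)) t = dirDeriv F (timeDir d) (t, x) := fun F hF t x => by
    have := (hF (t, x)).hasFDerivAt.comp_hasDerivAt t
      ((hasDerivAt_id t).prodMk (hasDerivAt_const t x))
    exact this.deriv
  have hx : ∀ (F : ℝ × Euc d → ℂ), Differentiable ℝ F → ∀ i t x,
      fderiv ℝ (fun y => F (t, y)) x (EuclideanSpace.single i 1) =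
        dirDeriv F (spaceDir i) (t, x) := fun F hF i t x => by
    have := (hF (t, x)).hasFDerivAt.comp x
      ((hasFDerivAt_const t x).prodMk (hasFDerivAt_id x))
    have := congrArg (fun L => L (EuclideanSpace.single i 1)) this.fderiv
    simpa [dirDeriv, Function.comp_def, spaceDir] using this
  have hd1 : ∀ b, Differentiable ℝ (dirDeriv (Function.uncurry u) b) := fun b =>
    (contDiff_dirDeriv (m := 1) hu (by norm_num) b).differentiable (by norm_num)
  have hwave' : ∀ p, dirDeriv (dirDeriv (Function.uncurry u) (timeDir d)) (timeDir d) p =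
      ∑ i, dirDeriv (dirDeriv (Function.uncurry u) (spaceDir i)) (spaceDir i) p := by
    rintro ⟨t, x⟩
    have := hwave t x
    have h1 : deriv (fun s => u s x) = fun s => dirDeriv (Function.uncurry u) (timeDir d) (s, x) :=
      funext fun s => ht _ hdu s x
    have h2 : ∀ i, (fun y => fderiv ℝ (u t) y (EuclideanSpace.single i 1)) =
        fun y => dirDeriv (Function.uncurry u) (spaceDir i) (t, y) :=
      fun i => funext fun y => hx _ hdu i t y
    simp only [timeDeriv2C, spatialLapC, h1, h2] at this
    rw [← ht _ (hd1 _), this]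
    exact Finset.sum_congr rfl fun i _ => hx _ (hd1 _) i t x
  have key := eq_zero_of_wave
    (W := fun p => (Function.uncurry u p - halfWave 1 (waveAmp 1 f g) p) -
      halfWave (-1) (waveAmp (-1) f g) p) ((hu.sub hv1).sub hv2) ?_ ?_ ?_ (t, x)
  · simp only [Function.uncurry_apply_pair] at key
    linear_combination key
  · intro p
    simp only [hsub2 _ p (hu.sub hv1) hv2, hsub2 _ p hu hv1, Finset.sum_sub_distrib,
      halfWave_wave (hA _) hp, halfWave_wave (hA _) hn, hwave']
  · intro x
    have := halfWave_zero_left_add (φ := f) (hA 1) (hA (-1)) (ae_of_all _ fun ξ => ?_) 1 (-1) x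
    · simp only [Function.uncurry_apply_pair, h0, ← this]
      ring
    · simp only [waveAmp]
      push_cast
      ring
  · intro x
    have := halfWave_zero_left_add (φ := g) ((hA 1).coneSymbol_mul hp (timeDir d))
      ((hA (-1)).coneSymbol_mul hn (timeDir d)) ?_ 1 (-1) x
    · rw [hsub _ _ ((hu.sub hv1).differentiable (by norm_num))
        (hv2.differentiable (by norm_num)), hsub _ _ hdu (hv1.differentiable (by norm_num)),
        dirDeriv_halfWave (hA _) hp, dirDeriv_halfWave (hA _) hn, ← ht _ hdu]
      have h1x := h1 x
      simp only [timeDerivC] at h1x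
      simp only [Function.uncurry_apply_pair, h1x, ← this]
      ring
    · filter_upwards [compl_mem_ae_iff.2 (measure_singleton (0 : Euc d))] with ξ hξ
      have hξ : ((‖ξ‖ : ℝ) : ℂ) ≠ 0 := by simpa using hξ
      simp only [waveAmp, coneSymbol, timeDir, inner_zero_right]
      push_cast
      have hI := Complex.I_ne_zero
      have hπ : (π : ℂ) ≠ 0 := by exact_mod_cast pi_ne_zero
      field_simp
      ring

end Representation

lemma lintegral_eq_lintegral_Ioi_add_neg {F : ℝ → ℝ≥0∞} (hF : Measurable F) :
    ∫⁻ ρ, F ρ = ∫⁻ r in Ioi (0 : ℝ), (F r + F (-r)) := by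
  rw [lintegral_add_left hF, ← lintegral_add_compl F (measurableSet_Ioi (a := (0 : ℝ))), compl_Ioi,
    ← restrict_Iio_eq_restrict_Iic]
  congr 1
  have h := (Measure.measurePreserving_neg (volume : Measure ℝ)).setLIntegral_comp_preimage
    (measurableSet_Iio (a := (0 : ℝ))) hF
  simpa using h.symm

lemma integral_eq_integral_Ioi_add_neg {F : ℝ → ℂ} (hF : Integrable F) :
    ∫ ρ, F ρ = (∫ r in Ioi (0 : ℝ), F r) + ∫ r in Ioi (0 : ℝ), F (-r) := by
  rw [integral_comp_neg_Ioi (0 : ℝ) F, neg_zero, add_comm,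
    intervalIntegral.integral_Iic_add_Ioi hF.integrableOn hF.integrableOn]

section Polar

variable {d : ℕ} [Nontrivial (Euc d)]

lemma eLpNorm_comp_log_norm {q : ℝ} (hq : 0 < q) {w : Euc d → ℂ} {T : ℝ → ℂ} (hT : Measurable T)
    (hw : ∀ x, x ≠ 0 → ‖w x‖ₑ = ENNReal.ofReal (‖x‖ ^ (-(d / q))) * ‖T (Real.log ‖x‖)‖ₑ) :
    eLpNorm w (ENNReal.ofReal q) volume =
      sphMeas (Euc d) univ ^ (1 / q) * eLpNorm T (ENNReal.ofReal q) volume := by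
  have hd : 1 ≤ d := by
    have := Module.finrank_pos (R := ℝ) (M := Euc d)
    rwa [finrank_euclideanSpace_fin] at this
  rw [eLpNorm_eq_lintegral_rpow_enorm_toReal (by simpa using hq) ENNReal.ofReal_ne_top,
    eLpNorm_eq_lintegral_rpow_enorm_toReal (by simpa using hq) ENNReal.ofReal_ne_top,
    ENNReal.toReal_ofReal hq.le, ← ENNReal.mul_rpow_of_nonneg _ _ (by positivity)]
  congr 1
  calc ∫⁻ x, ‖w x‖ₑ ^ q = ∫⁻ x : Euc d,
        (ENNReal.ofReal (‖x‖ ^ (-(d / q))) * ‖T (Real.log ‖x‖)‖ₑ) ^ q := by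
        refine lintegral_congr_ae ?_
        filter_upwards [compl_mem_ae_iff.2 (measure_singleton (0 : Euc d))] with x hx
        rw [hw x hx]
    _ = _ := by
        rw [lintegral_comp_norm (f := fun r =>
          (ENNReal.ofReal (r ^ (-(d / q))) * ‖T (Real.log r)‖ₑ) ^ q)
          (by have := hT.comp Real.measurable_log; fun_prop), ← lintegral_exp_mul_comp_exp]
        congr 1
        refine lintegral_congr fun s => ?_
        rw [finrank_euclideanSpace_fin, Real.log_exp, ENNReal.mul_rpow_of_nonneg _ _ hq.le,
          ENNReal.ofReal_rpow_of_pos (by positivity), ← mul_assoc, ← mul_assoc,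
          ← ENNReal.ofReal_mul (by positivity), ← ENNReal.ofReal_mul (by positivity)]
        have : Real.exp s * Real.exp s ^ (d - 1) * (Real.exp s ^ (-(d / q))) ^ q = 1 := by
          rw [← pow_succ', Nat.sub_add_cancel hd, ← Real.rpow_mul (by positivity),
            neg_mul, div_mul_cancel₀ _ hq.ne', ← Real.rpow_natCast, ← Real.rpow_add (by positivity)]
          simp
        rw [this]
        simp

lemma halfWave_radial {a : Euc d → ℂ} (ha : HasMoments a) {e : Euc d} (he : ‖e‖ = 1)
    (hr : ∀ ξ, a ξ = a (‖ξ‖ • e)) (σ t : ℝ) (x : Euc d) :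
    halfWave σ a (t, x) = ∫ r in Ioi (0 : ℝ),
      Complex.exp ((2 * π * (σ * r * t) : ℝ) * Complex.I) *
        (((r ^ (d - 1) : ℝ) : ℂ) * a (r • e) * sphJ e (r * ‖x‖)) := by
  have hm : Measurable fun ξ => Complex.exp
      ((2 * π * (σ * ‖ξ‖ * t + inner ℝ ξ x) : ℝ) * Complex.I) * a ξ :=
    (Continuous.measurable (by fun_prop)).mul ha.1
  rw [halfWave, integral_polar (ha.integrable_char_mul σ (t, x)) hm, finrank_euclideanSpace_fin]
  refine setIntegral_congr_fun measurableSet_Ioi fun r hr0 => ?_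
  have hr0 : 0 < r := hr0
  have h : ∫ v, Complex.exp ((2 * π * (σ * ‖r • v‖ * t + inner ℝ (r • v) x) : ℝ) * Complex.I) *
      a (r • v) ∂sphMeas (Euc d) = ∫ v, Complex.exp ((2 * π * (σ * r * t) : ℝ) * Complex.I) *
        a (r • e) * (Complex.exp ((2 * π * inner ℝ v (r • x) : ℝ) * Complex.I) * 1)
          ∂sphMeas (Euc d) := by
    refine integral_congr_ae ?_
    filter_upwards [ae_norm_eq_one_sphMeas (V := Euc d)] with v hv
    rw [hr (r • v), norm_smul, hv, Real.norm_eq_abs, abs_of_pos hr0, mul_one, mul_one,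
      real_inner_smul_left, real_inner_smul_right, mul_add, Complex.ofReal_add, add_mul,
      Complex.exp_add]
    ring
  have h2 : sphJ e (r * ‖x‖) = ∫ v, Complex.exp ((2 * π * inner ℝ v (r • x) : ℝ) * Complex.I) * 1
      ∂sphMeas (Euc d) := by
    rw [← abs_of_pos hr0, ← Real.norm_eq_abs, ← norm_smul, ← expInt_sphMeas_one he, expInt,
      Real.norm_eq_abs, abs_of_pos hr0]
  dsimp only
  rw [h, integral_const_mul, h2]
  ring

end Polar

section LineAmp

variable {d : ℕ}

/-- Two radial amplitudes merged into a function on the line along the ray through `e`. -/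
def lineAmp (e : Euc d) (a b : Euc d → ℂ) (ρ : ℝ) : ℂ :=
  if 0 < ρ then a (ρ • e) else b (-ρ • e)

lemma measurable_lineAmp (e : Euc d) {a b : Euc d → ℂ} (ha : Measurable a) (hb : Measurable b) :
    Measurable (lineAmp e a b) := by
  refine Measurable.ite measurableSet_Ioi (ha.comp ?_) (hb.comp ?_) <;> fun_prop

variable [Nontrivial (Euc d)]

lemma lintegral_lineAmp {e : Euc d} {a b : Euc d → ℂ} (ha : Measurable a) (hb : Measurable b)
    (har : ∀ ξ, a ξ = a (‖ξ‖ • e)) (hbr : ∀ ξ, b ξ = b (‖ξ‖ • e)) {H : ℝ → ℂ → ℝ≥0∞}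
    (hH : Measurable (Function.uncurry H)) :
    sphMeas (Euc d) univ * ∫⁻ ρ, ENNReal.ofReal (|ρ| ^ (d - 1)) * H |ρ| (lineAmp e a b ρ) =
      ∫⁻ ξ, (H ‖ξ‖ (a ξ) + H ‖ξ‖ (b ξ)) := by
  have hms : Measurable fun r : ℝ => r • e := by fun_prop
  have hG : Measurable fun r : ℝ => H r (a (r • e)) + H r (b (r • e)) :=
    (hH.comp (measurable_id.prodMk (ha.comp hms))).add
      (hH.comp (measurable_id.prodMk (hb.comp hms)))
  have hF : Measurable fun ρ => ENNReal.ofReal (|ρ| ^ (d - 1)) * H |ρ| (lineAmp e a b ρ) :=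
    (Continuous.measurable (by fun_prop)).ennreal_ofReal.mul
      (hH.comp ((measurable_norm (α := ℝ)).prodMk (measurable_lineAmp e ha hb)))
  have h1 : ∫⁻ ξ, (H ‖ξ‖ (a ξ) + H ‖ξ‖ (b ξ)) =
      ∫⁻ ξ : Euc d, (H ‖ξ‖ (a (‖ξ‖ • e)) + H ‖ξ‖ (b (‖ξ‖ • e))) :=
    lintegral_congr fun ξ => by rw [← har, ← hbr]
  rw [h1, lintegral_comp_norm hG, lintegral_eq_lintegral_Ioi_add_neg hF,
    finrank_euclideanSpace_fin]
  congr 1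
  refine setLIntegral_congr_fun measurableSet_Ioi fun r hr => ?_
  have hr : 0 < r := hr
  simp [lineAmp, hr, hr.not_gt, abs_of_pos hr, mul_add]

lemma integrable_lineAmp {e : Euc d} {a b : Euc d → ℂ} (ha : HasMoments a) (hb : HasMoments b)
    (har : ∀ ξ, a ξ = a (‖ξ‖ • e)) (hbr : ∀ ξ, b ξ = b (‖ξ‖ • e)) (n : ℕ) :
    Integrable fun ρ => |ρ| ^ (d - 1 + n) * ‖lineAmp e a b ρ‖ := by
  have hm := measurable_lineAmp e ha.1 hb.1
  refine ⟨(Measurable.mul (Continuous.measurable (by fun_prop)) hm.norm).aestronglyMeasurable, ?_⟩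
  have h := lintegral_lineAmp ha.1 hb.1 har hbr (H := fun r z => ENNReal.ofReal (r ^ n) * ‖z‖ₑ)
    (Measurable.mul (Continuous.measurable (by fun_prop)).ennreal_ofReal measurable_snd.enorm)
  have hfin : ∀ {c : Euc d → ℂ}, HasMoments c →
      ∫⁻ ξ, ENNReal.ofReal (‖ξ‖ ^ n) * ‖c ξ‖ₑ < ∞ := fun {c} hc => by
    have := (hc.2 n).2
    rw [hasFiniteIntegral_iff_enorm] at this
    refine lt_of_eq_of_lt (lintegral_congr fun ξ => ?_) this
    rw [enorm_mul, enorm_norm, Real.enorm_of_nonneg (by positivity)]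
  have hma : Measurable fun ξ => ENNReal.ofReal (‖ξ‖ ^ n) * ‖a ξ‖ₑ :=
    (Continuous.measurable (by fun_prop)).ennreal_ofReal.mul ha.1.enorm
  rw [lintegral_add_left hma] at h
  have h2 := h.trans_lt (ENNReal.add_lt_top.2 ⟨hfin ha, hfin hb⟩)
  rw [hasFiniteIntegral_iff_enorm]
  refine lt_of_eq_of_lt (lintegral_congr fun ρ => ?_)
    (ENNReal.lt_top_of_mul_ne_top_right h2.ne sphMeas_univ_ne_zero)
  rw [enorm_mul, enorm_norm, Real.enorm_of_nonneg (by positivity), ← mul_assoc,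
    ← ENNReal.ofReal_mul (by positivity), pow_add]

lemma halfWave_add_eq_integral_lineAmp {e : Euc d} (he : ‖e‖ = 1) {a b : Euc d → ℂ}
    (ha : HasMoments a) (hb : HasMoments b) (har : ∀ ξ, a ξ = a (‖ξ‖ • e))
    (hbr : ∀ ξ, b ξ = b (‖ξ‖ • e)) (t : ℝ) (x : Euc d) :
    halfWave 1 a (t, x) + halfWave (-1) b (t, x) =
      ∫ ρ : ℝ, Complex.exp ((2 * π * (ρ * t) : ℝ) * Complex.I) *
        (((|ρ| ^ (d - 1) : ℝ) : ℂ) * lineAmp e a b ρ * sphJ e (|ρ| * ‖x‖)) := by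
  have hm := measurable_lineAmp e ha.1 hb.1
  have hi : Integrable fun ρ : ℝ => Complex.exp ((2 * π * (ρ * t) : ℝ) * Complex.I) *
        (((|ρ| ^ (d - 1) : ℝ) : ℂ) * lineAmp e a b ρ * sphJ e (|ρ| * ‖x‖)) := by
    have hJ : Continuous fun ρ : ℝ => sphJ e (|ρ| * ‖x‖) :=
      (continuous_sphJ e).comp (by fun_prop)
    refine ((integrable_lineAmp ha hb har hbr 0).const_mul
      ((sphMeas (Euc d)).real univ)).mono' ?_ (ae_of_all _ fun ρ => ?_)
    · exact (Measurable.mul (Continuous.measurable (by fun_prop)) (Measurable.mul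
        (Measurable.mul (Continuous.measurable (by fun_prop)) hm)
        hJ.measurable)).aestronglyMeasurable
    · rw [norm_mul, Complex.norm_exp_ofReal_mul_I, one_mul, norm_mul, norm_mul, mul_comm,
        Complex.norm_real, Real.norm_of_nonneg (by positivity), add_zero]
      gcongr
      exact norm_sphJ_le _ _
  rw [halfWave_radial ha he har, halfWave_radial hb he hbr, integral_eq_integral_Ioi_add_neg hi]
  congr 1 <;> refine setIntegral_congr_fun measurableSet_Ioi fun r hr => ?_ <;>
    have hr : 0 < r := hr
  · simp [lineAmp, hr, abs_of_pos hr]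
  · simp [lineAmp, hr.not_gt, abs_of_pos hr]

end LineAmp

section Core

/-- The logarithmically rescaled spherical kernel. -/
def logKernel (j : ℕ) (e : Euc (j + 3)) (s : ℝ) : ℂ :=
  Real.exp (((j : ℝ) + 1) / 2 * s) * sphJ e (Real.exp s)

lemma nonempty_dyKernel_logKernel {j : ℕ} {e : Euc (j + 3)} (he : ‖e‖ = 1) :
    Nonempty (DyKernel (((j : ℝ) + 1) / 2) (logKernel j e)) := by
  obtain ⟨C, hC, h⟩ := lintegral_sphJ_sq_gaussian_le he
  obtain ⟨C', -, h'⟩ := lintegral_sphJ'_sq_gaussian_le he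
  rw [finrank_euclideanSpace_fin] at h h'
  have hmono : ∀ {c c' R : ℝ}, c ≤ c' → 1 ≤ R → ENNReal.ofReal (c * R) ≤ ENNReal.ofReal (c' * R) :=
    fun h hR => ENNReal.ofReal_le_ofReal (mul_le_mul_of_nonneg_right h (by linarith))
  refine exists_dyKernel (C := max C C')
    (M := max ((sphMeas (Euc (j + 3))).real univ) (2 * π * (sphMeas (Euc (j + 3))).real univ))
    (hC.trans (le_max_left _ _))
    (fun R hR => (h R hR).trans (hmono (le_max_left _ _) hR))
    (fun R hR => (h' R hR).trans (hmono (le_max_right _ _) hR))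
    (fun r => (norm_sphJ_le e r).trans (le_max_left _ _))
    (fun r => (norm_sphJ'_le he r).trans (le_max_right _ _)) (hasDerivAt_sphJ e)
    (continuous_sphJ' e)

/-- The line amplitude with the weight of the logarithmic rescaling. -/
def logAmp {j : ℕ} (e : Euc (j + 3)) (a b : Euc (j + 3) → ℂ) (ρ : ℝ) : ℂ :=
  ((|ρ| ^ (((j : ℝ) + 3) / 2) : ℝ) : ℂ) * lineAmp e a b ρ

variable {j : ℕ} {e : Euc (j + 3)} {a b : Euc (j + 3) → ℂ}

lemma integrable_logAmp (ha : HasMoments a) (hb : HasMoments b) (har : ∀ ξ, a ξ = a (‖ξ‖ • e))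
    (hbr : ∀ ξ, b ξ = b (‖ξ‖ • e)) (n : ℕ) :
    Integrable fun ρ => ‖logAmp e a b ρ‖ * |ρ| ^ (((j : ℝ) + 1) / 2 + n) := by
  refine (integrable_lineAmp ha hb har hbr n).congr ?_
  filter_upwards [compl_mem_ae_iff.2 (measure_singleton (0 : ℝ))] with ρ hρ
  have hρ : 0 < |ρ| := abs_pos.2 hρ
  rw [logAmp, norm_mul, Complex.norm_real, Real.norm_of_nonneg (by positivity), mul_right_comm,
    ← Real.rpow_add hρ, ← Real.rpow_natCast]
  congr 2
  push_cast [show j + 3 - 1 + n = j + 2 + n by omega]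
  ring

lemma transInt_logAmp (he : ‖e‖ = 1) (ha : HasMoments a) (hb : HasMoments b)
    (har : ∀ ξ, a ξ = a (‖ξ‖ • e)) (hbr : ∀ ξ, b ξ = b (‖ξ‖ • e)) (t : ℝ)
    {x : Euc (j + 3)} (hx : x ≠ 0) :
    transInt (logAmp e a b) (logKernel j e) t (Real.log ‖x‖) =
      ((‖x‖ ^ (((j : ℝ) + 1) / 2) : ℝ) : ℂ) *
        (halfWave 1 a (t, x) + halfWave (-1) b (t, x)) := by
  have hx : 0 < ‖x‖ := norm_pos_iff.2 hx
  rw [halfWave_add_eq_integral_lineAmp he ha hb har hbr, ← integral_const_mul, transInt, expInt]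
  refine integral_congr_ae ?_
  filter_upwards [compl_mem_ae_iff.2 (measure_singleton (0 : ℝ))] with ρ hρ
  have hρ' : 0 < |ρ| := abs_pos.2 hρ
  have h1 : Real.exp (Real.log ‖x‖ + Real.log ρ) = |ρ| * ‖x‖ := by
    rw [Real.exp_add, Real.exp_log hx, Real.exp_log_eq_abs hρ, mul_comm]
  have h2 : Real.exp (((j : ℝ) + 1) / 2 * (Real.log ‖x‖ + Real.log ρ)) =
      ‖x‖ ^ (((j : ℝ) + 1) / 2) * |ρ| ^ (((j : ℝ) + 1) / 2) := by
    rw [mul_comm, Real.exp_mul, h1, mul_comm, Real.mul_rpow hx.le hρ'.le]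
  have h3 : |ρ| ^ (j + 3 - 1) = |ρ| ^ (((j : ℝ) + 3) / 2) * |ρ| ^ (((j : ℝ) + 1) / 2) := by
    rw [← Real.rpow_add hρ', ← Real.rpow_natCast]
    congr 1
    push_cast [show j + 3 - 1 = j + 2 by omega]
    ring
  have h4 : (inner ℝ ρ t : ℝ) = ρ * t := by simp [mul_comm]
  rw [logKernel, logAmp, h1, h2, h3, h4]
  push_cast
  ring

lemma lintegral_logAmp_sq (ha : HasMoments a) (hb : HasMoments b)
    (har : ∀ ξ, a ξ = a (‖ξ‖ • e)) (hbr : ∀ ξ, b ξ = b (‖ξ‖ • e)) :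
    ∫⁻ ρ, ‖logAmp e a b ρ‖ₑ ^ 2 = (sphMeas (Euc (j + 3)) univ)⁻¹ *
      ∫⁻ ξ, (ENNReal.ofReal ‖ξ‖ * ‖a ξ‖ₑ ^ 2 + ENNReal.ofReal ‖ξ‖ * ‖b ξ‖ₑ ^ 2) := by
  rw [← lintegral_lineAmp ha.1 hb.1 har hbr (H := fun r z => ENNReal.ofReal r * ‖z‖ₑ ^ 2)
    (Measurable.mul (Continuous.measurable (by fun_prop)).ennreal_ofReal
      (measurable_snd.enorm.pow_const 2)), ← mul_assoc, ENNReal.inv_mul_cancel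
      sphMeas_univ_ne_zero (measure_ne_top _ _), one_mul]
  refine lintegral_congr fun ρ => ?_
  rw [logAmp, enorm_mul, mul_pow, ← mul_assoc, ← ENNReal.ofReal_mul (by positivity),
    enorm_sq_eq_ofReal, Complex.norm_real, Real.norm_of_nonneg (by positivity)]
  congr 2
  rw [← Real.rpow_natCast, ← Real.rpow_mul (abs_nonneg _), ← pow_succ, ← Real.rpow_natCast]
  congr 1
  push_cast [show j + 3 - 1 + 1 = j + 3 by omega]
  ring

lemma exists_lintegral_eLpNorm_halfWave_add_le (he : ‖e‖ = 1) {q : ℝ} (hq : 2 < q) :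
    ∃ C : ℝ, 0 ≤ C ∧ ∀ a b : Euc (j + 3) → ℂ, HasMoments a → HasMoments b →
      (∀ ξ, a ξ = a (‖ξ‖ • e)) → (∀ ξ, b ξ = b (‖ξ‖ • e)) →
      ∫⁻ t, eLpNorm (fun x : Euc (j + 3) =>
        ((‖x‖ ^ (((j : ℝ) + 1) / 2 - ((j : ℝ) + 3) / q) : ℝ) : ℂ) *
          (halfWave 1 a (t, x) + halfWave (-1) b (t, x))) (ENNReal.ofReal q) volume ^ 2 ≤
        ENNReal.ofReal C *
          ∫⁻ ξ, (ENNReal.ofReal ‖ξ‖ * ‖a ξ‖ₑ ^ 2 + ENNReal.ofReal ‖ξ‖ * ‖b ξ‖ₑ ^ 2) := by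
  obtain ⟨K⟩ := nonempty_dyKernel_logKernel he
  obtain ⟨C, hC, h⟩ := K.exists_lintegral_eLpNorm_transInt_le (by positivity) hq
  have hk : Measurable (logKernel j e) :=
    (Complex.continuous_ofReal.comp (by fun_prop : Continuous fun s : ℝ =>
      Real.exp (((j : ℝ) + 1) / 2 * s))).measurable.mul
      ((continuous_sphJ e).comp Real.continuous_exp).measurable
  set S := sphMeas (Euc (j + 3)) univ with hS
  have hS0 : S ≠ 0 := sphMeas_univ_ne_zero
  have hSt : S ≠ ∞ := measure_ne_top _ _
  refine ⟨((S ^ (1 / q)) ^ 2 * S⁻¹).toReal * C, by positivity, fun a b ha hb har hbr => ?_⟩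
  have hΦm : Measurable (logAmp e a b) :=
    Measurable.mul (Complex.measurable_ofReal.comp (by fun_prop)) (measurable_lineAmp e ha.1 hb.1)
  have h0 := integrable_logAmp ha hb har hbr 0
  have h1 := integrable_logAmp ha hb har hbr 1
  simp only [Nat.cast_zero, add_zero, Nat.cast_one] at h0 h1
  have key := h _ hΦm h0 h1
  have hT : ∀ t, Measurable (transInt (logAmp e a b) (logKernel j e) t) := fun t =>
    (measurable_transInt hΦm hk).of_uncurry_left
  have hfin : (S ^ (1 / q)) ^ 2 * S⁻¹ ≠ ∞ := ENNReal.mul_ne_top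
    (ENNReal.pow_ne_top (ENNReal.rpow_ne_top_of_nonneg (by positivity) hSt))
    (ENNReal.inv_ne_top.2 hS0)
  have hpow : (S ^ (1 / q)) ^ 2 ≠ ∞ :=
    ENNReal.pow_ne_top (ENNReal.rpow_ne_top_of_nonneg (by positivity) hSt)
  calc _ = ∫⁻ t, (S ^ (1 / q)) ^ 2 *
        eLpNorm (transInt (logAmp e a b) (logKernel j e) t) (ENNReal.ofReal q) volume ^ 2 := by
        refine lintegral_congr fun t => ?_
        rw [eLpNorm_comp_log_norm (by linarith) (hT t), mul_pow]
        intro x hx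
        rw [transInt_logAmp he ha hb har hbr t hx, enorm_mul, enorm_mul, ← mul_assoc]
        congr 1
        have hx : 0 < ‖x‖ := norm_pos_iff.2 hx
        rw [← ofReal_norm, ← ofReal_norm, Complex.norm_real, Complex.norm_real,
          Real.norm_of_nonneg (by positivity), Real.norm_of_nonneg (by positivity),
          ← ENNReal.ofReal_mul (by positivity), ← Real.rpow_add hx]
        push_cast
        ring_nf
    _ ≤ (S ^ (1 / q)) ^ 2 * (ENNReal.ofReal C * ∫⁻ ρ, ‖logAmp e a b ρ‖ₑ ^ 2) := by
        rw [lintegral_const_mul' _ _ hpow]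
        gcongr
    _ = _ := by
        rw [lintegral_logAmp_sq ha hb har hbr, ENNReal.ofReal_mul ENNReal.toReal_nonneg,
          ENNReal.ofReal_toReal hfin]
        ring

end Core

section Data

variable {d : ℕ}

lemma fourier_radial {f : Euc d → ℂ} (hf : IsRadialC d f) {e : Euc d} (he : ‖e‖ = 1)
    (ξ : Euc d) :
    FourierTransform.fourier f ξ = FourierTransform.fourier f (‖ξ‖ • e) := by
  obtain ⟨g, hg⟩ := hf
  obtain ⟨A, hA⟩ := exists_linearIsometryEquiv_apply_eq (x := ‖ξ‖ • e) (y := ξ)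
    (by simp [norm_smul, he])
  have hfA : f ∘ A = f := funext fun x => by simp [hg]
  conv_lhs => rw [← hA, ← Real.fourier_comp_linearIsometry, hfA]

lemma waveAmp_radial {f g : Euc d → ℂ} (hf : IsRadialC d f) (hg : IsRadialC d g) {e : Euc d}
    (he : ‖e‖ = 1) (σ : ℝ) (ξ : Euc d) : waveAmp σ f g ξ = waveAmp σ f g (‖ξ‖ • e) := by
  rw [waveAmp, waveAmp, fourier_radial hf he, fourier_radial hg he, norm_smul, he, norm_norm,
    mul_one]

lemma sq_norm_waveAmp_add_le (f g : Euc d → ℂ) {ξ : Euc d} (hξ : ξ ≠ 0) :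
    ‖ξ‖ * ‖waveAmp 1 f g ξ‖ ^ 2 + ‖ξ‖ * ‖waveAmp (-1) f g ξ‖ ^ 2 ≤
      ‖ξ‖ ^ (2 * (1 / 2) : ℝ) * ‖FourierTransform.fourier f ξ‖ ^ 2 +
        ‖ξ‖ ^ (2 * (-(1 / 2)) : ℝ) * ‖FourierTransform.fourier g ξ‖ ^ 2 := by
  have hξ : 0 < ‖ξ‖ := norm_pos_iff.2 hξ
  set F := FourierTransform.fourier f ξ with hF
  set G := FourierTransform.fourier g ξ with hG
  have h1 : waveAmp 1 f g ξ =
      1 / 2 * F + 1 / (4 * π * Complex.I) * (((‖ξ‖⁻¹ : ℝ) : ℂ) * G) := by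
    simp [waveAmp, hF, hG]
  have h2 : waveAmp (-1) f g ξ =
      1 / 2 * F - 1 / (4 * π * Complex.I) * (((‖ξ‖⁻¹ : ℝ) : ℂ) * G) := by
    simp [waveAmp, hF, hG, neg_div, sub_eq_add_neg]
  have hx : ‖(1 / 2 * F : ℂ)‖ = ‖F‖ / 2 := by simp; ring
  have hy : ‖(1 / (4 * π * Complex.I) * (((‖ξ‖⁻¹ : ℝ) : ℂ) * G) : ℂ)‖ =
      ‖ξ‖⁻¹ * ‖G‖ / (4 * π) := by
    simp [abs_of_pos pi_pos]
    ring
  have hpar := parallelogram_law_with_norm ℝ (1 / 2 * F)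
    (1 / (4 * π * Complex.I) * (((‖ξ‖⁻¹ : ℝ) : ℂ) * G))
  rw [← h1, ← h2, hx, hy] at hpar
  have e1 : ‖ξ‖ ^ (2 * (1 / 2) : ℝ) = ‖ξ‖ := by norm_num
  have e2 : ‖ξ‖ ^ (2 * (-(1 / 2)) : ℝ) = ‖ξ‖⁻¹ := by
    rw [show (2 * (-(1 / 2)) : ℝ) = -1 by norm_num, Real.rpow_neg_one]
  have hπ : 2 / (4 * π) ^ 2 ≤ 1 := by
    rw [div_le_one (by positivity)]
    nlinarith [pi_gt_three]
  calc _ = ‖ξ‖ * (‖waveAmp 1 f g ξ‖ ^ 2 + ‖waveAmp (-1) f g ξ‖ ^ 2) := by ring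
    _ = 1 / 2 * (‖ξ‖ * ‖F‖ ^ 2) + 2 / (4 * π) ^ 2 * (‖ξ‖⁻¹ * ‖G‖ ^ 2) := by
        rw [hpar]
        field_simp
    _ ≤ 1 * (‖ξ‖ * ‖F‖ ^ 2) + 1 * (‖ξ‖⁻¹ * ‖G‖ ^ 2) := by gcongr; norm_num
    _ = _ := by rw [e1, e2, one_mul, one_mul]

lemma lintegral_waveAmp_le [Nontrivial (Euc d)] (f g : SchwartzMap (Euc d) ℂ) :
    ∫⁻ ξ : Euc d, (ENNReal.ofReal ‖ξ‖ * ‖waveAmp 1 f g ξ‖ₑ ^ 2 +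
        ENNReal.ofReal ‖ξ‖ * ‖waveAmp (-1) f g ξ‖ₑ ^ 2) ≤
      (∫⁻ ξ : Euc d, ENNReal.ofReal (‖ξ‖ ^ (2 * (1 / 2) : ℝ) *
        ‖FourierTransform.fourier (f : Euc d → ℂ) ξ‖ ^ 2)) +
      ∫⁻ ξ : Euc d, ENNReal.ofReal (‖ξ‖ ^ (2 * (-(1 / 2)) : ℝ) *
        ‖FourierTransform.fourier (g : Euc d → ℂ) ξ‖ ^ 2) := by
  have hm : Measurable fun ξ : Euc d => ENNReal.ofReal (‖ξ‖ ^ (2 * (1 / 2) : ℝ) *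
      ‖FourierTransform.fourier (f : Euc d → ℂ) ξ‖ ^ 2) := by
    rw [← SchwartzMap.fourier_coe]
    have := (FourierTransform.fourier f).continuous.measurable
    fun_prop
  rw [← lintegral_add_left hm]
  refine lintegral_mono_ae ?_
  filter_upwards [compl_mem_ae_iff.2 (measure_singleton (0 : Euc d))] with ξ hξ
  rw [enorm_sq_eq_ofReal, enorm_sq_eq_ofReal, ← ENNReal.ofReal_mul (norm_nonneg _),
    ← ENNReal.ofReal_mul (norm_nonneg _), ← ENNReal.ofReal_add (by positivity) (by positivity),
    ← ENNReal.ofReal_add (by positivity) (by positivity)]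
  exact ENNReal.ofReal_le_ofReal (sq_norm_waveAmp_add_le f g hξ)

end Data

/-- **Weighted Strichartz estimate for radial free waves** (Lemma 2.4). Let `d ≥ 3` and
`0 < θ ≤ 1`, and let `u` solve the free wave equation `∂ₜ²u = Δu` on `ℝ × ℝ^d` with
radial Schwartz data `(u₀, u₁)`. Then
`‖ |x|^{((d−2)/2)(1−θ)} u ‖_{L²_t L^{2d/((d−2)θ)}_x(ℝ × ℝ^d)}
  ≤ C (‖u₀‖_{Ḣ^{1/2}} + ‖u₁‖_{Ḣ^{−1/2}})`
with `C` depending only on `d` and `θ`. -/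
theorem weighted_radial_strichartz_estimate (d : ℕ) (hd : 3 ≤ d)
    (θ : ℝ) (hθ0 : 0 < θ) (hθ1 : θ ≤ 1) :
    ∃ C : ℝ, 0 < C ∧
      ∀ (u : ℝ → Euc d → ℂ) (u₀ u₁ : Euc d → ℂ),
        ContDiff ℝ (⊤ : ℕ∞) (Function.uncurry u) →
        (∀ t, IsSchwartzC d (u t)) →
        (∀ t x, timeDeriv2C d u t x = spatialLapC d (u t) x) →
        (∀ x, u 0 x = u₀ x) → (∀ x, timeDerivC d u 0 x = u₁ x) →
        IsSchwartzC d u₀ → IsSchwartzC d u₁ → IsRadialC d u₀ → IsRadialC d u₁ →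
        mixedNorm d 2 (ENNReal.ofReal (2 * (d : ℝ) / (((d : ℝ) - 2) * θ))) univ
            (fun t x => (‖x‖ ^ (((d : ℝ) - 2) / 2 * (1 - θ)) : ℝ) * u t x) ≤
          ENNReal.ofReal C *
            (sobolevNormC d (1 / 2) u₀ + sobolevNormC d (-(1 / 2)) u₁) := by
  obtain ⟨j, rfl⟩ : ∃ j, d = j + 3 := ⟨d - 3, by omega⟩
  have hj : (((j + 3 : ℕ) : ℝ) - 2) = (j : ℝ) + 1 := by push_cast; ring
  have hj0 : (0 : ℝ) < (j : ℝ) + 1 := by positivity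
  rw [hj]
  set q : ℝ := 2 * ((j + 3 : ℕ) : ℝ) / (((j : ℝ) + 1) * θ) with hq
  have hq2 : 2 < q := by
    rw [hq, lt_div_iff₀ (by positivity)]
    push_cast
    nlinarith
  have hexp : ((j : ℝ) + 1) / 2 * (1 - θ) = ((j : ℝ) + 1) / 2 - ((j : ℝ) + 3) / q := by
    have : (0 : ℝ) < (j : ℝ) + 3 := by positivity
    rw [hq]
    push_cast
    field_simp
  obtain ⟨e, he⟩ := exists_norm_eq (Euc (j + 3)) zero_le_one
  obtain ⟨C, hC, h⟩ := exists_lintegral_eLpNorm_halfWave_add_le he hq2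
  refine ⟨√C + 1, by positivity, ?_⟩
  rintro u u₀ u₁ hu - hwave h0 h1 ⟨f, hf⟩ ⟨g, hg⟩ hr0 hr1
  obtain rfl : u₀ = f := funext hf
  obtain rfl : u₁ = g := funext hg
  have hrep := wave_eq_halfWave_add (by omega) (contDiff_infty.1 hu 2) hwave f g h0 h1
  have key := (h _ _ (hasMoments_waveAmp (by omega) 1 f g) (hasMoments_waveAmp (by omega) (-1) f g)
    (waveAmp_radial hr0 hr1 he 1) (waveAmp_radial hr0 hr1 he (-1))).trans
    (mul_le_mul_right (lintegral_waveAmp_le f g) _)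
  simp only [← hrep, ← hexp] at key
  rw [mixedNorm, if_neg ENNReal.ofNat_ne_top, Measure.restrict_univ, ENNReal.toReal_ofNat]
  simp only [ENNReal.rpow_ofNat]
  refine (ENNReal.rpow_le_rpow key (by norm_num)).trans ?_
  rw [ENNReal.mul_rpow_of_nonneg _ _ (by norm_num), sobolevNormC, sobolevNormC]
  refine mul_le_mul' ?_ (ENNReal.rpow_add_le_add_rpow _ _ (by norm_num) (by norm_num))
  rw [ENNReal.ofReal_rpow_of_nonneg hC (by norm_num), ← Real.sqrt_eq_rpow]
  exact ENNReal.ofReal_le_ofReal (by linarith)
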